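/- Let p and q be primes with p ≡ 5 (mod 8) and q ≡ 3 (mod 8), d = pq, with Legendre symbol (p/q) = 1 and with -q a fourth power residue modulo p. Let X', Y', Z be positive integers with pX'² + qY'² = Z², gcd(X',Y') = gcd(Y',Z) = gcd(Z,X') = gcd(p, Y'Z) = gcd(q, X'Z) = 1, X' odd, Y' even, and Z ≡ 1 (mod 4). If either (Z is a fourth power residue modulo p and the Jacobi symbol (2X'/Z) = -1) or (Z is a quadratic residue but not a fourth power residue modulo p and the Jacobi symbol (2X'/Z) = 1), then for every n ≥ 1 the 2-class group of L_{n,d} is isomorphic to ℤ/2^{n+3}ℤ. -/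

import Mathlib

open IntermediateField NumberField

/-- The quadratic field `ℚ(√m)` realized inside `ℂ` (for `m` of either sign). -/
noncomputable def quadField (m : ℤ) : IntermediateField ℚ ℂ :=
  IntermediateField.adjoin ℚ {z : ℂ | z ^ 2 = (m : ℂ)}

/-- The 2-class group of a number field `K ⊆ ℂ`: the 2-primary component
(= 2-Sylow subgroup) of the ideal class group of its ring of integers. -/
noncomputable def twoClassGroup (K : IntermediateField ℚ ℂ) :
    Subgroup (ClassGroup (𝓞 K)) :=
  CommGroup.primaryComponent _ 2

/-- `h₂(m)`: the 2-class number of the quadratic field `ℚ(√m)`. -/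
noncomputable def h2 (m : ℤ) : ℕ := Nat.card (twoClassGroup (quadField m))

/-- `L_{n,d} = ℚ(ζ_{2^{n+2}}, √d)`, the `n`-th layer of the cyclotomic
`ℤ₂`-extension of `ℚ(√d, √-1)`. -/
noncomputable def Lfield (n : ℕ) (d : ℤ) : IntermediateField ℚ ℂ :=
  IntermediateField.adjoin ℚ
    ({z : ℂ | z ^ 2 ^ (n + 2) = 1} ∪ {z : ℂ | z ^ 2 = (d : ℂ)})

/-- `ℚ(ζ_{2^{n+2}} + ζ_{2^{n+2}}⁻¹, √d) = ℚ(2cos(2π/2^{n+2}), √d)`.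
For `d > 0` this is the maximal real subfield `L_{n,d}⁺` of `L_{n,d}`;
for `d < 0` it is the `n`-th layer `K_{n,|d|}` of the cyclotomic
`ℤ₂`-extension of the imaginary quadratic field `ℚ(√d)`. -/
noncomputable def LplusField (n : ℕ) (d : ℤ) : IntermediateField ℚ ℂ :=
  IntermediateField.adjoin ℚ
    ({((2 * Real.cos (2 * Real.pi / 2 ^ (n + 2)) : ℝ) : ℂ)} ∪ {z : ℂ | z ^ 2 = (d : ℂ)})

section SecPell

/-- two coprime positive integers with product `p q y²`. -/
lemma p0_split (p q : ℕ) (hp : p.Prime) (hq : q.Prime) (hpq : p ≠ q) (u v y : ℤ) (hu : 0 < u) (hv : 0 < v)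
    (huv : IsCoprime u v) (h : u * v = p * q * y ^ 2) :
    ∃ d e : ℕ, ∃ a b : ℤ, u = d * a ^ 2 ∧ v = e * b ^ 2 ∧
      ((d = 1 ∧ e = p * q) ∨ (d = p ∧ e = q) ∨ (d = q ∧ e = p) ∨ (d = p * q ∧ e = 1)) := by
  have hpI : Prime (p : ℤ) := Nat.prime_iff_prime_int.mp hp
  have hqI : Prime (q : ℤ) := Nat.prime_iff_prime_int.mp hq
  have hp0 : (0 : ℤ) < p := by exact_mod_cast hp.pos
  have hq0 : (0 : ℤ) < q := by exact_mod_cast hq.pos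
  have key : ∀ u v y : ℤ, 0 < u → 0 < v → IsCoprime u v → u * v = y ^ 2 →
      ∃ a b : ℤ, u = a ^ 2 ∧ v = b ^ 2 := by
    intro u v y hu hv huv h
    obtain ⟨a, ha⟩ := Int.sq_of_gcd_eq_one (Int.isCoprime_iff_gcd_eq_one.1 huv) h
    obtain ⟨b, hb⟩ := Int.sq_of_gcd_eq_one (Int.isCoprime_iff_gcd_eq_one.1 huv.symm) (by rw [mul_comm]; exact h)
    refine ⟨a, b, ?_, ?_⟩
    · rcases ha with ha | ha
      · exact ha
      · nlinarith [sq_nonneg a]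
    · rcases hb with ha | ha
      · exact ha
      · nlinarith [sq_nonneg b]
  have hcop : IsCoprime (p : ℤ) q := by
    rw [Nat.isCoprime_iff_coprime]; exact (Nat.coprime_primes hp hq).2 hpq
  have hpd : (p : ℤ) ∣ u * v := ⟨q * y ^ 2, by rw [h]; ring⟩
  have hqd : (q : ℤ) ∣ u * v := ⟨p * y ^ 2, by rw [h]; ring⟩
  rcases hpI.dvd_or_dvd hpd with h1 | h1 <;> rcases hqI.dvd_or_dvd hqd with h2 | h2
  · obtain ⟨w, rfl⟩ := hcop.mul_dvd h1 h2
    have hw : 0 < w := by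
      have : (0:ℤ) < p * q := by positivity
      exact pos_of_mul_pos_right hu this.le
    obtain ⟨a, b, ha, hb⟩ := key w v y hw hv huv.of_mul_left_right
      (by have : (p * q : ℤ) ≠ 0 := by positivity
          apply mul_left_cancel₀ this; rw [← h]; ring)
    exact ⟨p * q, 1, a, b, by rw [ha]; push_cast; ring, by rw [hb]; push_cast; ring, by simp⟩
  · obtain ⟨w, rfl⟩ := h1
    obtain ⟨w', rfl⟩ := h2
    obtain ⟨a, b, ha, hb⟩ := key w w' y (pos_of_mul_pos_right hu hp0.le)
      (pos_of_mul_pos_right hv hq0.le) huv.of_mul_left_right.of_mul_right_right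
      (by have : (p * q : ℤ) ≠ 0 := by positivity
          apply mul_left_cancel₀ this; rw [← h]; ring)
    exact ⟨p, q, a, b, by rw [ha], by rw [hb], by simp⟩
  · obtain ⟨w, rfl⟩ := h2
    obtain ⟨w', rfl⟩ := h1
    obtain ⟨a, b, ha, hb⟩ := key w w' y (pos_of_mul_pos_right hu hq0.le)
      (pos_of_mul_pos_right hv hp0.le) huv.of_mul_left_right.of_mul_right_right
      (by have : (p * q : ℤ) ≠ 0 := by positivity
          apply mul_left_cancel₀ this; rw [← h]; ring)
    exact ⟨q, p, a, b, by rw [ha], by rw [hb], by simp⟩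
  · obtain ⟨w, rfl⟩ := hcop.mul_dvd h1 h2
    have hw : 0 < w := by
      have : (0:ℤ) < p * q := by positivity
      exact pos_of_mul_pos_right hv this.le
    obtain ⟨a, b, ha, hb⟩ := key u w y hu hw huv.of_mul_right_right
      (by have : (p * q : ℤ) ≠ 0 := by positivity
          apply mul_left_cancel₀ this; rw [← h]; ring)
    exact ⟨1, p * q, a, b, by rw [ha]; push_cast; ring, by rw [hb]; push_cast; ring, by simp⟩

lemma p0_pell (p q : ℕ) (hp : p.Prime) (hq : q.Prime) (hp8 : p % 8 = 5) (hq8 : q % 8 = 3) :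
    ∃ a b κ ε : ℤ, (κ = 1 ∨ κ = 2) ∧ (ε = 1 ∨ ε = -1) ∧ p * a ^ 2 - q * b ^ 2 = ε * κ := by
  have := Fact.mk hp
  have := Fact.mk hq
  have hpq : p ≠ q := by rintro rfl; omega
  have hp0 : (0 : ℤ) < p := by exact_mod_cast hp.pos
  have hq0 : (0 : ℤ) < q := by exact_mod_cast hq.pos
  have hns : ¬ IsSquare ((p : ℤ) * q) := by
    rintro ⟨r, hr⟩
    have h1 : (p : ℤ) ∣ r := by
      have : (p : ℤ) ∣ r * r := ⟨q, hr.symm⟩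
      rcases (Nat.prime_iff_prime_int.mp hp).dvd_or_dvd this with h | h <;> exact h
    obtain ⟨s, rfl⟩ := h1
    have h2 : (q : ℤ) = p * (s * s) := by
      apply mul_left_cancel₀ hp0.ne'; rw [hr]; ring
    have h3 : p ∣ q := by
      have : (p : ℤ) ∣ q := ⟨_, h2⟩
      exact_mod_cast this
    exact hpq ((Nat.prime_dvd_prime_iff_eq hp hq).1 h3)
  obtain ⟨s, hs⟩ := Pell.IsFundamental.exists_of_not_isSquare (d := (p : ℤ) * q) (by positivity) hns
  have hx1 : 1 < s.x := hs.1
  have hxy := s.prop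
  have cases4 : ∀ u v y : ℤ, 0 < u → 0 < v → IsCoprime u v → u * v = p * q * y ^ 2 →
     ∀ κ, v - u = κ → (κ = 1 ∨ κ = 2) → 
      (¬ ∃ a b : ℤ, u = a ^ 2 ∧ v = p * q * b ^ 2) → (¬ ∃ a b : ℤ, u = p * q * a ^ 2 ∧ v = b ^ 2) →
      ∃ a b κ ε : ℤ, (κ = 1 ∨ κ = 2) ∧ (ε = 1 ∨ ε = -1) ∧ p * a ^ 2 - q * b ^ 2 = ε * κ := by
    intro u v y hu hv huv h κ hκ hκ2 n1 n2
    obtain ⟨d, e, a, b, ha, hb, hc⟩ := p0_split p q hp hq hpq u v y hu hv huv h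
    rcases hc with ⟨rfl, rfl⟩ | ⟨rfl, rfl⟩ | ⟨rfl, rfl⟩ | ⟨rfl, rfl⟩
    · exact absurd ⟨a, b, by simpa using ha, by simpa using hb⟩ n1
    · exact ⟨a, b, κ, -1, hκ2, by simp, by rw [← hκ, ← ha, ← hb]; ring⟩
    · exact ⟨b, a, κ, 1, hκ2, by simp, by rw [← hκ, ← ha, ← hb]; ring⟩
    · exact absurd ⟨a, b, by simpa using ha, by simpa using hb⟩ n2
  rcases Int.even_or_odd s.x with he | ho
  · refine cases4 (s.x - 1) (s.x + 1) s.y (by linarith) (by linarith) ?_ (by linarith) 2 (by ring) (by simp) ?_ ?_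
    · obtain ⟨t, ht⟩ := he
      exact ⟨t, 1 - t, by rw [ht]; ring⟩
    · rintro ⟨a, b, h1, h2⟩
      have h3 : ((a : ZMod p)) ^ 2 = -2 := by
        have : a ^ 2 = p * q * b ^ 2 - 2 := by rw [← h1, ← h2]; ring
        have := congrArg (Int.cast : ℤ → ZMod p) this
        push_cast at this; simpa using this
      have := (ZMod.exists_sq_eq_neg_two_iff (p := p) (by rintro rfl; omega)).1 ⟨_, by rw [← h3, sq]⟩
      omega
    · rintro ⟨a, b, h1, h2⟩
      have h3 : ((b : ZMod p)) ^ 2 = 2 := by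
        have : b ^ 2 = p * q * a ^ 2 + 2 := by rw [← h1, ← h2]; ring
        have := congrArg (Int.cast : ℤ → ZMod p) this
        push_cast at this; simpa using this
      have := (ZMod.exists_sq_eq_two_iff (p := p) (by rintro rfl; omega)).1 ⟨_, by rw [← h3, sq]⟩
      omega
  · obtain ⟨t, ht⟩ := ho
    have hye : Even s.y := by
      by_contra hne
      rw [Int.not_even_iff_odd] at hne
      have h1 : Odd ((p : ℤ) * q * s.y ^ 2) := by
        have a1 : Odd (p : ℤ) := by rw [Int.odd_iff]; omega
        have a2 : Odd (q : ℤ) := by rw [Int.odd_iff]; omega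
        exact (a1.mul a2).mul (hne.pow)
      have h2 : (p : ℤ) * q * s.y ^ 2 = 2 * (2 * t ^ 2 + 2 * t) := by
        rw [← sub_eq_zero]; rw [ht] at hxy; linarith
      rw [h2] at h1
      exact (Int.not_odd_iff_even.2 (even_two_mul _)) h1
    obtain ⟨r, hr⟩ := hye
    have ht0 : 0 < t := by linarith
    refine cases4 t (t + 1) r ht0 (by linarith) ⟨-1, 1, by ring⟩ (by rw [hr, ht] at hxy; linarith) 1 (by ring) (by simp) ?_ ?_
    · rintro ⟨a, b, h1, h2⟩
      have h3 : ((a : ZMod q)) ^ 2 = -1 := by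
        have : a ^ 2 = p * q * b ^ 2 - 1 := by rw [← h1, ← h2]; ring
        have := congrArg (Int.cast : ℤ → ZMod q) this
        push_cast at this; simpa using this
      have := (ZMod.exists_sq_eq_neg_one_iff (p := q)).1 ⟨_, by rw [← h3, sq]⟩
      omega
    · rintro ⟨a, b, h1, h2⟩
      have h3 : |b| ^ 2 - p * q * a ^ 2 = 1 := by rw [sq_abs]; linarith
      have hb1 : 1 < |b| := by
        by_contra hh
        push Not at hh
        have : b ^ 2 ≤ 1 := by rw [← sq_abs]; nlinarith [abs_nonneg b]
        linarith
      have := hs.x_le_x (a := Pell.Solution₁.mk |b| a h3) (by simpa using hb1)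
      rw [Pell.Solution₁.x_mk, ht] at this
      have h5 : b ^ 2 = |b| ^ 2 := (sq_abs b).symm
      nlinarith

end SecPell

section SecGroupLemmas

lemma p1_jac_congr (a b : ℤ) (n : ℕ) (h : ∀ l : ℕ, l.Prime → l ∣ n → jacobiSym a l = jacobiSym b l) :
    jacobiSym a n = jacobiSym b n := by
  induction n using induction_on_primes with
  | zero => simp
  | one => simp
  | prime_mul l m hl ih =>
    by_cases hm : m = 0
    · subst hm; simp
    rw [jacobiSym.mul_right' a hl.ne_zero hm, jacobiSym.mul_right' b hl.ne_zero hm,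
      h l hl (dvd_mul_right _ _), ih (fun l' hl' hd => h l' hl' (hd.mul_left _))]

lemma p1_jac_modeq {a b : ℤ} {n : ℕ} (h : (n : ℤ) ∣ a - b) : jacobiSym a n = jacobiSym b n := by
  apply jacobiSym.mod_left'
  exact (Int.modEq_iff_dvd.2 h).symm

lemma p1_natAbs {a : ℤ} {n : ℕ} (hn : n % 4 = 1) : jacobiSym (a.natAbs : ℤ) n = jacobiSym a n := by
  rcases Int.natAbs_eq a with h | h
  · rw [← h]
  · have h2 : (a.natAbs : ℤ) = - a := by omega
    rw [h2, jacobiSym.neg _ (Nat.odd_iff.2 (by omega)), ZMod.χ₄_nat_one_mod_four hn, one_mul]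

lemma p1_sq_one {a : ℤ} {n : ℕ} (h : IsCoprime a (n : ℤ)) : jacobiSym (a ^ 2) n = 1 :=
  jacobiSym.sq_one' (Int.isCoprime_iff_gcd_eq_one.1 h)

lemma p1_coprime_of {a b : ℤ} (hb : b ≠ 0) (h : ∀ l : ℕ, l.Prime → (l : ℤ) ∣ a → (l : ℤ) ∣ b → False) : IsCoprime a b := by
  rw [Int.isCoprime_iff_gcd_eq_one]
  by_contra hne
  obtain ⟨l, hl, hd⟩ := Nat.exists_prime_and_dvd hne
  have := Int.natCast_dvd_natCast.2 hd
  exact h l hl (this.trans (Int.gcd_dvd_left _ _)) (this.trans (Int.gcd_dvd_right _ _))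

lemma p1_cop_of_not_dvd {l : ℕ} (hl : l.Prime) {a : ℤ} (h : ¬ (l : ℤ) ∣ a) : IsCoprime a (l : ℤ) := 
  ((Prime.coprime_iff_not_dvd (Nat.prime_iff_prime_int.mp hl)).2 h).symm

lemma p1_main (p q : ℕ) (hp : p.Prime) (hq : q.Prime)
    (hp8 : p % 8 = 5) (hq8 : q % 8 = 3)
    (X Y Z : ℕ) (hZ : 0 < Z)
    (heq : p * X ^ 2 + q * Y ^ 2 = Z ^ 2)
    (g1 : Nat.gcd X Y = 1) (g2 : Nat.gcd Y Z = 1) 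
    (g4 : Nat.gcd p (Y * Z) = 1) 
    (hXodd : Odd X) (hYeven : Even Y) (hZ4 : Z % 4 = 1)
    (hcond : ((∃ x : ZMod p, x ^ 4 = (Z : ZMod p)) ∧ jacobiSym (2 * (X : ℤ)) Z = -1) ∨
             ((∃ x : ZMod p, x ^ 2 = (Z : ZMod p)) ∧
              (¬ ∃ x : ZMod p, x ^ 4 = (Z : ZMod p)) ∧ jacobiSym (2 * (X : ℤ)) Z = 1))
    (u v : ℤ) (hv : Odd v) (N : ℕ)
    (h : u ^ 2 + p * q * v ^ 2 = (2 ^ (N + 1)) ^ 2 * Z) (hd : (Z : ℤ) ∣ u * Y - v * p * X) :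
    Odd N := by
  have := Fact.mk hp
  have hpI : Prime (p : ℤ) := Nat.prime_iff_prime_int.mp hp
  have hZo : Odd Z := Nat.odd_iff.2 (by omega)
  have heqI : (p : ℤ) * X ^ 2 + q * Y ^ 2 = Z ^ 2 := by exact_mod_cast heq
  obtain ⟨y, hy⟩ := hYeven
  have hyo : Odd y := by
    rw [Nat.odd_iff]
    obtain ⟨a, ha⟩ := hXodd
    obtain ⟨b, hb⟩ := hZo
    by_contra hne
    have h2 : ∃ c, y = 2 * c := ⟨y / 2, by omega⟩
    obtain ⟨c, hc⟩ := h2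
    have e1 : ((p : ZMod 8)) = 5 := by
      have : ((p % 8 : ℕ) : ZMod 8) = p := ZMod.natCast_mod p 8
      rw [← this, hp8]; rfl
    have h3 := congrArg (Nat.cast : ℕ → ZMod 8) heq
    rw [hy, hc, ha, hb] at h3
    push_cast at h3
    rw [e1] at h3
    have h16 : (2 * (c : ZMod 8) + 2 * c) ^ 2 = 0 := by
      have : (2 * (c : ZMod 8) + 2 * c) ^ 2 = 16 * c ^ 2 := by ring
      rw [this]; have : (16 : ZMod 8) = 0 := by decide
      rw [this]; ring
    rw [h16] at h3
    generalize (a : ZMod 8) = a' at h3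
    generalize (b : ZMod 8) = b' at h3
    generalize (q : ZMod 8) = q' at h3
    revert h3
    rw [mul_zero, add_zero]
    revert a' b'
    decide
  set w : ℤ := 2 ^ (N + 1) with hw
  obtain ⟨t, ht⟩ := hd
  have hZI : (0 : ℤ) < Z := by exact_mod_cast hZ
  set T' : ℤ := u * Y + v * p * X with hT'
  have htT : t * T' = w ^ 2 * Y ^ 2 - p * Z * v ^ 2 := by
    apply mul_left_cancel₀ hZI.ne'
    calc (Z : ℤ) * (t * T') = (u * Y - v * p * X) * T' := by rw [ht]; ring
      _ = u ^ 2 * Y ^ 2 - v ^ 2 * p * (p * X ^ 2) := by rw [hT']; ring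
      _ = (w ^ 2 * Z - p * q * v ^ 2) * Y ^ 2 - v ^ 2 * p * (Z ^ 2 - q * Y ^ 2) := by rw [← h, ← heqI]; ring
      _ = _ := by ring
  -- coprimality helpers
  have lw : ∀ l : ℕ, l.Prime → (l : ℤ) ∣ w → l = 2 := by
    intro l hl hd
    have := (Nat.prime_iff_prime_int.mp hl).dvd_of_dvd_pow hd
    have h2 : l ∣ 2 := by exact_mod_cast this
    exact (Nat.prime_dvd_prime_iff_eq hl Nat.prime_two).1 h2
  have lodd : ∀ l : ℕ, l.Prime → ∀ a : ℤ, Odd a → (l : ℤ) ∣ a → ¬ (l : ℤ) ∣ w := by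
    intro l hl a ha hd hdw
    have := lw l hl hdw
    subst this
    rw [Int.odd_iff] at ha
    omega
  have hZoI : Odd (Z : ℤ) := by exact_mod_cast hZo
  have lYZ : ∀ l : ℕ, l.Prime → (l : ℤ) ∣ Y → (l : ℤ) ∣ Z → False := by
    intro l hl h1 h2
    have := Nat.dvd_gcd (Int.natCast_dvd_natCast.1 h1) (Int.natCast_dvd_natCast.1 h2)
    rw [g2] at this
    exact hl.one_lt.ne' (Nat.dvd_one.1 this)
  have lXY : ∀ l : ℕ, l.Prime → (l : ℤ) ∣ X → (l : ℤ) ∣ Y → False := by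
    intro l hl h1 h2
    have := Nat.dvd_gcd (Int.natCast_dvd_natCast.1 h1) (Int.natCast_dvd_natCast.1 h2)
    rw [g1] at this
    exact hl.one_lt.ne' (Nat.dvd_one.1 this)
  have hpY : ¬ (p : ℤ) ∣ Y := by
    intro h1
    have := Nat.dvd_gcd (dvd_refl p) ((Int.natCast_dvd_natCast.1 h1).mul_right Z)
    rw [g4] at this
    exact hp.one_lt.ne' (Nat.dvd_one.1 this)
  have hpZ : ¬ (p : ℤ) ∣ Z := by
    intro h1
    have := Nat.dvd_gcd (dvd_refl p) ((Int.natCast_dvd_natCast.1 h1).mul_left Y)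
    rw [g4] at this
    exact hp.one_lt.ne' (Nat.dvd_one.1 this)
  have hvZ : ∀ l : ℕ, l.Prime → (l : ℤ) ∣ v → (l : ℤ) ∣ Z → False := by
    intro l hl h1 h2
    have hlI := Nat.prime_iff_prime_int.mp hl
    have h3 : (l : ℤ) ∣ u := by
      apply hlI.dvd_of_dvd_pow (n := 2)
      have : u ^ 2 = w ^ 2 * Z - p * q * v * v := by rw [← h]; ring
      rw [this]
      exact dvd_sub (h2.mul_left _) (h1.mul_left _)
    have h4 : (l : ℤ) ∣ w ^ 2 * Y ^ 2 := by
      have : w ^ 2 * Y ^ 2 = t * T' + p * Z * v ^ 2 := by rw [htT]; ring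
      rw [this, hT']
      refine dvd_add ((dvd_add (h3.mul_right _) ?_).mul_left _) ?_
      · rw [mul_assoc]; exact h1.mul_right _
      · exact (h2.mul_left _).mul_right _
    rcases hlI.dvd_or_dvd h4 with h5 | h5
    · exact lodd l hl v hv h1 (hlI.dvd_of_dvd_pow h5)
    · exact lYZ l hl (hlI.dvd_of_dvd_pow h5) h2
  have huv : ∀ l : ℕ, l.Prime → (l : ℤ) ∣ u → (l : ℤ) ∣ v → False := by
    intro l hl h1 h2
    have hlI := Nat.prime_iff_prime_int.mp hl
    have h4 : (l : ℤ) ∣ w ^ 2 * Z := by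
      rw [← h]
      refine dvd_add (h1.pow two_ne_zero) (Dvd.dvd.mul_left (h2.pow two_ne_zero) _)
    rcases hlI.dvd_or_dvd h4 with h5 | h5
    · exact lodd l hl v hv h2 (hlI.dvd_of_dvd_pow h5)
    · exact hvZ l hl h2 h5
  have hv0 : v ≠ 0 := by rintro rfl; simp at hv
  -- (v/Z)=1
  have hvabs : Odd v.natAbs := Int.natAbs_odd.2 hv
  have dvdabs : ∀ (l : ℕ) (a : ℤ), (l : ℤ) ∣ (a.natAbs : ℤ) → (l : ℤ) ∣ a := fun l a h => Int.dvd_natAbs.1 h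
  have J1 : jacobiSym v Z = 1 := by
    rw [← p1_natAbs hZ4, ← jacobiSym.quadratic_reciprocity_one_mod_four hZ4 hvabs]
    have e1 : jacobiSym (w ^ 2 * Z) v.natAbs = jacobiSym (u ^ 2) v.natAbs := by
      apply p1_jac_modeq
      rw [← h]; rw [Int.natAbs_dvd]
      exact ⟨p * q * v, by ring⟩
    have hnz : (v.natAbs : ℤ) ≠ 0 := by simpa using hv0
    rw [jacobiSym.mul_left, p1_sq_one, p1_sq_one, one_mul] at e1
    · exact e1
    · exact p1_coprime_of hnz (fun l hl h1 h2 => huv l hl h1 (dvdabs _ _ h2))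
    · exact p1_coprime_of hnz (fun l hl h1 h2 => lodd l hl v hv (dvdabs _ _ h2) h1)
  have hp4 : p % 4 = 1 := by omega
  have hZ0 : (Z : ℤ) ≠ 0 := hZI.ne'
  have hp0 : (p : ℤ) ≠ 0 := by exact_mod_cast hp.ne_zero
  -- (Y/p) = -1
  have J2 : jacobiSym Y p = -1 := by
    have : (Y : ℤ) = 2 * y := by rw [hy]; push_cast; ring
    rw [this, jacobiSym.mul_left, jacobiSym.at_two (Nat.odd_iff.2 (by omega)), ZMod.χ₈_nat_eq_if_mod_eight,
      if_neg (by omega), if_neg (by omega), ← jacobiSym.quadratic_reciprocity_one_mod_four hp4 hyo]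
    have hyd : (y : ℤ) ∣ Y := ⟨2, by rw [hy]; push_cast; ring⟩
    have e1 : jacobiSym ((X : ℤ) ^ 2 * p) y = jacobiSym ((Z : ℤ) ^ 2) y := by
      apply p1_jac_modeq
      rw [← heqI]
      obtain ⟨c, hc⟩ := hyd
      exact ⟨- q * c * Y, by rw [hc]; ring⟩
    have hy0 : (y : ℤ) ≠ 0 := by
      rintro h0
      have : y = 0 := by exact_mod_cast h0
      subst this; simp at hyo
    rw [jacobiSym.mul_left, p1_sq_one, p1_sq_one, one_mul] at e1
    · rw [e1]; ring
    · exact p1_coprime_of hy0 (fun l hl h1 h2 => lYZ l hl (h2.trans hyd) h1)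
    · exact p1_coprime_of hy0 (fun l hl h1 h2 => lXY l hl h1 (h2.trans hyd))
  -- the square root of Z mod p
  have hx : ∃ x : ℤ, (p : ℤ) ∣ x ^ 2 - Z ∧ jacobiSym x p = - jacobiSym (2 * (X : ℤ)) Z := by
    have hpZ' : (Z : ZMod p) ≠ 0 := by
      intro h0
      apply hpZ
      have := (ZMod.intCast_zmod_eq_zero_iff_dvd (Z : ℤ) p).1 (by exact_mod_cast h0)
      exact this
    rcases hcond with ⟨⟨x, hx⟩, hj⟩ | ⟨⟨x, hx⟩, hn, hj⟩
    · obtain ⟨x', rfl⟩ := ZMod.intCast_surjective x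
      have hd : (p : ℤ) ∣ (x' ^ 2) ^ 2 - Z := by
        rw [← ZMod.intCast_zmod_eq_zero_iff_dvd]; push_cast; rw [← hx]; ring
      refine ⟨x' ^ 2, hd, ?_⟩
      rw [hj, neg_neg]
      apply p1_sq_one
      apply p1_cop_of_not_dvd hp
      intro h0
      apply hpZ
      have : (p : ℤ) ∣ (x' ^ 2) ^ 2 := (h0.pow two_ne_zero).pow two_ne_zero |>.trans dvd_rfl |> fun h => (dvd_trans (Dvd.intro_left _ (by ring : x' ^ 3 * x' = (x' ^ 2) ^ 2) |> fun k => h0.trans k) dvd_rfl)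
      exact (dvd_sub_right this).1 hd
    · obtain ⟨x', rfl⟩ := ZMod.intCast_surjective x
      have hd : (p : ℤ) ∣ x' ^ 2 - Z := by
        rw [← ZMod.intCast_zmod_eq_zero_iff_dvd]; push_cast; rw [← hx]; ring
      refine ⟨x', hd, ?_⟩
      rw [hj]
      rw [← jacobiSym.legendreSym.to_jacobiSym, legendreSym.eq_neg_one_iff]
      rintro ⟨r, hr⟩
      exact hn ⟨r, by rw [← hx, hr]; ring⟩
  obtain ⟨x, hx1, hx2⟩ := hx
  have hxp : ¬ (p : ℤ) ∣ x := by
    intro h0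
    exact hpZ ((dvd_sub_right (h0.pow two_ne_zero)).1 hx1)
  have J3 : jacobiSym Z p = 1 := by
    rw [← p1_jac_modeq hx1]
    exact p1_sq_one (p1_cop_of_not_dvd hp hxp)
  have hpw : ¬ (p : ℤ) ∣ w := by
    intro h0
    have := lw p hp h0
    omega
  -- (w/p)
  have Jw : jacobiSym w p = (-1) ^ (N + 1) := by
    rw [hw, jacobiSym.pow_left, jacobiSym.at_two (Nat.odd_iff.2 (by omega)), ZMod.χ₈_nat_eq_if_mod_eight,
      if_neg (by omega), if_neg (by omega)]
  have Ju : jacobiSym u p = jacobiSym w p * jacobiSym x p := by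
    have h1 : (p : ℤ) ∣ (u - w * x) * (u + w * x) := by
      obtain ⟨c, hc⟩ := hx1
      refine ⟨-w ^ 2 * c - q * v ^ 2, ?_⟩
      have : (u - w * x) * (u + w * x) = (u ^ 2 + p * q * v ^ 2) - p * q * v ^ 2 - w ^ 2 * (x ^ 2 - Z) - w ^ 2 * Z := by ring
      rw [this, h, hc]; ring
    rw [← jacobiSym.mul_left]
    rcases hpI.dvd_or_dvd h1 with h2 | h2
    · exact p1_jac_modeq h2
    · rw [← one_mul (jacobiSym (w * x) p), ← ZMod.χ₄_nat_one_mod_four hp4, ← jacobiSym.neg _ (Nat.odd_iff.2 (by omega))]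
      exact p1_jac_modeq (by rw [sub_neg_eq_add]; exact h2)
  -- t odd
  have hto : Odd t := by
    have hTo : Odd ((Z : ℤ) * t) := by
      rw [← ht]
      have a1 : Even (u * Y) := by rw [hy]; push_cast; exact ⟨u * y, by ring⟩
      have a2 : Odd (v * p * X) := by
        have b1 : Odd (p : ℤ) := by rw [Int.odd_iff]; omega
        have b2 : Odd (X : ℤ) := by exact_mod_cast hXodd
        exact (hv.mul b1).mul b2
      exact a1.sub_odd a2
    exact (Int.odd_mul.1 hTo).2
  have ht0 : t ≠ 0 := by rintro rfl; simp at hto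
  have htabs : Odd t.natAbs := Int.natAbs_odd.2 hto
  -- (t/p) = -(u/p)
  have J4 : jacobiSym t p = - jacobiSym u p := by
    have : jacobiSym (Z * t) p = jacobiSym (u * Y) p := by
      apply p1_jac_modeq
      rw [← ht]
      exact ⟨- v * X, by ring⟩
    rw [jacobiSym.mul_left, jacobiSym.mul_left, J3, J2] at this
    linarith
  -- (p/|t|) = (Z/|t|)
  have J5 : jacobiSym p t.natAbs = jacobiSym Z t.natAbs := by
    apply p1_jac_congr
    intro l hl hlt
    have hlt' : (l : ℤ) ∣ t := Int.natCast_dvd.2 hlt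
    have hlI := Nat.prime_iff_prime_int.mp hl
    have hlw := lodd l hl t hto hlt'
    have hld : (l : ℤ) ∣ w ^ 2 * Y ^ 2 - p * Z * v ^ 2 := by rw [← htT]; exact hlt'.mul_right _
    by_cases hlY : (l : ℤ) ∣ Y
    · have h1 : (l : ℤ) ∣ p * Z * v ^ 2 := (dvd_sub_right (Dvd.dvd.mul_left (hlY.pow two_ne_zero) _)).1 hld
      have hlv : (l : ℤ) ∣ v := by
        rcases hlI.dvd_or_dvd h1 with h2 | h2
        · rcases hlI.dvd_or_dvd h2 with h3 | h3
          · exfalso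
            have : l = p := (Nat.prime_dvd_prime_iff_eq hl hp).1 (Int.natCast_dvd_natCast.1 h3)
            rw [this] at hlY
            exact hpY hlY
          · exact absurd h3 (fun h3 => lYZ l hl hlY h3)
        · exact hlI.dvd_of_dvd_pow h2
      have e1 : jacobiSym ((X : ℤ) ^ 2 * p) l = jacobiSym ((Z : ℤ) ^ 2) l := by
        apply p1_jac_modeq
        rw [← heqI]
        obtain ⟨c, hc⟩ := hlY
        exact ⟨- q * c * Y, by rw [hc]; ring⟩
      have e2 : jacobiSym (w ^ 2 * Z) l = jacobiSym (u ^ 2) l := by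
        apply p1_jac_modeq
        rw [← h]
        obtain ⟨c, hc⟩ := hlv
        exact ⟨p * q * c * v, by rw [hc]; ring⟩
      rw [jacobiSym.mul_left, p1_sq_one, p1_sq_one, one_mul] at e1
      rw [jacobiSym.mul_left, p1_sq_one, p1_sq_one, one_mul] at e2
      · rw [e1, e2]
      · exact p1_cop_of_not_dvd hl (fun h0 => huv l hl h0 hlv)
      · exact p1_cop_of_not_dvd hl hlw
      · exact p1_cop_of_not_dvd hl (fun h0 => lYZ l hl hlY h0)
      · exact p1_cop_of_not_dvd hl (fun h0 => lXY l hl h0 hlY)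
    · have e0 : ¬ (l : ℤ) ∣ w ^ 2 * Y ^ 2 := by
        intro h0
        rcases hlI.dvd_or_dvd h0 with h5 | h5
        · exact hlw (hlI.dvd_of_dvd_pow h5)
        · exact hlY (hlI.dvd_of_dvd_pow h5)
      have e0' : ¬ (l : ℤ) ∣ p * Z * v ^ 2 := fun h0 => e0 ((dvd_sub_left h0).1 hld)
      have e1 := p1_jac_modeq hld
      rw [jacobiSym.mul_left, jacobiSym.mul_left, jacobiSym.mul_left, p1_sq_one (p1_cop_of_not_dvd hl hlw),
        p1_sq_one (p1_cop_of_not_dvd hl hlY), p1_sq_one (p1_cop_of_not_dvd hl (fun h0 => e0' (Dvd.dvd.mul_left (h0.pow two_ne_zero) _)))] at e1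
      have hZl : IsCoprime (Z : ℤ) (l : ℤ) := p1_cop_of_not_dvd hl (fun h0 => e0' ((h0.mul_left _).mul_right _))
      have e2 := p1_sq_one hZl
      rw [jacobiSym.pow_left] at e2
      have : jacobiSym p l * jacobiSym Z l ^ 2 = jacobiSym Z l := by linear_combination -jacobiSym Z l * e1
      rw [e2, mul_one] at this
      exact this
  have J6 : jacobiSym t Z = jacobiSym (2 * (X : ℤ)) Z := by
    have hZY : IsCoprime (Y : ℤ) (Z : ℤ) := p1_coprime_of hZ0 lYZ
    have e1 : jacobiSym (t * T') Z = 1 := by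
      have : jacobiSym (t * T') Z = jacobiSym (w ^ 2 * Y ^ 2) Z := by
        apply p1_jac_modeq; rw [htT]; exact ⟨- p * v ^ 2, by ring⟩
      rw [this, jacobiSym.mul_left, p1_sq_one hZY, p1_sq_one, one_mul]
      exact p1_coprime_of hZ0 (fun l hl h1 h2 => lodd l hl Z hZoI h2 h1)
    have e2 : jacobiSym T' Z = jacobiSym (2 * (X : ℤ)) Z := by
      have : jacobiSym T' Z = jacobiSym (2 * X * v * p) Z := by
        apply p1_jac_modeq
        exact ⟨t, by rw [hT', ← ht]; ring⟩
      rw [this, jacobiSym.mul_left, jacobiSym.mul_left _ v, J1, jacobiSym.quadratic_reciprocity_one_mod_four hp4 hZo, J3]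
      ring
    rw [jacobiSym.mul_left, e2] at e1
    rcases hcond with ⟨_, hj⟩ | ⟨_, _, hj⟩ <;> rw [hj] at e1 ⊢ <;> linarith
  have J7 : jacobiSym t p = jacobiSym t Z := by
    rw [← p1_natAbs hp4, ← jacobiSym.quadratic_reciprocity_one_mod_four hp4 htabs, J5,
      jacobiSym.quadratic_reciprocity_one_mod_four hZ4 htabs, p1_natAbs hZ4]
  have fin : jacobiSym w p = 1 := by
    rw [J4, J6] at J7
    have hJ : jacobiSym x p = jacobiSym u p := by rw [hx2]; linarith
    rw [hJ] at Ju
    rcases hcond with ⟨_, hj⟩ | ⟨_, _, hj⟩ <;> rw [hj] at J7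
    · have : jacobiSym u p = 1 := by linarith
      rw [this] at Ju; linarith
    · have : jacobiSym u p = -1 := by linarith
      rw [this] at Ju; linarith
  rw [Jw] at fin
  by_contra hne
  rw [Nat.not_odd_iff_even] at hne
  have : Odd (N + 1) := hne.add_one
  rw [this.neg_one_pow] at fin
  norm_num at fin

end SecGroupLemmas

section SecQuadA

set_option linter.unusedSectionVars false

/-- data describing the maximal order of `ℚ(√(-pq))` -/
structure QData (O : Type) [CommRing O] (p q : ℕ) where
  δ : O
  ω : O
  σ : O →+* O
  hδ : δ ^ 2 = -((p : O) * q)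
  hω : 2 * ω = 1 + δ
  hσ : σ δ = -δ
  hO : ∀ x : O, ∃ a b : ℤ, 2 * x = a + b * δ

namespace QData

variable {O : Type} [CommRing O] [IsDomain O] [CharZero O] {p q : ℕ} (Q : QData O p q)

lemma sigsig (x : O) : Q.σ (Q.σ x) = x := by
  obtain ⟨a, b, h⟩ := Q.hO x
  have h2 := congrArg (fun y => Q.σ (Q.σ y)) h
  simp only [map_mul, map_add, map_intCast, Q.hσ, map_neg, neg_neg, map_ofNat] at h2
  rw [← h] at h2
  exact mul_left_cancel₀ two_ne_zero h2

lemma two_sig {x : O} {a b : ℤ} (h : 2 * x = a + b * Q.δ) : 2 * Q.σ x = a - b * Q.δ := by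
  have h2 := congrArg Q.σ h
  simp only [map_mul, map_add, map_intCast, Q.hσ, map_ofNat] at h2
  rw [h2]; ring

lemma four_norm {x : O} {a b : ℤ} (h : 2 * x = a + b * Q.δ) :
    4 * (x * Q.σ x) = ((a ^ 2 + p * q * b ^ 2 : ℤ) : O) := by
  have : 4 * (x * Q.σ x) = (2 * x) * (2 * Q.σ x) := by ring
  rw [this, h, Q.two_sig h]
  push_cast
  have := Q.hδ
  linear_combination (-(b : O) ^ 2) * this

lemma coord_zero (hpq : 0 < p * q) {a b : ℤ} (h : (a : O) + b * Q.δ = 0) : a = 0 ∧ b = 0 := by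
  have h1 := Q.four_norm (x := 0) (a := a) (b := b) (by rw [h]; ring)
  have h2 : (a ^ 2 + p * q * b ^ 2 : ℤ) = 0 := by
    rw [zero_mul, mul_zero] at h1
    exact_mod_cast h1.symm
  have h3 : (0 : ℤ) < p * q := by exact_mod_cast hpq
  have hb : b ^ 2 = 0 := by nlinarith [sq_nonneg a, sq_nonneg b]
  have ha : a ^ 2 = 0 := by rw [hb] at h2; linarith
  exact ⟨by simpa using ha, by simpa using hb⟩

lemma coord_unique (hpq : 0 < p * q) {a b c d : ℤ} (h : (a : O) + b * Q.δ = c + d * Q.δ) : a = c ∧ b = d := by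
  have := Q.coord_zero hpq (a := a - c) (b := b - d) (by push_cast; linear_combination h)
  omega

lemma parity (hpq : p * q % 8 = 7) {x : O} {a b : ℤ} (h : 2 * x = a + b * Q.δ) : a % 2 = b % 2 := by
  obtain ⟨c, d, h1⟩ := Q.hO (x * Q.σ x)
  have h2 := Q.four_norm h
  have h3 := Q.coord_unique (by omega) (a := 2 * c) (b := 2 * d) (c := a ^ 2 + p * q * b ^ 2) (d := 0)
    (by rw [← h2]; push_cast; linear_combination (-2 : O) * h1)
  have h4 : (p : ℤ) * q % 8 = 7 := by exact_mod_cast congrArg (Nat.cast : ℕ → ℤ) hpq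
  obtain ⟨r, hr⟩ : ∃ r : ℤ, (p : ℤ) * q = 2 * r + 1 := ⟨((p : ℤ) * q) / 2, by omega⟩
  have h5 : 2 * c = a ^ 2 + b ^ 2 + 2 * (r * b ^ 2) := by rw [h3.1, hr]; ring
  have h6 : Even (a ^ 2 + b ^ 2) := ⟨c - r * b ^ 2, by linarith⟩
  rw [Int.even_add, Int.even_pow' two_ne_zero, Int.even_pow' two_ne_zero, Int.even_iff, Int.even_iff] at h6
  omega

/-- build an element from its coordinates -/
lemma build {a b : ℤ} (h : a % 2 = b % 2) : ∃ x : O, 2 * x = a + b * Q.δ := by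
  obtain ⟨c, hc⟩ : ∃ c, a = b + 2 * c := ⟨(a - b) / 2, by omega⟩
  refine ⟨c + b * Q.ω, ?_⟩
  rw [hc]
  push_cast
  linear_combination (b : O) * Q.hω

lemma norm_int (hpq : p * q % 8 = 7) (x : O) : ∃ n : ℤ, x * Q.σ x = n ∧ 0 ≤ n ∧ (x ≠ 0 → 0 < n) := by
  obtain ⟨a, b, h⟩ := Q.hO x
  have h1 := Q.four_norm h
  have h2 := Q.parity hpq h
  have h4 : (p : ℤ) * q % 8 = 7 := by exact_mod_cast congrArg (Nat.cast : ℕ → ℤ) hpq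
  have hp0 : (0 : ℤ) < p * q := by
    have : 0 < p * q := by omega
    exact_mod_cast this
  have : (4 : ℤ) ∣ a ^ 2 + p * q * b ^ 2 := by
    obtain ⟨c, hc⟩ : ∃ c, a = b + 2 * c := ⟨(a - b) / 2, by omega⟩
    obtain ⟨r, hr⟩ : ∃ r : ℤ, (p : ℤ) * q = 4 * r + 3 := ⟨((p : ℤ) * q) / 4, by omega⟩
    rw [hc, hr]
    exact ⟨b ^ 2 + b * c + c ^ 2 + r * b ^ 2, by ring⟩
  obtain ⟨n, hn⟩ := this
  have hn0 : 0 ≤ n := by nlinarith [sq_nonneg a, sq_nonneg b, mul_nonneg hp0.le (sq_nonneg b)]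
  refine ⟨n, ?_, hn0, ?_⟩
  · rw [hn] at h1
    push_cast at h1
    exact mul_left_cancel₀ (by norm_num) h1
  · intro hx
    rcases hn0.lt_or_eq with h0 | h0
    · exact h0
    · exfalso
      apply hx
      rw [← h0, mul_zero] at hn
      have : (4 : O) * (x * Q.σ x) = 0 := by rw [h1, hn]; simp
      have h7 : x * Q.σ x = 0 := by
        rcases mul_eq_zero.1 this with h8 | h8
        · norm_num at h8
        · exact h8
      rcases mul_eq_zero.1 h7 with h8 | h8
      · exact h8
      · rw [← Q.sigsig x, h8, map_zero]

lemma trace_int (x : O) : ∃ t : ℤ, x + Q.σ x = t := by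
  obtain ⟨a, b, h⟩ := Q.hO x
  refine ⟨a, ?_⟩
  apply mul_left_cancel₀ (two_ne_zero (α := O))
  linear_combination h + Q.two_sig h

lemma int_dvd {p q : ℕ} (Q : QData O p q) (hpq : p * q % 8 = 7) {a b : ℤ} (h : (b : O) ∣ a) : b ∣ a := by
  obtain ⟨x, hx⟩ := h
  obtain ⟨c, d, h1⟩ := Q.hO x
  have h2 := Q.coord_unique (by omega) (a := 2 * a) (b := 0) (c := b * c) (d := b * d)
    (by push_cast; linear_combination (2 : O) * hx + (b : O) * h1)
  rcases eq_or_ne b 0 with rfl | hb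
  · rw [Int.cast_zero, zero_mul] at hx
    have : a = 0 := by exact_mod_cast hx
    rw [this]
  · have hd : d = 0 := by
      rcases mul_eq_zero.1 h2.2.symm with h3 | h3
      · exact absurd h3 hb
      · exact h3
    have := Q.parity hpq h1
    obtain ⟨e, he⟩ : ∃ e, c = 2 * e := ⟨c / 2, by omega⟩
    exact ⟨e, by rw [he] at h2; linarith [h2.1]⟩

/-- an element whose norm is even and whose coordinates are even is divisible by 2 -/
lemma two_dvd_of (hpq : p * q % 8 = 7) {x : O} {a b n : ℤ} (h : 2 * x = a + b * Q.δ) (ha : a % 2 = 0)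
    (hn : x * Q.σ x = n) (hn2 : n % 2 = 0) : (2 : O) ∣ x := by
  have hb := Q.parity hpq h
  obtain ⟨c, hc⟩ : ∃ c, a = 2 * c := ⟨a / 2, by omega⟩
  obtain ⟨d, hd⟩ : ∃ c, b = 2 * c := ⟨b / 2, by omega⟩
  have h1 := Q.four_norm h
  rw [hn] at h1
  have h2 : 4 * n = a ^ 2 + p * q * b ^ 2 := by exact_mod_cast h1
  rw [hc, hd] at h2
  have h4 : (p : ℤ) * q % 8 = 7 := by exact_mod_cast congrArg (Nat.cast : ℕ → ℤ) hpq
  obtain ⟨r, hr⟩ : ∃ r : ℤ, (p : ℤ) * q = 2 * r + 1 := ⟨((p : ℤ) * q) / 2, by omega⟩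
  have h5 : n = c ^ 2 + d ^ 2 + 2 * (r * d ^ 2) := by rw [hr] at h2; linarith
  have h6 : Even (c ^ 2 + d ^ 2) := by
    rw [Int.even_iff]; omega
  rw [Int.even_add, Int.even_pow' two_ne_zero, Int.even_pow' two_ne_zero, Int.even_iff, Int.even_iff] at h6
  obtain ⟨y, hy⟩ := Q.build (a := c) (b := d) (by omega)
  refine ⟨y, ?_⟩
  apply mul_left_cancel₀ (two_ne_zero (α := O))
  rw [h, hy, hc, hd]; push_cast; ring

/-- conjugate ideal -/
noncomputable def cj (I : Ideal O) : Ideal O := I.map Q.σ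

lemma mem_cj {I : Ideal O} {x : O} : x ∈ Q.cj I ↔ Q.σ x ∈ I := by
  have hs : Function.Surjective Q.σ := fun y => ⟨Q.σ y, Q.sigsig y⟩
  rw [cj, Ideal.mem_map_iff_of_surjective _ hs]
  constructor
  · rintro ⟨y, hy, rfl⟩
    rw [Q.sigsig]; exact hy
  · intro h
    exact ⟨_, h, Q.sigsig x⟩

lemma cj_mul (I J : Ideal O) : Q.cj (I * J) = Q.cj I * Q.cj J := Ideal.map_mul _ _ _

lemma cj_span (x : O) : Q.cj (Ideal.span {x}) = Ideal.span {Q.σ x} := by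
  rw [cj, Ideal.map_span, Set.image_singleton]

lemma cj_cj (I : Ideal O) : Q.cj (Q.cj I) = I := by
  ext x; rw [Q.mem_cj, Q.mem_cj, Q.sigsig]

/-- Gauss content lemma -/
lemma dvd_of_trace_norm [IsIntegrallyClosed O] {z : O} {n t s : ℤ} (hn : n ≠ 0) (h1 : z + Q.σ z = n * t)
    (h2 : z * Q.σ z = n ^ 2 * s) : (n : O) ∣ z := by
  have hn' : (algebraMap O (FractionRing O)) n ≠ 0 := by
    rw [Ne, FaithfulSMul.algebraMap_eq_zero_iff]
    exact_mod_cast hn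
  have hinteg : IsIntegral O ((algebraMap O (FractionRing O)) z / (algebraMap O (FractionRing O)) n) := by
    refine ⟨Polynomial.X ^ 2 - Polynomial.C (t : O) * Polynomial.X + Polynomial.C (s : O), ?_, ?_⟩
    · monicity!
    · simp only [Polynomial.eval₂_add, Polynomial.eval₂_sub, Polynomial.eval₂_pow, Polynomial.eval₂_X,
        Polynomial.eval₂_mul, Polynomial.eval₂_C]
      have : z ^ 2 - n * t * z + n ^ 2 * s = 0 := by rw [← h1, ← h2]; ring
      have := congrArg (algebraMap O (FractionRing O)) this
      simp only [map_add, map_sub, map_mul, map_pow, map_zero] at this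
      field_simp
      linear_combination this
  obtain ⟨y, hy⟩ := IsIntegrallyClosed.isIntegral_iff.1 hinteg
  refine ⟨y, ?_⟩
  apply FaithfulSMul.algebraMap_injective O (FractionRing O)
  rw [map_mul, hy]
  field_simp

lemma mul_cj [IsIntegrallyClosed O] (hpq : p * q % 8 = 7) (I : Ideal O) (hI : I ≠ ⊥) :
    ∃ n : ℤ, 0 < n ∧ I * Q.cj I = Ideal.span {(n : O)} := by
  set B := I * Q.cj I with hB
  let N : Ideal ℤ := B.comap (Int.castRingHom O)
  obtain ⟨g, hg⟩ := (IsPrincipalIdealRing.principal N).principal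
  have memN : ∀ m : ℤ, (m : O) ∈ B → g ∣ m := by
    intro m hm
    have : m ∈ N := by simpa [N] using hm
    rw [hg] at this
    exact Ideal.mem_span_singleton.1 this
  have gB : (g : O) ∈ B := by
    have : g ∈ N := by rw [hg]; exact Ideal.mem_span_singleton_self g
    simpa [N] using this
  have xB : ∀ x ∈ I, ∀ y ∈ I, x * Q.σ y ∈ B := fun x hx y hy =>
    Ideal.mul_mem_mul hx (Q.mem_cj.2 (by rw [Q.sigsig]; exact hy))
  have normB : ∀ x ∈ I, ∃ m : ℤ, x * Q.σ x = g * m := by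
    intro x hx
    obtain ⟨n, hn, -⟩ := Q.norm_int hpq x
    obtain ⟨m, hm⟩ := memN n (by rw [← hn]; exact xB x hx x hx)
    exact ⟨m, by rw [hn, hm]; push_cast; rfl⟩
  have hg0 : g ≠ 0 := by
    rintro rfl
    apply hI
    rw [Submodule.eq_bot_iff]
    intro x hx
    obtain ⟨m, hm⟩ := normB x hx
    obtain ⟨n, hn, -, hn2⟩ := Q.norm_int hpq x
    by_contra hne
    have := hn2 hne
    rw [hn] at hm
    simp at hm
    omega
  refine ⟨|g|, abs_pos.2 hg0, ?_⟩
  have : Ideal.span {((|g| : ℤ) : O)} = Ideal.span {(g : O)} := by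
    rcases abs_choice g with h | h <;> rw [h]
    push_cast
    rw [Ideal.span_singleton_neg]
  rw [this]
  apply le_antisymm
  · rw [hB, Ideal.mul_le]
    intro x hx y hy
    rw [Ideal.mem_span_singleton]
    rw [Q.mem_cj] at hy
    obtain ⟨t, ht⟩ := Q.trace_int (x * y)
    obtain ⟨t', ht'⟩ := memN t (by
      rw [← ht]
      apply B.add_mem
      · have := xB x hx _ hy
        rwa [Q.sigsig] at this
      · rw [map_mul, mul_comm]
        exact xB _ hy x hx)
    obtain ⟨m1, h1⟩ := normB x hx
    obtain ⟨m2, h2⟩ := normB _ hy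
    rw [Q.sigsig] at h2
    refine Q.dvd_of_trace_norm hg0 (t := t') (s := m1 * m2) (by rw [ht, ht']; push_cast; rfl) ?_
    rw [map_mul]
    push_cast
    linear_combination (y * Q.σ y) * h1 + (g : O) * m1 * h2
  · rw [Ideal.span_singleton_le_iff_mem]; exact gB

end QData

end SecQuadA

section SecQuadB

set_option linter.unusedSectionVars false

namespace QData

variable {O : Type} [CommRing O] [CharZero O] [IsDedekindDomain O] {p q : ℕ} (Q : QData O p q)

lemma sq_dvd_sq {I J : Ideal O} (h : I * I ∣ J * J) : I ∣ J := by
  rw [← sq, ← sq] at h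
  exact (UniqueFactorizationMonoid.pow_dvd_pow_iff_dvd two_ne_zero).1 h

lemma sq_inj {I J : Ideal O} (h : I * I = J * J) : I = J := 
  dvd_antisymm (sq_dvd_sq (by rw [h])) (sq_dvd_sq (by rw [h]))

/-- the ramified ideal above p -/
noncomputable def aa : Ideal O := Ideal.span {(p : O), Q.δ}

lemma aa_sq (hcop : p.Coprime q) : Q.aa * Q.aa = Ideal.span {(p : O)} := by
  rw [aa, Ideal.span_pair_mul_span_pair]
  apply le_antisymm
  · rw [Ideal.span_le]
    rintro x (rfl | rfl | rfl | rfl)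
    · exact Ideal.mem_span_singleton.2 ⟨p, rfl⟩
    · exact Ideal.mem_span_singleton.2 ⟨Q.δ, rfl⟩
    · exact Ideal.mem_span_singleton.2 ⟨Q.δ, mul_comm _ _⟩
    · exact Ideal.mem_span_singleton.2 ⟨-q, by rw [← sq, Q.hδ]; ring⟩
  · rw [Ideal.span_singleton_le_iff_mem]
    obtain ⟨a, b, hab⟩ := Nat.isCoprime_iff_coprime.2 hcop
    have h1 : (p : O) = a * (p * p) + (-b) * (Q.δ * Q.δ) := by
      rw [← sq Q.δ, Q.hδ]
      have := congrArg (Int.cast : ℤ → O) hab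
      push_cast at this
      linear_combination (-p : O) * this
    have hm : ((a : O) * (p * p) + (-b) * (Q.δ * Q.δ)) ∈ Ideal.span {(p : O) * p, p * Q.δ, Q.δ * p, Q.δ * Q.δ} := by
      apply Ideal.add_mem
      · exact Ideal.mul_mem_left _ _ (Ideal.subset_span (by simp))
      · exact Ideal.mul_mem_left _ _ (Ideal.subset_span (by simp))
    rw [h1]
    convert hm using 2
    rw [← h1]

lemma inv_ideal (hp : p.Prime) (hq : q.Prime) (hne : p ≠ q) (hpq : p * q % 8 = 7) :
    ∀ r : ℕ, 0 < r → ∀ B : Ideal O, Q.cj B = B → B * B = Ideal.span {(r : O)} →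
      (∃ x, B = Ideal.span {x}) ∨ (∃ x, B * Q.aa = Ideal.span {x}) := by
  intro r
  induction r using Nat.strong_induction_on with
  | _ r ih =>
  intro hr B hB hBB
  have hcop : p.Coprime q := (Nat.coprime_primes hp hq).2 hne
  -- reduction step
  have step : ∀ l : ℕ, l.Prime → B ≤ Ideal.span {(l : O)} → 
      (∃ x, B = Ideal.span {x}) ∨ (∃ x, B * Q.aa = Ideal.span {x}) := by
    intro l hl hle
    have hl0 : (l : O) ≠ 0 := by exact_mod_cast hl.ne_zero
    obtain ⟨B', hB'⟩ := Ideal.dvd_iff_le.2 hle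
    have h1 : Ideal.span {(r : O)} ≤ Ideal.span {((l * l : ℕ) : O)} := by
      rw [← hBB]
      refine (Ideal.mul_mono hle hle).trans ?_
      rw [Ideal.span_singleton_mul_span_singleton]
      push_cast; rfl
    rw [Ideal.span_singleton_le_span_singleton] at h1
    have h2 : ((l * l : ℕ) : ℤ) ∣ (r : ℕ) := Q.int_dvd hpq (by exact_mod_cast h1)
    obtain ⟨r', hr'⟩ := Int.natCast_dvd_natCast.1 h2
    have hr'0 : 0 < r' := by
      rcases Nat.eq_zero_or_pos r' with h0 | h0
      · subst h0; omega
      · exact h0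
    have hlt : r' < r := by
      rw [hr']
      have := hl.one_lt
      have h4 : 1 < l * l := by nlinarith
      nlinarith
    have hsp : Ideal.span {(l : O)} ≠ 0 := by
      rw [Ne, Ideal.zero_eq_bot, Ideal.span_singleton_eq_bot]; exact hl0
    have e1 : Q.cj B' = B' := by
      apply mul_left_cancel₀ hsp
      rw [← hB', ← hB]
      conv_rhs => rw [hB', Q.cj_mul, Q.cj_span]
      simp
    have e2 : B' * B' = Ideal.span {(r' : O)} := by
      apply mul_left_cancel₀ (mul_ne_zero hsp hsp)
      have : Ideal.span {(l : O)} * Ideal.span {(l : O)} * (B' * B') = B * B := by rw [hB']; ring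
      rw [this, hBB, hr', Ideal.span_singleton_mul_span_singleton, Ideal.span_singleton_mul_span_singleton]
      push_cast; rfl
    rcases ih r' hlt hr'0 B' e1 e2 with ⟨x, hx⟩ | ⟨x, hx⟩
    · left
      exact ⟨l * x, by rw [hB', hx, Ideal.span_singleton_mul_span_singleton]⟩
    · right
      exact ⟨l * x, by rw [hB', mul_assoc, hx, Ideal.span_singleton_mul_span_singleton]⟩
  by_cases hex : ∃ l : ℕ, l.Prime ∧ B ≤ Ideal.span {(l : O)}
  · obtain ⟨l, hl, hle⟩ := hex
    exact step l hl hle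
  -- now r is squarefree and only divisible by p, q
  have hnsq : ∀ l : ℕ, l.Prime → ¬ l * l ∣ r := by
    intro l hl hd
    apply hex
    refine ⟨l, hl, Ideal.le_of_dvd (sq_dvd_sq ?_)⟩
    rw [hBB, Ideal.span_singleton_mul_span_singleton, Ideal.dvd_iff_le, Ideal.span_singleton_le_span_singleton]
    exact_mod_cast Nat.cast_dvd_cast (α := O) hd
  have hdiv : ∀ l : ℕ, l.Prime → l ∣ r → l = p ∨ l = q := by
    intro l hl hd
    by_contra hno
    push Not at hno
    apply hex
    refine ⟨l, hl, ?_⟩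
    intro b hb
    rw [Ideal.mem_span_singleton]
    have hlI := Nat.prime_iff_prime_int.mp hl
    have hsb : Q.σ b ∈ B := by rw [← Q.mem_cj, hB]; exact hb
    obtain ⟨c, d, hcd⟩ := Q.hO b
    have hcd' := Q.two_sig hcd
    have key : ∀ m : ℤ, (m : O) ∈ B * B → (l : ℤ) ∣ m := by
      intro m hm
      rw [hBB, Ideal.mem_span_singleton] at hm
      refine Q.int_dvd hpq (dvd_trans ?_ hm)
      exact_mod_cast Nat.cast_dvd_cast (α := O) hd
    have hc : (l : ℤ) ∣ c := by
      apply hlI.dvd_of_dvd_pow (n := 2)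
      apply key
      have : ((c ^ 2 : ℤ) : O) = (b + Q.σ b) * (b + Q.σ b) := by
        apply mul_left_cancel₀ (show (4 : O) ≠ 0 by norm_num)
        have : (4 : O) * ((b + Q.σ b) * (b + Q.σ b)) = (2 * b + 2 * Q.σ b) * (2 * b + 2 * Q.σ b) := by ring
        rw [this, hcd, hcd']
        push_cast; ring
      rw [this]
      exact Ideal.mul_mem_mul (B.add_mem hb hsb) (B.add_mem hb hsb)
    have hdd : (l : ℤ) ∣ d := by
      have : (l : ℤ) ∣ p * q * d ^ 2 := by
        apply key
        have : ((p * q * d ^ 2 : ℤ) : O) = -((b - Q.σ b) * (b - Q.σ b)) := by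
          apply mul_left_cancel₀ (show (4 : O) ≠ 0 by norm_num)
          have : (4 : O) * (-((b - Q.σ b) * (b - Q.σ b))) = -((2 * b - 2 * Q.σ b) * (2 * b - 2 * Q.σ b)) := by ring
          rw [this, hcd, hcd']
          push_cast
          linear_combination 4 * (d : O) ^ 2 * Q.hδ
        rw [this]
        exact neg_mem (Ideal.mul_mem_mul (B.sub_mem hb hsb) (B.sub_mem hb hsb))
      rcases hlI.dvd_or_dvd this with h1 | h1
      · exfalso
        rcases hlI.dvd_or_dvd h1 with h2 | h2
        · exact hno.1 ((Nat.prime_dvd_prime_iff_eq hl hp).1 (Int.natCast_dvd_natCast.1 h2))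
        · exact hno.2 ((Nat.prime_dvd_prime_iff_eq hl hq).1 (Int.natCast_dvd_natCast.1 h2))
      · exact hlI.dvd_of_dvd_pow h1
    rcases hl.eq_two_or_odd with h2 | hodd
    · subst h2
      obtain ⟨n, hn, -⟩ := Q.norm_int hpq b
      have hn2 := key n (by rw [← hn]; exact Ideal.mul_mem_mul hb hsb)
      have := Q.two_dvd_of hpq hcd (by push_cast at hc; omega) hn (by push_cast at hn2; omega)
      exact_mod_cast this
    · obtain ⟨c', rfl⟩ := hc
      obtain ⟨d', rfl⟩ := hdd
      have hpar := Q.parity hpq hcd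
      have hpar' : c' % 2 = d' % 2 := by
        have hl2 : (l : ℤ) % 2 = 1 := by omega
        rw [Int.mul_emod, Int.mul_emod _ d', hl2, one_mul, one_mul] at hpar
        omega
      obtain ⟨y, hy⟩ := Q.build hpar'
      refine ⟨y, ?_⟩
      apply mul_left_cancel₀ (two_ne_zero (α := O))
      rw [hcd]
      push_cast
      linear_combination (-l : O) * hy
  have hr4 : r = 1 ∨ r = p ∨ r = q ∨ r = p * q := by
    have hsqf : Squarefree r := by
      rw [Nat.squarefree_iff_prime_squarefree]
      exact hnsq
    have hrd : r ∣ p * q := by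
      rw [← Nat.prod_primeFactors_of_squarefree hsqf]
      have hsub : r.primeFactors ⊆ {p, q} := by
        intro l hl
        have := hdiv l (Nat.prime_of_mem_primeFactors hl) (Nat.dvd_of_mem_primeFactors hl)
        simpa using this
      refine (Finset.prod_dvd_prod_of_subset _ _ _ hsub).trans ?_
      rw [Finset.prod_pair hne]
    rw [Nat.dvd_mul] at hrd
    obtain ⟨a, b, ha, hb, rfl⟩ := hrd
    rcases (Nat.dvd_prime hp).1 ha with rfl | rfl <;> rcases (Nat.dvd_prime hq).1 hb with rfl | rfl <;> simp
  have hdd : Ideal.span {Q.δ} * Ideal.span {Q.δ} = Ideal.span {(p : O) * q} := by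
    rw [Ideal.span_singleton_mul_span_singleton, ← sq, Q.hδ, Ideal.span_singleton_neg]
  rcases hr4 with h1 | h1 | h1 | h1
  · left
    refine ⟨1, ?_⟩
    rw [h1] at hBB
    rw [Ideal.span_singleton_one, Ideal.eq_top_iff_one]
    apply Ideal.mul_le_left (I := B) (J := B)
    rw [hBB]
    simp
  · right
    refine ⟨p, ?_⟩
    have : B = Q.aa := sq_inj (by rw [hBB, h1, Q.aa_sq hcop])
    rw [this, Q.aa_sq hcop]
  · right
    refine ⟨Q.δ, sq_inj ?_⟩
    rw [hdd, mul_mul_mul_comm, hBB, h1, Q.aa_sq hcop, Ideal.span_singleton_mul_span_singleton, mul_comm]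
  · left
    refine ⟨Q.δ, sq_inj ?_⟩
    rw [hdd, hBB, h1]
    push_cast; rfl

lemma int_eq_of_span (Q : QData O p q) (hpq : p * q % 8 = 7) {a b : ℤ} (ha : 0 < a) (hb : 0 < b) 
    (h : Ideal.span {(a : O)} = Ideal.span {(b : O)}) : a = b := by
  have h1 : a ∣ b := Q.int_dvd hpq (Ideal.span_singleton_le_span_singleton.1 h.ge)
  have h2 : b ∣ a := Q.int_dvd hpq (Ideal.span_singleton_le_span_singleton.1 h.le)
  exact Int.dvd_antisymm ha.le hb.le h1 h2

/-- ambiguous classes -/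
lemma two_torsion_ideal (hp : p.Prime) (hq : q.Prime) (hne : p ≠ q) (hpq : p * q % 8 = 7)
    (I : Ideal O) (hI : I ≠ ⊥) (x : O) (hx : I * I = Ideal.span {x}) :
    ∃ w : O, w ≠ 0 ∧ ((∃ z, Ideal.span {w} * I = Ideal.span {z}) ∨ 
      (∃ z, Ideal.span {w} * I * Q.aa = Ideal.span {z})) := by
  obtain ⟨n, hn0, hn⟩ := Q.mul_cj hpq I hI
  obtain ⟨m, hm, -, hm2⟩ := Q.norm_int hpq x
  have hx0 : x ≠ 0 := by
    rintro rfl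
    have : I * I = ⊥ := by rw [hx]; simp
    rcases Ideal.mul_eq_bot.1 this with h | h <;> exact hI h
  have hmn : m = n ^ 2 := by
    apply Q.int_eq_of_span hpq (hm2 hx0) (by positivity)
    rw [← hm]
    push_cast
    rw [sq, ← Ideal.span_singleton_mul_span_singleton, ← Ideal.span_singleton_mul_span_singleton, ← hn, ← hx,
      ← Q.cj_span, ← hx, Q.cj_mul]
    ring
  have hnO : (n : O) ≠ 0 := by exact_mod_cast hn0.ne'
  have hw : ∃ w : O, w ≠ 0 ∧ x * Q.σ w = n * w := by
    by_cases h0 : (n : O) + x = 0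
    · refine ⟨Q.δ, ?_, ?_⟩
      · intro h
        have h1 := Q.hδ
        rw [h] at h1
        have h2 : ((p * q : ℕ) : O) = 0 := by push_cast; linear_combination h1
        have : p * q = 0 := by exact_mod_cast h2
        omega
      · rw [Q.hσ]; linear_combination (-Q.δ) * h0
    · refine ⟨n + x, h0, ?_⟩
      rw [map_add, map_intCast]
      rw [hmn] at hm
      push_cast at hm
      linear_combination hm
  obtain ⟨w, hw0, hw⟩ := hw
  have hsw0 : Q.σ w ≠ 0 := fun h => hw0 (by rw [← Q.sigsig w, h, map_zero])
  refine ⟨Q.σ w, hsw0, ?_⟩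
  obtain ⟨k, hk, -, hk0⟩ := Q.norm_int hpq w
  have hk0' := hk0 hw0
  have hIc : Ideal.span {x} * Q.cj I = Ideal.span {(n : O)} * I := by rw [← hx, ← hn]; ring
  have hspn : Ideal.span {(n : O)} ≠ 0 := by
    rw [Ne, Ideal.zero_eq_bot, Ideal.span_singleton_eq_bot]; exact hnO
  have hinv : Q.cj (Ideal.span {Q.σ w} * I) = Ideal.span {Q.σ w} * I := by
    apply mul_left_cancel₀ hspn
    rw [Q.cj_mul, Q.cj_span, Q.sigsig]
    calc Ideal.span {(n : O)} * (Ideal.span {w} * Q.cj I) = Ideal.span {(n : O) * w} * Q.cj I := by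
          rw [← Ideal.span_singleton_mul_span_singleton]; ring
      _ = Ideal.span {Q.σ w} * (Ideal.span {x} * Q.cj I) := by
          rw [← hw, ← Ideal.span_singleton_mul_span_singleton]; ring
      _ = _ := by rw [hIc]; ring
  obtain ⟨r, hr⟩ := Int.eq_ofNat_of_zero_le (a := n * k) (by positivity)
  refine Q.inv_ideal hp hq hne hpq r ?_ _ hinv ?_
  · have : 0 < n * k := by positivity
    omega
  · have e : ((r : ℕ) : O) = n * k := by
      have := congrArg (Int.cast : ℤ → O) hr
      push_cast at this
      rw [this]
    rw [e, ← hk]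
    calc Ideal.span {Q.σ w} * I * (Ideal.span {Q.σ w} * I) = Ideal.span {Q.σ w} * Ideal.span {Q.σ w} * (I * I) := by ring
      _ = Ideal.span {Q.σ w * Q.σ w * x} := by
        rw [hx, Ideal.span_singleton_mul_span_singleton, Ideal.span_singleton_mul_span_singleton]
      _ = _ := by congr 2; linear_combination (Q.σ w) * hw

end QData

end SecQuadB

section SecQuadC

set_option linter.unusedSectionVars false

section icl
variable {O : Type} [CommRing O] [IsDedekindDomain O]

open Classical in
/-- class of an ideal (1 for the zero ideal) -/
noncomputable def icl (I : Ideal O) : ClassGroup O :=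
  if h : I = ⊥ then 1 else ClassGroup.mk0 ⟨I, mem_nonZeroDivisors_of_ne_zero h⟩

lemma icl_eq {I : Ideal O} (h : I ≠ ⊥) : icl I = ClassGroup.mk0 ⟨I, mem_nonZeroDivisors_of_ne_zero h⟩ := by
  rw [icl, dif_neg h]

lemma icl_mul {I J : Ideal O} (hI : I ≠ ⊥) (hJ : J ≠ ⊥) : icl (I * J) = icl I * icl J := by
  have hIJ : I * J ≠ ⊥ := by
    intro h
    rcases Ideal.mul_eq_bot.1 h with h | h
    · exact hI h
    · exact hJ h
  rw [icl_eq hI, icl_eq hJ, icl_eq hIJ, ← map_mul]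
  rfl

lemma icl_eq_one_iff {I : Ideal O} (hI : I ≠ ⊥) : icl I = 1 ↔ ∃ x, I = Ideal.span {x} := by
  rw [icl_eq hI, ClassGroup.mk0_eq_one_iff]
  constructor
  · intro h; exact h.principal
  · intro h; exact ⟨h⟩

lemma icl_span (x : O) : icl (Ideal.span {x}) = 1 := by
  by_cases h : Ideal.span {x} = ⊥
  · rw [icl, dif_pos h]
  · exact (icl_eq_one_iff h).2 ⟨x, rfl⟩

lemma icl_surj (c : ClassGroup O) : ∃ I : Ideal O, I ≠ ⊥ ∧ icl I = c := by
  obtain ⟨⟨I, hI⟩, rfl⟩ := ClassGroup.mk0_surjective c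
  have h : I ≠ ⊥ := nonZeroDivisors.ne_zero hI
  exact ⟨I, h, icl_eq h⟩

lemma icl_pow {I : Ideal O} (hI : I ≠ ⊥) (n : ℕ) : icl (I ^ n) = icl I ^ n := by
  induction n with
  | zero => rw [pow_zero, pow_zero, ← icl_span (1 : O)]; simp
  | succ n ih => rw [pow_succ, pow_succ, icl_mul (pow_ne_zero n hI) hI, ih]

lemma span_ne_bot {x : O} (h : x ≠ 0) : Ideal.span {x} ≠ ⊥ := by
  rwa [Ne, Ideal.span_singleton_eq_bot]

lemma ideal_mul_ne_bot {I J : Ideal O} (hI : I ≠ ⊥) (hJ : J ≠ ⊥) : I * J ≠ ⊥ := by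
  intro h
  rcases Ideal.mul_eq_bot.1 h with h | h
  · exact hI h
  · exact hJ h

end icl

lemma grp_SP {C : Type*} [CommGroup C] [Finite C] (a P : C) (h2 : ∀ c : C, c ^ 2 = 1 → c = 1 ∨ c = a)
    (hP : ¬ ∃ c : C, c ^ 2 = P) (c : C) (hc : c ^ 2 ∈ Subgroup.zpowers P) : c ∈ Subgroup.zpowers P := by
  let f : C →* C := powMonoidHom 2
  have hker : Nat.card f.ker ≤ 2 := by
    have hsub : (f.ker : Set C) ⊆ {1, a} := by
      intro x hx
      exact h2 x hx
    have := Set.ncard_le_ncard hsub (Set.toFinite _)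
    rw [← Nat.card_coe_set_eq] at this
    exact this.trans ((Set.ncard_insert_le 1 {a}).trans (by rw [Set.ncard_singleton]))
  have hindex : f.range.index ≤ 2 := by
    have h1 := Subgroup.card_mul_index f.ker
    have h3 := Subgroup.card_mul_index f.range
    rw [Subgroup.index_ker] at h1
    have h4 : 0 < Nat.card f.range := Nat.card_pos
    have : Nat.card f.range * f.range.index = Nat.card f.range * Nat.card f.ker := by rw [h3, ← h1]; ring
    rw [Nat.eq_of_mul_eq_mul_left h4 this]
    exact hker
  have hPn : P ∉ f.range := by
    rintro ⟨c, hc⟩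
    exact hP ⟨c, hc⟩
  have hidx2 : f.range.index = 2 := by
    have h0 : f.range.index ≠ 0 := Subgroup.index_ne_zero_of_finite
    have h1 : f.range.index ≠ 1 := by
      intro h
      rw [Subgroup.index_eq_one] at h
      rw [h] at hPn
      exact hPn trivial
    omega
  have hcov : ∀ x : C, (∃ y, y ^ 2 = x) ∨ ∃ y, y ^ 2 = x * P := by
    intro x
    by_cases hx : x ∈ f.range
    · left; exact hx
    · right
      have := (Subgroup.mul_mem_iff_of_index_two hidx2 (a := x) (b := P)).2 (by simp [hx, hPn])
      exact this
  let D := C ⧸ Subgroup.zpowers P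
  have hsurj : Function.Surjective (powMonoidHom 2 : D →* D) := by
    intro d
    obtain ⟨x, rfl⟩ := QuotientGroup.mk_surjective d
    rcases hcov x with ⟨y, hy⟩ | ⟨y, hy⟩
    · exact ⟨(y : D), by simp only [powMonoidHom_apply]; rw [← hy]; rfl⟩
    · refine ⟨(y : D), ?_⟩
      have : ((y : D)) ^ 2 = ((x * P : C) : D) := by rw [← hy]; rfl
      rw [powMonoidHom_apply, this, QuotientGroup.mk_mul, (QuotientGroup.eq_one_iff P).2 (Subgroup.mem_zpowers P), mul_one]
  have hinj := Finite.injective_iff_surjective.2 hsurj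
  have h5 : (c : D) = 1 := by
    apply hinj
    simp only [powMonoidHom_apply, one_pow]
    have : ((c ^ 2 : C) : D) = 1 := (QuotientGroup.eq_one_iff _).2 hc
    exact this
  exact (QuotientGroup.eq_one_iff c).1 h5

lemma p2_nosol (p q : ℕ) (hp : p.Prime) (hq : q.Prime) (hne : p ≠ q) (hp8 : p % 8 = 5) :
    ∀ N : ℕ, ∀ n t c : ℤ, n.natAbs = N → n ≠ 0 → 8 * n ^ 2 = t ^ 2 + p * q * c ^ 2 → False := by
  intro N
  induction N using Nat.strong_induction_on with
  | _ N ih =>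
  intro n t c hN hn h
  have := Fact.mk hp
  have hpI : Prime (p : ℤ) := Nat.prime_iff_prime_int.mp hp
  have hp0 : (p : ℤ) ≠ 0 := hpI.ne_zero
  have hpn : (p : ℤ) ∣ n := by
    by_contra hpn
    have e1 : jacobiSym (2 ^ 3 * n ^ 2) p = jacobiSym (t ^ 2) p := by
      apply p1_jac_modeq
      exact ⟨q * c ^ 2, by linarith⟩
    rw [jacobiSym.mul_left, p1_sq_one (p1_cop_of_not_dvd hp hpn), jacobiSym.pow_left, jacobiSym.at_two (Nat.odd_iff.2 (by omega)),
      ZMod.χ₈_nat_eq_if_mod_eight, if_neg (by omega), if_neg (by omega), jacobiSym.pow_left] at e1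
    nlinarith [sq_nonneg (jacobiSym t p)]
  obtain ⟨n', rfl⟩ := hpn
  have hpt : (p : ℤ) ∣ t := by
    apply hpI.dvd_of_dvd_pow (n := 2)
    exact ⟨8 * p * n' ^ 2 - q * c ^ 2, by linarith⟩
  obtain ⟨t', rfl⟩ := hpt
  have h1 : (p : ℤ) * (8 * n' ^ 2 - t' ^ 2) = q * c ^ 2 := by
    apply mul_left_cancel₀ hp0; linarith
  have hpc : (p : ℤ) ∣ c := by
    rcases hpI.dvd_or_dvd (Dvd.intro _ h1) with h2 | h2
    · exact absurd ((Nat.prime_dvd_prime_iff_eq hp hq).1 (Int.natCast_dvd_natCast.1 h2)) hne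
    · exact hpI.dvd_of_dvd_pow h2
  obtain ⟨c', rfl⟩ := hpc
  have hn' : n' ≠ 0 := by rintro rfl; simp at hn
  refine ih n'.natAbs ?_ n' t' c' rfl hn' ?_
  · rw [← hN, Int.natAbs_mul, Int.natAbs_natCast]
    have := hp.one_lt
    have : 0 < n'.natAbs := Int.natAbs_pos.2 hn'
    nlinarith
  · apply mul_left_cancel₀ hp0; linarith

namespace QData

variable {O : Type} [CommRing O] [CharZero O] [IsDedekindDomain O] {p q : ℕ} (Q : QData O p q)

/-- the prime above 2 -/
noncomputable def pp : Ideal O := Ideal.span {2, Q.ω}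

noncomputable def pb : Ideal O := Ideal.span {2, Q.σ Q.ω}

lemma omega_tr : Q.ω + Q.σ Q.ω = 1 := by
  have h := Q.two_sig (x := Q.ω) (a := 1) (b := 1) (by rw [Q.hω]; push_cast; ring)
  push_cast at h
  apply mul_left_cancel₀ (two_ne_zero (α := O))
  linear_combination h + Q.hω

lemma omega_norm (hpq : p * q % 8 = 7) : (2 : O) ∣ Q.ω * Q.σ Q.ω := by
  have h := Q.two_sig (x := Q.ω) (a := 1) (b := 1) (by rw [Q.hω]; push_cast; ring)
  push_cast at h
  obtain ⟨r, hr⟩ : ∃ r, p * q = 8 * r + 7 := ⟨p * q / 8, by omega⟩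
  have hr' := congrArg (Nat.cast : ℕ → O) hr
  push_cast at hr'
  refine ⟨r + 1, ?_⟩
  apply mul_left_cancel₀ (show (4 : O) ≠ 0 by norm_num)
  have : (4 : O) * (Q.ω * Q.σ Q.ω) = (2 * Q.ω) * (2 * Q.σ Q.ω) := by ring
  rw [this, h, Q.hω]
  linear_combination -Q.hδ + hr'

lemma pp_mul_pb (hpq : p * q % 8 = 7) : Q.pp * Q.pb = Ideal.span {(2 : O)} := by
  rw [pp, pb, Ideal.span_pair_mul_span_pair]
  apply le_antisymm
  · rw [Ideal.span_le]
    rintro x (rfl | rfl | rfl | rfl)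
    · exact Ideal.mem_span_singleton.2 ⟨2, rfl⟩
    · exact Ideal.mem_span_singleton.2 ⟨_, rfl⟩
    · exact Ideal.mem_span_singleton.2 ⟨_, mul_comm _ _⟩
    · exact Ideal.mem_span_singleton.2 (Q.omega_norm hpq)
  · rw [Ideal.span_singleton_le_iff_mem]
    have : (2 : O) = Q.ω * 2 + 2 * Q.σ Q.ω := by linear_combination (-2 : O) * Q.omega_tr
    have hm : Q.ω * 2 + 2 * Q.σ Q.ω ∈ Ideal.span {(2 : O) * 2, 2 * Q.σ Q.ω, Q.ω * 2, Q.ω * Q.σ Q.ω} := by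
      apply Ideal.add_mem <;> exact Ideal.subset_span (by simp)
    convert hm using 1

lemma cj_pp : Q.cj Q.pp = Q.pb := by
  rw [cj, pp, pb, Ideal.map_span, Set.image_pair, map_ofNat]

lemma pp_ne : Q.pp ≠ ⊥ := by
  intro h
  have : (2 : O) ∈ Q.pp := Ideal.subset_span (by simp)
  rw [h] at this
  exact two_ne_zero ((Submodule.mem_bot O).1 this)

lemma pb_ne : Q.pb ≠ ⊥ := by
  intro h
  have : (2 : O) ∈ Q.pb := Ideal.subset_span (by simp)
  rw [h] at this
  exact two_ne_zero ((Submodule.mem_bot O).1 this)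

lemma pp_sup_pb : Q.pp ⊔ Q.pb = ⊤ := by
  rw [Ideal.eq_top_iff_one, ← Q.omega_tr]
  exact Submodule.add_mem_sup (Ideal.subset_span (by simp)) (Ideal.subset_span (by simp))

lemma pb_ne_top (hpq : p * q % 8 = 7) : Q.pb ≠ ⊤ := by
  intro h
  have h1 := Q.pp_mul_pb hpq
  rw [h, Ideal.mul_top] at h1
  have h2 : Q.ω ∈ Q.pp := Ideal.subset_span (by simp)
  rw [h1, Ideal.mem_span_singleton] at h2
  obtain ⟨x, hx⟩ := h2
  obtain ⟨a, b, hab⟩ := Q.hO x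
  have := Q.coord_unique (by omega) (a := 1) (b := 1) (c := 2 * a) (d := 2 * b) (by
    push_cast; linear_combination -Q.hω + 2 * hx + 2 * hab)
  omega

lemma pp_not_sq (hp : p.Prime) (hq : q.Prime) (hne : p ≠ q) (hp8 : p % 8 = 5) (hpq : p * q % 8 = 7) :
    ¬ ∃ c : ClassGroup O, c ^ 2 = icl Q.pp := by
  rintro ⟨c, hc⟩
  obtain ⟨I, hI, hIc⟩ := icl_surj c⁻¹
  have h1 : icl (Q.pp * (I * I)) = 1 := by
    rw [icl_mul Q.pp_ne (ideal_mul_ne_bot hI hI), icl_mul hI hI, hIc, ← hc]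
    group
  have hne0 : Q.pp * (I * I) ≠ ⊥ := ideal_mul_ne_bot Q.pp_ne (ideal_mul_ne_bot hI hI)
  obtain ⟨x, hx⟩ := (icl_eq_one_iff hne0).1 h1
  have hx0 : x ≠ 0 := by
    rintro rfl
    apply hne0; rw [hx]; simp
  obtain ⟨n, hn0, hn⟩ := Q.mul_cj hpq I hI
  obtain ⟨m, hm, -, hm2⟩ := Q.norm_int hpq x
  have hmn : m = 2 * n ^ 2 := by
    apply Q.int_eq_of_span hpq (hm2 hx0) (by positivity)
    rw [← hm]
    push_cast
    rw [sq, ← Ideal.span_singleton_mul_span_singleton, ← Ideal.span_singleton_mul_span_singleton, 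
      ← Ideal.span_singleton_mul_span_singleton, ← hn, ← Q.cj_span, ← hx, Q.cj_mul, Q.cj_mul, Q.cj_pp, ← Q.pp_mul_pb hpq]
    ring
  obtain ⟨t, c, htc⟩ := Q.hO x
  have h4 := Q.four_norm htc
  rw [hm, hmn] at h4
  have h5 : 4 * (2 * n ^ 2) = t ^ 2 + p * q * c ^ 2 := by exact_mod_cast h4
  exact p2_nosol p q hp hq hne hp8 _ n t c rfl hn0.ne' (by linarith)

lemma aa_ne (hp : p.Prime) : Q.aa ≠ ⊥ := by
  intro h
  have : (p : O) ∈ Q.aa := Ideal.subset_span (by simp)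
  rw [h] at this
  have h2 := (Submodule.mem_bot O).1 this
  have : p = 0 := by exact_mod_cast h2
  exact hp.ne_zero this

lemma SPodd [Finite (ClassGroup O)] (hp : p.Prime) (hq : q.Prime) (hne : p ≠ q) (hp8 : p % 8 = 5) (hpq : p * q % 8 = 7)
    (c : ClassGroup O) (hc : c ^ 2 ∈ Subgroup.zpowers (icl Q.pp)) : c ∈ Subgroup.zpowers (icl Q.pp) := by
  refine grp_SP (icl Q.aa) (icl Q.pp) ?_ (Q.pp_not_sq hp hq hne hp8 hpq) c hc
  intro c hc
  obtain ⟨I, hI, rfl⟩ := icl_surj c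
  have h1 : icl (I * I) = 1 := by rw [icl_mul hI hI, ← sq, hc]
  obtain ⟨x, hx⟩ := (icl_eq_one_iff (ideal_mul_ne_bot hI hI)).1 h1
  have haa := Q.aa_sq ((Nat.coprime_primes hp hq).2 hne)
  have haa' : icl Q.aa * icl Q.aa = 1 := by rw [← icl_mul (Q.aa_ne hp) (Q.aa_ne hp), haa, icl_span]
  obtain ⟨w, hw, ⟨z, hz⟩ | ⟨z, hz⟩⟩ := Q.two_torsion_ideal hp hq hne hpq I hI x hx
  · left
    have := congrArg icl hz
    rwa [icl_mul (span_ne_bot hw) hI, icl_span, icl_span, one_mul] at this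
  · right
    have := congrArg icl hz
    rw [icl_mul (ideal_mul_ne_bot (span_ne_bot hw) hI) (Q.aa_ne hp), icl_mul (span_ne_bot hw) hI, icl_span, icl_span, one_mul] at this
    exact mul_right_cancel (this.trans haa'.symm)

end QData

end SecQuadC

section SecQuadD

set_option linter.unusedSectionVars false

namespace QData

variable {O : Type} [CommRing O] [CharZero O] [IsDedekindDomain O] {p q : ℕ} (Q : QData O p q)

lemma not_two_dvd (hpq : p * q % 8 = 7) {I : Ideal O} (hI : I ⊔ Q.pb = ⊤) {N : ℕ} {x : O}
    (h : I * Q.pp ^ N = Ideal.span {x}) : ¬ (2 : O) ∣ x := by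
  intro hd
  have h1 : IsCoprime (I * Q.pp ^ N) Q.pb :=
    (Ideal.isCoprime_iff_sup_eq.2 hI).mul_left ((Ideal.isCoprime_iff_sup_eq.2 Q.pp_sup_pb).pow_left)
  rw [h, Ideal.isCoprime_iff_sup_eq] at h1
  have h2 : Ideal.span {x} ≤ Q.pb := by
    rw [Ideal.span_singleton_le_iff_mem]
    obtain ⟨y, rfl⟩ := hd
    exact Ideal.mul_mem_right _ _ (Ideal.subset_span (by simp))
  rw [sup_eq_right.2 h2] at h1
  exact Q.pb_ne_top hpq h1

lemma odd_sup (Q : QData O p q) {I : Ideal O} {n : ℕ} (hn : n % 2 = 1) (h : (n : O) ∈ I) : I ⊔ Q.pb = ⊤ := by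
  rw [Ideal.eq_top_iff_one]
  obtain ⟨k, hk⟩ : ∃ k, n = 2 * k + 1 := ⟨n / 2, by omega⟩
  have : (1 : O) = n + (-k) * 2 := by rw [hk]; push_cast; ring
  rw [this]
  exact Submodule.add_mem_sup h (Ideal.mul_mem_left _ _ (Ideal.subset_span (by simp)))

set_option maxHeartbeats 2000000 in
theorem output (Q : QData O p q) [Finite (ClassGroup O)] (hp : p.Prime) (hq : q.Prime)
    (hp8 : p % 8 = 5) (hq8 : q % 8 = 3)
    (X Y Z : ℕ) (hZ : 0 < Z)
    (heq : p * X ^ 2 + q * Y ^ 2 = Z ^ 2)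
    (g1 : Nat.gcd X Y = 1) (g2 : Nat.gcd Y Z = 1) (g3 : Nat.gcd Z X = 1)
    (g4 : Nat.gcd p (Y * Z) = 1)
    (hXodd : Odd X) (hYeven : Even Y) (hZ4 : Z % 4 = 1)
    (hcond : ((∃ x : ZMod p, x ^ 4 = (Z : ZMod p)) ∧ jacobiSym (2 * (X : ℤ)) Z = -1) ∨
             ((∃ x : ZMod p, x ^ 2 = (Z : ZMod p)) ∧
              (¬ ∃ x : ZMod p, x ^ 4 = (Z : ZMod p)) ∧ jacobiSym (2 * (X : ℤ)) Z = 1)) :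
    ∃ m : ℕ, ∃ A B : ℤ, Odd m ∧ Odd A ∧ Odd B ∧ p * A ^ 2 + q * B ^ 2 = 4 * 16 ^ m := by
  have := Fact.mk hp
  have hne : p ≠ q := by rintro rfl; omega
  have hpq : p * q % 8 = 7 := by rw [Nat.mul_mod, hp8, hq8]
  have hpO : (p : O) ≠ 0 := by exact_mod_cast hp.ne_zero
  have hZO : (Z : O) ≠ 0 := by exact_mod_cast hZ.ne'
  have heqO : (p : O) * X ^ 2 + q * Y ^ 2 = Z ^ 2 := by exact_mod_cast congrArg (Nat.cast : ℕ → O) heq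
  set θ : O := p * X + Y * Q.δ with hθ
  have hσθ : Q.σ θ = p * X - Y * Q.δ := by
    rw [hθ, map_add, map_mul, map_mul, Q.hσ, map_natCast, map_natCast, map_natCast]; ring
  have hθθ : θ * Q.σ θ = p * Z ^ 2 := by
    rw [hσθ, hθ]; linear_combination (-(Y : O) ^ 2) * Q.hδ + (p : O) * heqO
  have hθ0 : θ ≠ 0 := by
    intro h
    rw [h, zero_mul] at hθθ
    rcases mul_eq_zero.1 hθθ.symm with h | h
    · exact hpO h
    · exact hZO (by simpa using h)
  have hcopZ : Nat.Coprime Z (2 * p * X) := by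
    refine Nat.Coprime.mul_right (Nat.Coprime.mul_right ?_ ?_) g3
    · exact (Nat.coprime_two_right).2 (Nat.odd_iff.2 (by omega))
    · exact (Nat.Coprime.coprime_mul_left_right g4).symm
  obtain ⟨e1, e2, he⟩ := Nat.isCoprime_iff_coprime.2 hcopZ
  have heO : (e1 : O) * Z + e2 * (2 * p * X) = 1 := by exact_mod_cast congrArg (Int.cast : ℤ → O) he
  set J : Ideal O := Ideal.span {(Z : O), θ} with hJ
  have hJZ : (Z : O) ∈ J := Ideal.subset_span (by simp)
  have hJθ : θ ∈ J := Ideal.subset_span (by simp)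
  have hcJ : Q.cj J = Ideal.span {(Z : O), Q.σ θ} := by
    rw [cj, hJ, Ideal.map_span, Set.image_pair, map_natCast]
  have hJne : J ≠ ⊥ := by
    intro h
    rw [h] at hJZ
    exact hZO ((Submodule.mem_bot O).1 hJZ)
  have hJJ : J * Q.cj J = Ideal.span {(Z : O)} := by
    rw [hcJ, hJ, Ideal.span_pair_mul_span_pair]
    apply le_antisymm
    · rw [Ideal.span_le]
      rintro x (rfl | rfl | rfl | rfl)
      · exact Ideal.mem_span_singleton.2 ⟨Z, rfl⟩
      · exact Ideal.mem_span_singleton.2 ⟨_, rfl⟩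
      · exact Ideal.mem_span_singleton.2 ⟨_, mul_comm _ _⟩
      · exact Ideal.mem_span_singleton.2 ⟨p * Z, by rw [hθθ]; ring⟩
    · rw [Ideal.span_singleton_le_iff_mem]
      have : (Z : O) = e1 * (Z * Z) + (e2 * (Z * Q.σ θ) + e2 * (θ * Z)) := by
        rw [hσθ, hθ]; linear_combination (-Z : O) * heO
      have hm : (e1 : O) * (Z * Z) + (e2 * (Z * Q.σ θ) + e2 * (θ * Z)) ∈ Ideal.span {(Z : O) * Z, Z * Q.σ θ, θ * Z, θ * Q.σ θ} := by
        refine Ideal.add_mem _ ?_ (Ideal.add_mem _ ?_ ?_) <;>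
          exact Ideal.mul_mem_left _ _ (Ideal.subset_span (by simp))
      convert hm using 1
  obtain ⟨f1, f2, hf⟩ := Nat.isCoprime_iff_coprime.2 (Nat.Coprime.coprime_mul_right_right g4 : Nat.Coprime p Y)
  have hfO : (f1 : O) * p + f2 * Y = 1 := by exact_mod_cast congrArg (Int.cast : ℤ → O) hf
  have hpJ : Ideal.span {(p : O)} * (J * J) = Ideal.span {θ} * Q.aa := by
    have h1 : Ideal.span {(p : O)} * (J * J) = Ideal.span {θ} * Ideal.span {Q.σ θ, (p : O) * Z, (p : O) * θ} := by
      rw [hJ, Ideal.span_pair_mul_span_pair]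
      apply le_antisymm
      · rw [Ideal.span_singleton_mul_le_iff]
        intro z hz
        rw [Ideal.mem_span_singleton_mul]
        induction hz using Submodule.span_induction with
        | mem x hx =>
          rcases hx with rfl | rfl | rfl | rfl
          · exact ⟨Q.σ θ, Ideal.subset_span (by simp), by rw [hθθ]; ring⟩
          · exact ⟨p * Z, Ideal.subset_span (by simp), by ring⟩
          · exact ⟨p * Z, Ideal.subset_span (by simp), by ring⟩
          · exact ⟨p * θ, Ideal.subset_span (by simp), by ring⟩
        | zero => exact ⟨0, Submodule.zero_mem _, by simp⟩
        | add x y _ _ hx hy =>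
          obtain ⟨a, ha, ha'⟩ := hx
          obtain ⟨b, hb, hb'⟩ := hy
          exact ⟨a + b, Submodule.add_mem _ ha hb, by rw [mul_add, mul_add, ha', hb']⟩
        | smul r x _ hx =>
          obtain ⟨a, ha, ha'⟩ := hx
          exact ⟨r * a, Ideal.mul_mem_left _ _ ha, by rw [smul_eq_mul, mul_left_comm, ha']; ring⟩
      · rw [Ideal.span_singleton_mul_le_iff]
        intro z hz
        rw [Ideal.mem_span_singleton_mul]
        induction hz using Submodule.span_induction with
        | mem x hx =>
          rcases hx with rfl | rfl | rfl
          · exact ⟨Z * Z, Ideal.subset_span (by simp), by rw [hθθ]; ring⟩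
          · exact ⟨Z * θ, Ideal.subset_span (by simp), by ring⟩
          · exact ⟨θ * θ, Ideal.subset_span (by simp), by ring⟩
        | zero => exact ⟨0, Submodule.zero_mem _, by simp⟩
        | add x y _ _ hx hy =>
          obtain ⟨a, ha, ha'⟩ := hx
          obtain ⟨b, hb, hb'⟩ := hy
          exact ⟨a + b, Submodule.add_mem _ ha hb, by rw [mul_add, mul_add, ha', hb']⟩
        | smul r x _ hx =>
          obtain ⟨a, ha, ha'⟩ := hx
          exact ⟨r * a, Ideal.mul_mem_left _ _ ha, by rw [smul_eq_mul, mul_left_comm, ha']; ring⟩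
    rw [h1]
    congr 1
    rw [aa]
    apply le_antisymm
    · rw [Ideal.span_le]
      rintro x (rfl | rfl | rfl)
      · rw [hσθ]
        exact Ideal.mem_span_pair.2 ⟨X, -Y, by ring⟩
      · exact Ideal.mem_span_pair.2 ⟨Z, 0, by ring⟩
      · exact Ideal.mem_span_pair.2 ⟨θ, 0, by ring⟩
    · have hpm : (p : O) ∈ Ideal.span {Q.σ θ, (p : O) * Z, (p : O) * θ} := by
        have : (p : O) = e1 * (p * Z) + (e2 * (p * θ) + (e2 * p) * Q.σ θ) := by
          rw [hσθ, hθ]; linear_combination (-p : O) * heO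
        have hm : (e1 : O) * (p * Z) + (e2 * (p * θ) + (e2 * p) * Q.σ θ) ∈ Ideal.span {Q.σ θ, (p : O) * Z, (p : O) * θ} := by
          refine Ideal.add_mem _ ?_ (Ideal.add_mem _ ?_ ?_) <;>
            exact Ideal.mul_mem_left _ _ (Ideal.subset_span (by simp))
        convert hm using 1
      rw [Ideal.span_le]
      rintro x (rfl | rfl)
      · exact hpm
      · have : Q.δ = (f1 * Q.δ + f2 * X) * p + (-f2) * Q.σ θ := by
          rw [hσθ]; linear_combination (-Q.δ) * hfO
        have hm : (f1 * Q.δ + f2 * X) * p + (-f2) * Q.σ θ ∈ Ideal.span {Q.σ θ, (p : O) * Z, (p : O) * θ} := by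
          refine Ideal.add_mem _ (Ideal.mul_mem_left _ _ hpm) ?_
          exact Ideal.mul_mem_left _ _ (Ideal.subset_span (by simp))
        change Q.δ ∈ Ideal.span {Q.σ θ, (p : O) * Z, (p : O) * θ}
        convert hm using 1
  have haane := Q.aa_ne hp
  have hcJJ : icl J ^ 2 = icl Q.aa := by
    have := congrArg icl hpJ
    rwa [icl_mul (span_ne_bot hpO) (ideal_mul_ne_bot hJne hJne), icl_mul hJne hJne, icl_span,
      icl_mul (span_ne_bot hθ0) haane, icl_span, one_mul, one_mul, ← sq] at this
  have haa := Q.aa_sq ((Nat.coprime_primes hp hq).2 hne)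
  have haa' : icl Q.aa ^ 2 = 1 := by rw [sq, ← icl_mul haane haane, haa, icl_span]
  have hJmem : icl J ∈ Subgroup.zpowers (icl Q.pp) := by
    apply Q.SPodd hp hq hne hp8 hpq
    apply Q.SPodd hp hq hne hp8 hpq
    rw [hcJJ, haa']
    exact one_mem _
  obtain ⟨N0, hN0⟩ := mem_powers_iff_mem_zpowers.2 (inv_mem hJmem)
  simp only at hN0
  obtain ⟨N, hN1, hN⟩ : ∃ N, 1 ≤ N ∧ icl Q.pp ^ N = (icl J)⁻¹ := by
    refine ⟨N0 + orderOf (icl Q.pp), ?_, by rw [pow_add, pow_orderOf_eq_one, mul_one, hN0]⟩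
    have := orderOf_pos (icl Q.pp)
    omega
  have hppN : Q.pp ^ N ≠ ⊥ := pow_ne_zero N Q.pp_ne
  obtain ⟨μ, hμ⟩ := (icl_eq_one_iff (ideal_mul_ne_bot hJne hppN)).1
    (by rw [icl_mul hJne hppN, icl_pow Q.pp_ne, hN, mul_inv_cancel])
  have hμ0 : μ ≠ 0 := by
    rintro rfl
    apply ideal_mul_ne_bot hJne hppN; rw [hμ]; simp
  obtain ⟨k, hk, -, hk0⟩ := Q.norm_int hpq μ
  have hcjpow : Q.cj (Q.pp ^ N) = Q.pb ^ N := by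
    rw [← Q.cj_pp, cj, cj, Ideal.map_pow]
  have hkN : k = 2 ^ N * Z := by
    apply Q.int_eq_of_span hpq (hk0 hμ0) (by positivity)
    rw [← hk]
    push_cast
    rw [← Ideal.span_singleton_mul_span_singleton, ← Ideal.span_singleton_mul_span_singleton, ← Q.cj_span, ← hμ,
      ← Ideal.span_singleton_pow, ← Q.pp_mul_pb hpq, ← hJJ, Q.cj_mul, hcjpow, mul_pow]
    ring
  have hZ2 : Z % 2 = 1 := by omega
  have hnd := Q.not_two_dvd hpq (Q.odd_sup hZ2 hJZ) hμ
  obtain ⟨u, v, huv⟩ := Q.hO μ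
  have hpar := Q.parity hpq huv
  have hu : u % 2 = 1 := by
    by_contra hcon
    apply hnd
    refine Q.two_dvd_of hpq huv (by omega) hk ?_
    rw [hkN]
    obtain ⟨N', rfl⟩ : ∃ N', N = N' + 1 := ⟨N - 1, by omega⟩
    rw [pow_succ]
    have : (2 : ℤ) ^ N' * 2 * Z = 2 * (2 ^ N' * Z) := by ring
    rw [this]; omega
  have hnorm : u ^ 2 + p * q * v ^ 2 = 4 * (2 ^ N * Z) := by
    have := Q.four_norm huv
    rw [hk, hkN] at this
    exact_mod_cast this.symm
  have hpZ : ¬ (p : ℤ) ∣ Z := by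
    intro h1
    have := Nat.dvd_gcd (dvd_refl p) ((Int.natCast_dvd_natCast.1 h1).mul_left Y)
    rw [g4] at this
    exact hp.one_lt.ne' (Nat.dvd_one.1 this)
  have hJZp : jacobiSym Z p = 1 := by
    rw [← jacobiSym.legendreSym.to_jacobiSym, legendreSym.eq_one_iff]
    · rcases hcond with ⟨⟨x, hx⟩, -⟩ | ⟨⟨x, hx⟩, -⟩
      · exact ⟨x ^ 2, by push_cast; rw [← hx]; ring⟩
      · exact ⟨x, by push_cast; rw [← hx]; ring⟩
    · intro h0
      exact hpZ ((ZMod.intCast_zmod_eq_zero_iff_dvd (Z : ℤ) p).1 h0)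
  have hNe : Even N := by
    by_contra hodd
    rw [Nat.not_even_iff_odd] at hodd
    have e1 : jacobiSym (2 ^ 2 * (2 ^ N * Z)) p = jacobiSym (u ^ 2) p := by
      apply p1_jac_modeq
      exact ⟨q * v ^ 2, by linarith⟩
    rw [jacobiSym.mul_left, jacobiSym.mul_left, hJZp, jacobiSym.pow_left, jacobiSym.pow_left _ N, jacobiSym.at_two (Nat.odd_iff.2 (by omega)),
      ZMod.χ₈_nat_eq_if_mod_eight, if_neg (by omega), if_neg (by omega), jacobiSym.pow_left, hodd.neg_one_pow] at e1
    nlinarith [sq_nonneg (jacobiSym u p)]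
  obtain ⟨m, hm⟩ := hNe
  have hN2 : N = 2 * m := by omega
  have hdvd : (Z : ℤ) ∣ u * Y - v * p * X := by
    have h1 : μ * Q.σ θ ∈ J * Q.cj J := by
      apply Ideal.mul_mem_mul
      · have : μ ∈ J * Q.pp ^ N := by rw [hμ]; exact Ideal.mem_span_singleton_self μ
        exact (Ideal.mul_le_left : J * Q.pp ^ N ≤ J) this
      · rw [Q.mem_cj, Q.sigsig]; exact hJθ
    rw [hJJ, Ideal.mem_span_singleton] at h1
    obtain ⟨x, hx⟩ := h1
    obtain ⟨c, d, hcd⟩ := Q.hO x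
    have := Q.coord_unique (by omega) (a := u * p * X + p * q * v * Y) (b := v * p * X - u * Y) (c := Z * c) (d := Z * d) (by
      push_cast
      rw [hσθ] at hx
      linear_combination (-(p * X - Y * Q.δ)) * huv + 2 * hx + (Z : O) * hcd + (v * Y : O) * Q.hδ)
    exact ⟨-d, by linarith [this.2]⟩
  have hmodd : Odd m := by
    refine p1_main p q hp hq hp8 hq8 X Y Z hZ heq g1 g2 g4 hXodd hYeven hZ4 hcond u v (Int.odd_iff.2 (by omega)) m ?_ hdvd
    rw [hnorm, hN2]; ring
  -- gamma
  have h1 : (p : O) * (μ * μ) ∈ Ideal.span {θ} * Q.aa := by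
    rw [← hpJ]
    have hμJ : μ ∈ J := by
      have : μ ∈ J * Q.pp ^ N := by rw [hμ]; exact Ideal.mem_span_singleton_self μ
      exact (Ideal.mul_le_left : J * Q.pp ^ N ≤ J) this
    exact Ideal.mul_mem_mul (Ideal.mem_span_singleton_self _) (Ideal.mul_mem_mul hμJ hμJ)
  obtain ⟨γ, hγa, hγ⟩ := Ideal.mem_span_singleton_mul.1 h1
  have hspan : Q.aa * Q.pp ^ (2 * N) = Ideal.span {γ} := by
    have hs : Ideal.span {θ} ≠ 0 := span_ne_bot hθ0
    apply mul_left_cancel₀ hs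
    rw [← mul_assoc, ← hpJ, Ideal.span_singleton_mul_span_singleton, hγ, ← Ideal.span_singleton_mul_span_singleton,
      ← Ideal.span_singleton_mul_span_singleton, ← hμ]
    ring
  have hpm : (p : O) ∈ Q.aa := Ideal.subset_span (by simp)
  have hnd2 := Q.not_two_dvd hpq (Q.odd_sup (by omega) hpm) hspan
  have hnγ : γ * Q.σ γ = ((p * 4 ^ N : ℤ) : O) := by
    apply mul_left_cancel₀ (mul_ne_zero hpO (pow_ne_zero 2 hZO))
    rw [← hθθ]
    have h2 := congrArg Q.σ hγ
    simp only [map_mul, map_natCast] at h2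
    have h3 : (θ * Q.σ θ) * (γ * Q.σ γ) = p * (μ * μ) * (p * (Q.σ μ * Q.σ μ)) := by rw [← hγ, ← h2]; ring
    have h4 : p * (μ * μ) * (p * (Q.σ μ * Q.σ μ)) = (p : O) ^ 2 * (μ * Q.σ μ) ^ 2 := by ring
    rw [h3, h4, hk, hkN, hθθ]
    push_cast
    have : (4 : O) ^ N = (2 ^ N) ^ 2 := by rw [← pow_mul, mul_comm, pow_mul]; norm_num
    rw [this]; ring
  obtain ⟨a, B, haB⟩ := Q.hO γ
  have hpa : (p : ℤ) ∣ a := by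
    obtain ⟨x, y, hxy⟩ := Ideal.mem_span_pair.1 hγa
    obtain ⟨x1, x2, hx⟩ := Q.hO x
    obtain ⟨y1, y2, hy⟩ := Q.hO y
    have := Q.coord_unique (by omega) (a := a) (b := B) (c := p * x1 - p * q * y2) (d := p * x2 + y1) (by
      push_cast
      linear_combination -haB - 2 * hxy + (p : O) * hx + Q.δ * hy + (y2 : O) * Q.hδ)
    exact ⟨x1 - q * y2, by rw [this.1]; ring⟩
  obtain ⟨A, rfl⟩ := hpa
  have hpar2 := Q.parity hpq haB
  have hodd : (p * A) % 2 = 1 := by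
    by_contra hcon
    apply hnd2
    refine Q.two_dvd_of hpq haB (by omega) hnγ ?_
    obtain ⟨N', rfl⟩ : ∃ N', N = N' + 1 := ⟨N - 1, by omega⟩
    rw [pow_succ]
    have : (p : ℤ) * (4 ^ N' * 4) = 2 * (p * 4 ^ N' * 2) := by ring
    rw [this]; omega
  refine ⟨m, A, B, hmodd, (Int.odd_mul.1 (Int.odd_iff.2 hodd)).2, Int.odd_iff.2 (by omega), ?_⟩
  have h5 := Q.four_norm haB
  rw [hnγ] at h5
  have h6 : 4 * ((p : ℤ) * 4 ^ N) = (p * A) ^ 2 + p * q * B ^ 2 := by exact_mod_cast h5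
  have hpI0 : (p : ℤ) ≠ 0 := by exact_mod_cast hp.ne_zero
  apply mul_left_cancel₀ hpI0
  have : (16 : ℤ) ^ m = 4 ^ N := by rw [hN2, pow_mul]; norm_num
  rw [this]; linarith

end QData

end SecQuadD

section SecNormPoly

open Polynomial

namespace TwoG

section basic
variable {R : Type*} [CommRing R]

/-- even part -/
noncomputable def fe (f : R[X]) : R[X] := contract 2 f
/-- odd part -/
noncomputable def fo (f : R[X]) : R[X] := contract 2 (divX f)

lemma coeff_fe (f : R[X]) (n : ℕ) : (fe f).coeff n = f.coeff (n * 2) := coeff_contract two_ne_zero f n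
lemma coeff_fo (f : R[X]) (n : ℕ) : (fo f).coeff n = f.coeff (n * 2 + 1) := by
  rw [fo, coeff_contract two_ne_zero, coeff_divX]

lemma decomp (f : R[X]) : f = expand R 2 (fe f) + X * expand R 2 (fo f) := by
  ext n
  rcases Nat.even_or_odd' n with ⟨c, rfl | rfl⟩
  · rcases c with _ | c
    · simp [coeff_expand, coeff_fe]
    · rw [show 2 * (c + 1) = (2 * c + 1) + 1 by ring, coeff_add, coeff_X_mul, coeff_expand two_pos, coeff_expand two_pos,
        if_pos (by omega), if_neg (by omega), coeff_fe, add_zero]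
      congr 1; omega
  · rw [coeff_add, coeff_X_mul, coeff_expand two_pos, coeff_expand two_pos,
        if_neg (by omega), if_pos (by omega), coeff_fo, zero_add]
    congr 1; omega

lemma fe_add (f g : R[X]) : fe (f + g) = fe f + fe g := by ext n; simp [coeff_fe]
lemma fo_add (f g : R[X]) : fo (f + g) = fo f + fo g := by ext n; simp [coeff_fo]
lemma fe_expand_mul (a f : R[X]) : fe (expand R 2 a * f) = a * fe f := by
  rw [fe, mul_comm, contract_mul_expand two_ne_zero, mul_comm]; rfl
lemma fo_expand_mul (a f : R[X]) : fo (expand R 2 a * f) = a * fo f := by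
  conv_lhs => rw [decomp f]
  ext n
  rw [coeff_fo, mul_add, coeff_add, ← map_mul, coeff_expand two_pos, if_neg (by omega), zero_add, mul_left_comm, coeff_X_mul,
    ← map_mul, coeff_expand two_pos, if_pos (by omega)]
  congr 1; omega

/-- Graeffe transform -/
noncomputable def gG (f : R[X]) : R[X] := fe f ^ 2 - X * fo f ^ 2

lemma expand_comp_neg (a : R[X]) : (expand R 2 a).comp (-X) = expand R 2 a := by
  rw [expand_eq_comp_X_pow, comp_assoc]; simp

lemma expand_gG (f : R[X]) : expand R 2 (gG f) = f * f.comp (-X) := by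
  conv_rhs => rw [decomp f]
  rw [add_comp, mul_comp, expand_comp_neg, expand_comp_neg, X_comp, gG, map_sub, map_mul, map_pow, map_pow, expand_X]
  ring

lemma gG_mul (f g : R[X]) : gG (f * g) = gG f * gG g := by
  apply expand_injective two_pos
  rw [map_mul, expand_gG, expand_gG, expand_gG, mul_comp]; ring

lemma gG_map {S : Type*} [CommRing S] (φ : R →+* S) (f : R[X]) : gG (f.map φ) = (gG f).map φ := by
  have h1 : fe (f.map φ) = (fe f).map φ := by ext n; simp [coeff_fe]
  have h2 : fo (f.map φ) = (fo f).map φ := by ext n; simp [coeff_fo]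
  rw [gG, gG, h1, h2]; simp

lemma gG_C (a : R) : gG (C a) = C (a ^ 2) := by
  apply expand_injective two_pos
  rw [expand_gG, expand_C, C_comp, ← C_mul, sq]

lemma gG_expand (a : R[X]) : gG (expand R 2 a) = a ^ 2 := by
  apply expand_injective two_pos
  rw [expand_gG, expand_comp_neg, map_pow, sq]

lemma gG_one_sub : gG (1 - X : R[X]) = 1 - X := by
  apply expand_injective two_pos
  rw [expand_gG, map_sub, map_one, expand_X, sub_comp, one_comp, X_comp]; ring

lemma aeval_gG {A : Type*} [CommRing A] [Algebra R A] (f : R[X]) (x : A) :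
    aeval (x ^ 2) (gG f) = aeval x f * aeval (-x) f := by
  rw [← expand_aeval, expand_gG, map_mul, aeval_comp]; simp

lemma eval_gG (f : R[X]) (x : R) : (gG f).eval (x ^ 2) = f.eval x * f.eval (-x) := by
  rw [← expand_eval, expand_gG, eval_mul, eval_comp]; simp

lemma iter_mul (j : ℕ) (f g : R[X]) : gG^[j] (f * g) = gG^[j] f * gG^[j] g := by
  induction j generalizing f g with
  | zero => rfl
  | succ j ih => rw [Function.iterate_succ_apply, Function.iterate_succ_apply, Function.iterate_succ_apply, gG_mul, ih]

lemma iter_C (j : ℕ) (a : R) : gG^[j] (C a) = C (a ^ 2 ^ j) := by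
  induction j generalizing a with
  | zero => simp
  | succ j ih => rw [Function.iterate_succ_apply, gG_C, ih, ← pow_mul, pow_succ']

lemma iter_map (j : ℕ) {S : Type*} [CommRing S] (φ : R →+* S) (f : R[X]) : gG^[j] (f.map φ) = (gG^[j] f).map φ := by
  induction j generalizing f with
  | zero => rfl
  | succ j ih => rw [Function.iterate_succ_apply, Function.iterate_succ_apply, gG_map, ih]

lemma iter_one_sub (j : ℕ) : gG^[j] (1 - X : R[X]) = 1 - X := by
  induction j with
  | zero => rfl
  | succ j ih => rw [Function.iterate_succ_apply, gG_one_sub, ih]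

/-- `nr j f = (G^j f)(-1)` -/
noncomputable def nr (j : ℕ) (f : R[X]) : R := (gG^[j] f).eval (-1)

lemma nr_mul (j : ℕ) (f g : R[X]) : nr j (f * g) = nr j f * nr j g := by
  rw [nr, iter_mul, eval_mul]; rfl
lemma nr_C (j : ℕ) (a : R) : nr j (C a) = a ^ 2 ^ j := by rw [nr, iter_C, eval_C]
lemma nr_map (j : ℕ) {S : Type*} [CommRing S] (φ : R →+* S) (f : R[X]) : nr j (f.map φ) = φ (nr j f) := by
  rw [nr, iter_map, nr, eval_map, ← Polynomial.eval₂_at_apply]; simp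
lemma nr_one_sub (j : ℕ) : nr j (1 - X : R[X]) = 2 := by
  rw [nr, iter_one_sub]; simp; norm_num
lemma nr_succ (j : ℕ) (f : R[X]) : nr (j + 1) f = nr j (gG f) := by
  rw [nr, Function.iterate_succ_apply]; rfl
lemma nr_expand (j : ℕ) (f : R[X]) : nr (j + 1) (expand R 2 f) = nr j f ^ 2 := by
  rw [nr_succ, gG_expand, sq, nr_mul, sq]

lemma iter_wd (j : ℕ) (f A : R[X]) : ∃ A', gG^[j] (f + (X ^ 2 ^ j + 1) * A) = gG^[j] f + (X + 1) * A' := by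
  induction j generalizing f A with
  | zero => exact ⟨A, by simp⟩
  | succ j ih =>
    have h : (X ^ 2 ^ (j + 1) + 1 : R[X]) = expand R 2 (X ^ 2 ^ j + 1) := by
      rw [map_add, map_pow, expand_X, map_one, ← pow_mul, pow_succ']
    set B : R[X] := X ^ 2 ^ j + 1 with hB
    have h2 : gG (f + (X ^ 2 ^ (j + 1) + 1) * A) =
        gG f + B * (2 * fe f * fe A + B * fe A ^ 2 - X * (2 * fo f * fo A + B * fo A ^ 2)) := by
      rw [h, gG, gG, fe_add, fo_add, fe_expand_mul, fo_expand_mul]; ring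
    rw [Function.iterate_succ_apply, Function.iterate_succ_apply, h2]
    exact ih _ _

lemma nr_wd (j : ℕ) {f g : R[X]} (h : (X ^ 2 ^ j + 1) ∣ f - g) : nr j f = nr j g := by
  obtain ⟨A, hA⟩ := h
  obtain ⟨A', hA'⟩ := iter_wd j g A
  have : f = g + (X ^ 2 ^ j + 1) * A := by rw [← hA]; ring
  rw [nr, this, hA', nr]; simp

lemma gG_congr {f g : R[X]} {i : ℕ} (hi : 1 ≤ i) (h : (C (2 ^ i)) ∣ f - g) : (C (2 ^ (i + 1))) ∣ gG f - gG g := by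
  obtain ⟨A, hA⟩ := h
  have hf : f = g + expand R 2 (C (2 ^ i)) * A := by rw [expand_C, ← hA]; ring
  obtain ⟨i, rfl⟩ : ∃ k, i = k + 1 := ⟨i - 1, by omega⟩
  rw [hf, gG, gG, fe_add, fo_add, fe_expand_mul, fo_expand_mul]
  refine ⟨fe g * fe A + C (2 ^ i) * fe A ^ 2 - X * (fo g * fo A + C (2 ^ i) * fo A ^ 2), ?_⟩
  have e1 : (C (2 ^ (i + 1)) : R[X]) = 2 * C (2 ^ i) := by rw [pow_succ', C_mul, C_ofNat]
  have e2 : (C (2 ^ (i + 1 + 1)) : R[X]) = 4 * C (2 ^ i) := by rw [pow_succ', C_mul, e1, C_ofNat]; ring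
  rw [e1, e2]
  ring

end basic

lemma c2_dvd_iff (f : ℤ_[2][X]) : C 2 ∣ f ↔ f.map (PadicInt.toZMod (p := 2)) = 0 := by
  rw [C_dvd_iff_dvd_coeff, Polynomial.ext_iff]
  refine forall_congr' fun n => ?_
  rw [coeff_map, coeff_zero, ← RingHom.mem_ker, PadicInt.ker_toZMod, PadicInt.maximalIdeal_eq_span_p,
    Ideal.mem_span_singleton]
  norm_num

lemma gG_base (f : ℤ_[2][X]) : C 2 ∣ gG f - f := by
  rw [c2_dvd_iff, Polynomial.map_sub, ← gG_map, sub_eq_zero]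
  set g := f.map (PadicInt.toZMod (p := 2))
  apply expand_injective two_pos
  rw [expand_gG, ZMod.expand_card g, sq]
  congr 1
  have : (-X : (ZMod 2)[X]) = X := by
    have h2 : (2 : (ZMod 2)[X]) = 0 := by
      have := CharP.cast_eq_zero (ZMod 2)[X] 2
      exact_mod_cast this
    linear_combination (-X) * h2
  rw [this, comp_X]

lemma iter_congr (i : ℕ) (f : ℤ_[2][X]) : C (2 ^ (i + 1)) ∣ gG^[i + 1] f - gG^[i] f := by
  induction i with
  | zero => simpa using gG_base f
  | succ i ih =>
    rw [Function.iterate_succ_apply' gG (i + 1), Function.iterate_succ_apply' gG i]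
    rw [Function.iterate_succ_apply'] at ih
    exact gG_congr (by omega) ih

lemma eval_dvd {f : ℤ_[2][X]} {a : ℤ_[2]} (h : C a ∣ f) (x : ℤ_[2]) : a ∣ f.eval x := by
  obtain ⟨g, rfl⟩ := h
  simp

/-- `2^ℤ (1 + 2^t ℤ_2)` -/
def U (t : ℕ) (y : ℚ_[2]) : Prop := ∃ e : ℤ, ∃ z : ℤ_[2], y = 2 ^ e * (1 + 2 ^ t * (z : ℚ_[2]))

lemma coe_two : ((2 : ℤ_[2]) : ℚ_[2]) = 2 := by norm_cast

lemma two_ne : (2 : ℚ_[2]) ≠ 0 := two_ne_zero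

lemma U_mul {t : ℕ} {x y : ℚ_[2]} (hx : U t x) (hy : U t y) : U t (x * y) := by
  obtain ⟨e, z, rfl⟩ := hx
  obtain ⟨e', z', rfl⟩ := hy
  refine ⟨e + e', z + z' + 2 ^ t * (z * z'), ?_⟩
  rw [zpow_add₀ two_ne]; push_cast; rw [coe_two]; ring

lemma U_sq {t : ℕ} (ht : 1 ≤ t) {x : ℚ_[2]} (hx : U t x) : U (t + 1) (x ^ 2) := by
  obtain ⟨e, z, rfl⟩ := hx
  obtain ⟨s, rfl⟩ : ∃ s, t = s + 1 := ⟨t - 1, by omega⟩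
  refine ⟨e + e, z + 2 ^ s * (z * z), ?_⟩
  rw [zpow_add₀ two_ne]; push_cast; rw [coe_two]; ring

lemma unit_odd {u : ℤ_[2]} (hu : ¬ (2 : ℤ_[2]) ∣ u) : ∃ z, u = 1 + 2 * z := by
  have h : PadicInt.toZMod (p := 2) u = 1 := by
    have h0 : PadicInt.toZMod (p := 2) u ≠ 0 := by
      intro h
      rw [← RingHom.mem_ker, PadicInt.ker_toZMod, PadicInt.maximalIdeal_eq_span_p,
        Ideal.mem_span_singleton] at h
      exact hu (by exact_mod_cast h)
    revert h0
    generalize PadicInt.toZMod (p := 2) u = w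
    revert w; decide
  have h2 : u - 1 ∈ RingHom.ker (PadicInt.toZMod (p := 2)) := by rw [RingHom.mem_ker, map_sub, h, map_one, sub_self]
  rw [PadicInt.ker_toZMod, PadicInt.maximalIdeal_eq_span_p, Ideal.mem_span_singleton] at h2
  obtain ⟨z, hz⟩ := h2
  exact ⟨z, by push_cast at hz; linear_combination hz⟩

lemma not_two_dvd_one : ¬ (2 : ℤ_[2]) ∣ 1 := by
  intro h
  have := isUnit_of_dvd_one h
  have h2 := PadicInt.prime_p (p := 2)
  exact h2.not_isUnit (by exact_mod_cast this)

lemma isUnit_odd (z : ℤ_[2]) : IsUnit (1 + 2 * z) := by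
  by_contra h
  rw [← mem_nonunits_iff, ← IsLocalRing.mem_maximalIdeal, PadicInt.maximalIdeal_eq_span_p, Ideal.mem_span_singleton] at h
  obtain ⟨w, hw⟩ := h
  apply not_two_dvd_one
  exact ⟨w - z, by push_cast at hw; linear_combination hw⟩

lemma isUnit_of_not {u : ℤ_[2]} (hu : ¬ (2 : ℤ_[2]) ∣ u) : IsUnit u := by
  obtain ⟨z, rfl⟩ := unit_odd hu
  exact isUnit_odd z

lemma fin_mult {c : ℤ_[2]} (hc : c ≠ 0) : ∃ n u, c = 2 ^ n * u ∧ ¬ (2 : ℤ_[2]) ∣ u := by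
  have : FiniteMultiplicity (2 : ℤ_[2]) c := by
    apply FiniteMultiplicity.of_prime_left _ hc
    exact_mod_cast PadicInt.prime_p (p := 2)
  obtain ⟨u, hu, hn⟩ := this.exists_eq_pow_mul_and_not_dvd
  exact ⟨_, u, hu, hn⟩

lemma U_coe {c : ℤ_[2]} (hc : c ≠ 0) : U 1 (c : ℚ_[2]) := by
  obtain ⟨n, u, rfl, hu⟩ := fin_mult hc
  obtain ⟨z, rfl⟩ := unit_odd hu
  exact ⟨n, z, by push_cast; rw [coe_two]; simp⟩

lemma U_inv {t : ℕ} (ht : 1 ≤ t) {x : ℚ_[2]} (hx : U t x) : U t x⁻¹ := by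
  obtain ⟨e, z, rfl⟩ := hx
  obtain ⟨s, rfl⟩ : ∃ s, t = s + 1 := ⟨t - 1, by omega⟩
  obtain ⟨w, hw⟩ := isUnit_odd (2 ^ s * z)
  have h1 : (1 + 2 * (2 ^ s * z)) * (↑w⁻¹ : ℤ_[2]) = 1 := by rw [← hw]; simp
  have h2 : (1 + 2 * (2 ^ s * (z : ℚ_[2]))) * ((↑w⁻¹ : ℤ_[2]) : ℚ_[2]) = 1 := by
    have := congrArg (fun x : ℤ_[2] => (x : ℚ_[2])) h1
    simpa [coe_two] using this
  refine ⟨-e, -(z * (↑w⁻¹ : ℤ_[2])), ?_⟩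
  have h3 : (1 + 2 ^ (s + 1) * (z : ℚ_[2])) ≠ 0 := by
    intro h
    have h' : 1 + 2 * (2 ^ s * (z : ℚ_[2])) = 0 := by rw [← h]; ring
    rw [h', zero_mul] at h2
    exact zero_ne_one h2
  rw [mul_inv, zpow_neg]
  congr 1
  apply inv_eq_of_mul_eq_one_right
  push_cast
  linear_combination (-(2 ^ (s + 1) * (z : ℚ_[2]))) * h2

lemma U_one {y : ℚ_[2]} (hy : y ≠ 0) : U 1 y := by
  obtain ⟨a, b, hb, rfl⟩ := IsFractionRing.div_surjective (A := ℤ_[2]) y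
  have ha : a ≠ 0 := by rintro rfl; simp at hy
  rw [div_eq_mul_inv]
  exact U_mul (U_coe ha) (U_inv le_rfl (U_coe (nonZeroDivisors.ne_zero hb)))

lemma U_pow (j : ℕ) {y : ℚ_[2]} (hy : y ≠ 0) : U (j + 1) (y ^ 2 ^ j) := by
  induction j with
  | zero => simpa using U_one hy
  | succ j ih => rw [pow_succ 2, pow_mul]; exact U_sq (by omega) ih

lemma iter_eval_odd (i : ℕ) {f : ℤ_[2][X]} (h : ¬ (2 : ℤ_[2]) ∣ f.eval 1) : ¬ (2 : ℤ_[2]) ∣ (gG^[i] f).eval 1 := by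
  induction i with
  | zero => exact h
  | succ i ih =>
    intro h2
    have h3 := eval_dvd (iter_congr i f) 1
    rw [eval_sub] at h3
    have h4 : (2 : ℤ_[2]) ∣ 2 ^ (i + 1) := dvd_pow_self 2 (by omega)
    exact ih ((dvd_sub_right h2).1 (h4.trans h3))

lemma nr_odd (j : ℕ) {f : ℤ_[2][X]} (h : ¬ (2 : ℤ_[2]) ∣ f.eval 1) : ∃ z, nr j f = 1 + 2 ^ (j + 1) * z := by
  have h1 := eval_dvd (iter_congr j f) 1
  have h2 : (gG^[j + 1] f).eval 1 = (gG^[j] f).eval 1 * nr j f := by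
    rw [Function.iterate_succ_apply']
    have := eval_gG (gG^[j] f) 1
    rwa [one_pow] at this
  rw [eval_sub, h2] at h1
  have h3 := isUnit_of_not (iter_eval_odd j h)
  have h4 : (2 : ℤ_[2]) ^ (j + 1) ∣ (gG^[j] f).eval 1 * (nr j f - 1) := by rw [mul_sub, mul_one]; exact h1
  rw [h3.dvd_mul_left] at h4
  obtain ⟨z, hz⟩ := h4
  exact ⟨z, by linear_combination hz⟩

lemma split_even (j : ℕ) {f : ℤ_[2][X]} (h : (2 : ℤ_[2]) ∣ f.eval 1) : ∃ h : ℤ_[2][X], nr j f = 2 * nr j h := by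
  obtain ⟨a, ha⟩ := h
  have h1 : (X - C 1) ∣ f - C (2 * a) := by rw [dvd_iff_isRoot]; simp [ha]
  obtain ⟨f1, hf1⟩ := h1
  have hg := mul_neg_geom_sum (X : ℤ_[2][X]) (2 ^ j)
  refine ⟨C a * (∑ i ∈ Finset.range (2 ^ j), X ^ i) - f1, ?_⟩
  rw [← nr_one_sub (R := ℤ_[2]) j, ← nr_mul]
  apply nr_wd
  refine ⟨C a, ?_⟩
  rw [C_mul, C_1, C_ofNat] at hf1
  linear_combination hf1 - C a * hg

lemma nr_Zp (j n : ℕ) : ∀ (f : ℤ_[2][X]) (u : ℤ_[2]), nr j f = 2 ^ n * u → ¬ (2 : ℤ_[2]) ∣ u →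
    ∃ z, u = 1 + 2 ^ (j + 1) * z := by
  induction n with
  | zero =>
    intro f u h hu
    rw [pow_zero, one_mul] at h
    by_cases h1 : (2 : ℤ_[2]) ∣ f.eval 1
    · exfalso
      obtain ⟨h', hh'⟩ := split_even j h1
      rw [hh'] at h
      exact hu ⟨_, h.symm⟩
    · rw [← h]
      exact nr_odd j h1
  | succ n ih =>
    intro f u h hu
    by_cases h1 : (2 : ℤ_[2]) ∣ f.eval 1
    · obtain ⟨h', hh'⟩ := split_even j h1
      rw [hh'] at h
      refine ih h' u ?_ hu
      apply mul_left_cancel₀ (two_ne_zero (α := ℤ_[2]))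
      rw [h]; ring
    · exfalso
      obtain ⟨z, hz⟩ := nr_odd j h1
      rw [h] at hz
      apply not_two_dvd_one
      exact ⟨2 ^ n * u - 2 ^ j * z, by linear_combination -hz⟩

/-- main 2-adic statement -/
theorem nr_U (j : ℕ) (f : ℚ_[2][X]) (h : nr j f ≠ 0) : U (j + 1) (nr j f) := by
  obtain ⟨b, hb, hf⟩ := IsLocalization.integerNormalization_spec (nonZeroDivisors ℤ_[2]) f
  set f' := IsLocalization.integerNormalization (nonZeroDivisors ℤ_[2]) f
  have hb0 : (b : ℚ_[2]) ≠ 0 := by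
    have := nonZeroDivisors.ne_zero hb
    rwa [Ne, PadicInt.coe_eq_zero]
  have h1 : (b : ℚ_[2]) ^ 2 ^ j * nr j f = ((nr j f' : ℤ_[2]) : ℚ_[2]) := by
    rw [← nr_C, ← nr_mul]
    have h2 : (C (b : ℚ_[2])) * f = f'.map (algebraMap ℤ_[2] ℚ_[2]) := by
      rw [hf, ← smul_eq_C_mul]; rfl
    rw [h2, nr_map]; rfl
  have h0 : nr j f' ≠ 0 := by
    intro h0
    rw [h0] at h1
    have : (b : ℚ_[2]) ^ 2 ^ j * nr j f ≠ 0 := mul_ne_zero (pow_ne_zero _ hb0) h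
    exact this (by rw [h1]; simp)
  obtain ⟨n, u, hu, hu2⟩ := fin_mult h0
  obtain ⟨z, hz⟩ := nr_Zp j n f' u hu hu2
  have h3 : U (j + 1) ((nr j f' : ℤ_[2]) : ℚ_[2]) := ⟨n, z, by rw [hu, hz]; push_cast; rw [coe_two]; simp⟩
  have h4 : nr j f = ((nr j f' : ℤ_[2]) : ℚ_[2]) * ((b : ℚ_[2]) ^ 2 ^ j)⁻¹ := by
    rw [← h1]; field_simp
  rw [h4]
  exact U_mul h3 (U_inv (by omega) (U_pow j hb0))

end TwoG

end SecNormPoly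

section SecSquareExt

set_option linter.unusedSectionVars false

/-- every ideal with principal nonzero square is principal -/
def SqPrin (R : Type*) [CommRing R] : Prop :=
  ∀ I : Ideal R, ∀ x : R, x ≠ 0 → I * I = Ideal.span {x} → ∃ y, I = Ideal.span {y}

/-- data for the quadratic extension `R' = R ⊕ R s` -/
structure QExt (R R' : Type*) [CommRing R] [CommRing R'] where
  ι : R →+* R'
  inj : Function.Injective ι
  s : R'
  u : Rˣ
  hs : s ^ 2 = ι u
  h2 : IsUnit (2 : R)
  σ : R' →+* R'
  hσ : ∀ a, σ (ι a) = ι a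
  hσs : σ s = -s
  dec : ∀ x, ∃ a b, x = ι a + ι b * s

namespace QExt

variable {R R' : Type*} [CommRing R] [CommRing R'] [IsDomain R] [IsDomain R'] (E : QExt R R')

lemma sigsig (x : R') : E.σ (E.σ x) = x := by
  obtain ⟨a, b, rfl⟩ := E.dec x
  simp [E.hσ, E.hσs]

lemma sig_inj : Function.Injective E.σ := fun x y h => by rw [← E.sigsig x, h, E.sigsig]

lemma sig_ne {x : R'} (hx : x ≠ 0) : E.σ x ≠ 0 := fun h => hx (E.sig_inj (by rw [h, map_zero]))

lemma s_unit : IsUnit E.s := by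
  have : IsUnit (E.s ^ 2) := by rw [E.hs]; exact E.u.isUnit.map E.ι
  exact (isUnit_pow_iff two_ne_zero).1 this

lemma s_ne : E.s ≠ 0 := E.s_unit.ne_zero

lemma two_unit (E : QExt R R') : IsUnit (2 : R') := by
  have := E.h2.map E.ι
  rwa [map_ofNat] at this

lemma two_ne (E : QExt R R') : (2 : R') ≠ 0 := E.two_unit.ne_zero

lemma dec_zero {a b : R} (h : E.ι a + E.ι b * E.s = 0) : a = 0 ∧ b = 0 := by
  have h1 := congrArg E.σ h
  simp only [map_add, map_mul, E.hσ, E.hσs, map_zero] at h1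
  have ha : E.ι a = 0 := by
    have : 2 * E.ι a = 0 := by linear_combination h + h1
    exact (mul_eq_zero.1 this).resolve_left E.two_ne
  have hb : E.ι b = 0 := by
    rw [ha, zero_add] at h
    exact (mul_eq_zero.1 h).resolve_right E.s_ne
  exact ⟨E.inj (by rw [ha, map_zero]), E.inj (by rw [hb, map_zero])⟩

lemma dec_unique {a b c d : R} (h : E.ι a + E.ι b * E.s = E.ι c + E.ι d * E.s) : a = c ∧ b = d := by
  have := E.dec_zero (a := a - c) (b := b - d) (by rw [map_sub, map_sub]; linear_combination h)
  exact ⟨sub_eq_zero.1 this.1, sub_eq_zero.1 this.2⟩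

lemma fixed {x : R'} (h : E.σ x = x) : ∃ a, x = E.ι a := by
  obtain ⟨a, b, rfl⟩ := E.dec x
  simp only [map_add, map_mul, E.hσ, E.hσs] at h
  have h1 : E.ι b * E.s = 0 := by
    have : 2 * (E.ι b * E.s) = 0 := by linear_combination -h
    exact (mul_eq_zero.1 this).resolve_left E.two_ne
  exact ⟨a, by rw [h1, add_zero]⟩

lemma nm_ex (x : R') : ∃ a, E.ι a = x * E.σ x := by
  obtain ⟨a, h⟩ := E.fixed (x := x * E.σ x) (by rw [map_mul, E.sigsig, mul_comm])
  exact ⟨a, h.symm⟩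

/-- the norm -/
noncomputable def nm (x : R') : R := (E.nm_ex x).choose

lemma nm_spec (x : R') : E.ι (E.nm x) = x * E.σ x := (E.nm_ex x).choose_spec

/-- norm as a monoid hom -/
noncomputable def nmHom : R' →* R where
  toFun := E.nm
  map_one' := E.inj (by rw [nm_spec, map_one, map_one, one_mul])
  map_mul' x y := E.inj (by rw [nm_spec, map_mul, map_mul, nm_spec, nm_spec]; ring)

lemma nm_ne {x : R'} (hx : x ≠ 0) : E.nm x ≠ 0 := by
  intro h
  have := E.nm_spec x
  rw [h, map_zero] at this
  exact mul_ne_zero hx (E.sig_ne hx) this.symm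

lemma inv_ideal {I : Ideal R'} (h : ∀ x ∈ I, E.σ x ∈ I) : I = (I.comap E.ι).map E.ι := by
  apply le_antisymm _ Ideal.map_comap_le
  intro x hx
  have h1 := h x hx
  obtain ⟨a, b, rfl⟩ := E.dec x
  simp only [map_add, map_mul, E.hσ, E.hσs] at h1
  obtain ⟨t, ht⟩ := E.two_unit
  obtain ⟨v, hv⟩ := E.s_unit
  have h3 : (2 : R') * ↑t⁻¹ = 1 := by rw [← ht]; simp
  have h4 : E.s * ↑v⁻¹ = 1 := by rw [← hv]; simp
  have ha : E.ι a ∈ I := by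
    have h2 : (↑t⁻¹ : R') * ((E.ι a + E.ι b * E.s) + (E.ι a + E.ι b * -E.s)) ∈ I :=
      Ideal.mul_mem_left _ _ (Ideal.add_mem _ hx h1)
    have : E.ι a = (↑t⁻¹ : R') * ((E.ι a + E.ι b * E.s) + (E.ι a + E.ι b * -E.s)) := by
      linear_combination (-E.ι a) * h3
    rwa [this]
  have hb : E.ι b ∈ I := by
    have h2 : (↑v⁻¹ : R') * ((E.ι a + E.ι b * E.s) - E.ι a) ∈ I :=
      Ideal.mul_mem_left _ _ (Ideal.sub_mem _ hx ha)
    have : E.ι b = (↑v⁻¹ : R') * ((E.ι a + E.ι b * E.s) - E.ι a) := by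
      linear_combination (-E.ι b) * h4
    rwa [this]
  exact Ideal.add_mem _ (Ideal.mem_map_of_mem _ ha) (Ideal.mul_mem_right _ _ (Ideal.mem_map_of_mem _ hb))

lemma mem_map {J : Ideal R} {x : R'} (hx : x ∈ J.map E.ι) : ∃ a ∈ J, ∃ b ∈ J, x = E.ι a + E.ι b * E.s := by
  induction hx using Submodule.span_induction with
  | mem x hx =>
    obtain ⟨a, ha, rfl⟩ := hx
    exact ⟨a, ha, 0, J.zero_mem, by simp⟩
  | zero => exact ⟨0, J.zero_mem, 0, J.zero_mem, by simp⟩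
  | add x y _ _ hx hy =>
    obtain ⟨a, ha, b, hb, rfl⟩ := hx
    obtain ⟨c, hc, d, hd, rfl⟩ := hy
    exact ⟨a + c, J.add_mem ha hc, b + d, J.add_mem hb hd, by simp only [map_add]; ring⟩
  | smul r x _ hx =>
    obtain ⟨a, ha, b, hb, rfl⟩ := hx
    obtain ⟨c, d, rfl⟩ := E.dec r
    refine ⟨c * a + d * b * E.u, J.add_mem (J.mul_mem_left _ ha) (J.mul_mem_right _ (J.mul_mem_left _ hb)),
      c * b + d * a, J.add_mem (J.mul_mem_left _ hb) (J.mul_mem_left _ ha), ?_⟩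
    simp only [map_add, map_mul, ← E.hs, smul_eq_mul]
    ring

lemma comap_map (J : Ideal R) : (J.map E.ι).comap E.ι = J := by
  apply le_antisymm _ Ideal.le_comap_map
  intro x hx
  obtain ⟨a, ha, b, hb, h⟩ := E.mem_map hx
  have := E.dec_unique (a := x) (b := 0) (c := a) (d := b) (by rw [← h]; simp)
  rwa [this.1]

lemma map_inj {J J' : Ideal R} (h : J.map E.ι = J'.map E.ι) : J = J' := by
  rw [← E.comap_map J, h, E.comap_map]

/-- an invariant ideal whose square is generated by an element of `R` is generated by an element of `R` -/
lemma inv_prin (hP : SqPrin R) {I : Ideal R'} (h : ∀ x ∈ I, E.σ x ∈ I) {r : R} (hr : r ≠ 0)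
    (hI : I * I = Ideal.span {E.ι r}) : ∃ b, I = Ideal.span {E.ι b} := by
  have h1 := E.inv_ideal h
  set J := I.comap E.ι
  have h2 : J * J = Ideal.span {r} := by
    apply E.map_inj
    rw [Ideal.map_mul, ← h1, hI, Ideal.map_span, Set.image_singleton]
  obtain ⟨b, hb⟩ := hP J r hr h2
  exact ⟨b, by rw [h1, hb, Ideal.map_span, Set.image_singleton]⟩

lemma h90 {x y : R'} (hy : y ≠ 0) (h : x * E.σ x = y * E.σ y) : ∃ w, w ≠ 0 ∧ x * E.σ w = y * w := by
  by_cases h0 : x + y = 0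
  · refine ⟨E.s, E.s_ne, ?_⟩
    rw [E.hσs]
    linear_combination (-E.s) * h0
  · refine ⟨E.σ y * (x + y), mul_ne_zero (E.sig_ne hy) h0, ?_⟩
    rw [map_mul, E.sigsig, map_add]
    linear_combination y * h

lemma hm1 (hP : SqPrin R) (v : R'ˣ) (h : (v : R') * E.σ v = 1) : ∃ y : R'ˣ, (v : R') * E.σ y = y := by
  obtain ⟨w, hw, hw2⟩ := E.h90 (x := v) (y := 1) one_ne_zero (by rw [h, map_one, one_mul])
  rw [one_mul] at hw2
  have hσw : Associated w (E.σ w) := Associated.symm ⟨v, by rw [mul_comm, hw2]⟩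
  obtain ⟨b, hb⟩ := E.inv_prin hP (I := Ideal.span {w}) (r := E.nm w) (by
    intro x hx
    rw [Ideal.mem_span_singleton] at hx ⊢
    exact hσw.dvd.trans (map_dvd E.σ hx)) (E.nm_ne hw) (by
    rw [Ideal.span_singleton_mul_span_singleton, E.nm_spec, Ideal.span_singleton_eq_span_singleton]
    exact Associated.mul_left _ hσw)
  rw [Ideal.span_singleton_eq_span_singleton] at hb
  obtain ⟨y, hy⟩ := hb.symm
  refine ⟨y, ?_⟩
  have hb0 : E.ι b ≠ 0 := by intro h0; rw [h0, zero_mul] at hy; exact hw hy.symm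
  apply mul_left_cancel₀ hb0
  have := hw2
  rw [← hy, map_mul, E.hσ] at this
  linear_combination this

/-- norm on units -/
noncomputable def nmU : R'ˣ →* Rˣ := Units.map E.nmHom

lemma nmU_spec (v : R'ˣ) : E.ι (E.nmU v : R) = v * E.σ v := E.nm_spec v

/-- conjugation on units -/
def sigU : R'ˣ →* R'ˣ := Units.map (E.σ : R' →* R')

lemma sigU_spec (v : R'ˣ) : (E.sigU v : R') = E.σ v := rfl

/-- inclusion on units -/
def inclU : Rˣ →* R'ˣ := Units.map (E.ι : R →* R')

lemma inclU_spec (v : Rˣ) : (E.inclU v : R') = E.ι v := rfl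

lemma nmU_inclU (v : Rˣ) : E.nmU (E.inclU v) = v ^ 2 := by
  ext; apply E.inj
  rw [nmU_spec, inclU_spec, E.hσ]; push_cast; rw [map_pow, sq]

lemma mem_ker {v : R'ˣ} : v ∈ E.nmU.ker ↔ v * E.sigU v = 1 := by
  rw [MonoidHom.mem_ker, Units.ext_iff, Units.ext_iff, ← E.inj.eq_iff, nmU_spec]; simp [sigU_spec]

/-- squares -/
def sqH (G : Type*) [CommGroup G] : Subgroup G := (powMonoidHom 2 : G →* G).range

lemma mem_sqH {G : Type*} [CommGroup G] {x : G} : x ∈ sqH G ↔ ∃ y, y ^ 2 = x := Iff.rfl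

lemma index_eq (hP : SqPrin R) :
    (sqH Rˣ).relIndex E.nmU.range = (sqH E.nmU.ker).index := by
  have h1 : (sqH Rˣ).relIndex E.nmU.range = ((sqH Rˣ).comap E.nmU).index := (Subgroup.index_comap _ _).symm
  let f : R'ˣ →* E.nmU.ker :=
    { toFun := fun y => ⟨y * (E.sigU y)⁻¹, by
        rw [mem_ker]
        have : E.sigU (E.sigU y) = y := by ext; exact E.sigsig _
        rw [map_mul, map_inv, this]; group⟩
      map_one' := by ext; simp
      map_mul' := fun x y => by
        apply Subtype.ext
        change x * y * (E.sigU (x * y))⁻¹ = x * (E.sigU x)⁻¹ * (y * (E.sigU y)⁻¹)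
        rw [map_mul, mul_inv]; exact mul_mul_mul_comm _ _ _ _ }
  have hf : Function.Surjective f := by
    rintro ⟨v, hv⟩
    rw [mem_ker] at hv
    obtain ⟨y, hy⟩ := E.hm1 hP v (congrArg Units.val hv)
    refine ⟨y, Subtype.ext ?_⟩
    change y * (E.sigU y)⁻¹ = v
    rw [mul_inv_eq_iff_eq_mul]
    ext; exact hy.symm
  rw [h1, ← Subgroup.index_comap_of_surjective _ hf]
  congr 1
  ext y
  rw [Subgroup.mem_comap, Subgroup.mem_comap, mem_sqH, mem_sqH]
  constructor
  · rintro ⟨r, hr⟩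
    have hk : y * (E.inclU r)⁻¹ ∈ E.nmU.ker := by
      rw [MonoidHom.mem_ker, map_mul, map_inv, nmU_inclU, hr, mul_inv_cancel]
    refine ⟨⟨_, hk⟩, Subtype.ext ?_⟩
    change (y * (E.inclU r)⁻¹) ^ 2 = y * (E.sigU y)⁻¹
    rw [mem_ker, map_mul, map_inv] at hk
    have h3 : E.sigU (E.inclU r) = E.inclU r := by ext; exact E.hσ _
    rw [h3] at hk
    rw [sq]
    nth_rewrite 2 [eq_inv_of_mul_eq_one_left hk]
    rw [mul_inv, inv_inv, mul_mul_mul_comm, inv_mul_cancel, mul_one]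
  · rintro ⟨⟨v, hv⟩, h⟩
    have h' : v ^ 2 = y * (E.sigU y)⁻¹ := congrArg Subtype.val h
    rw [mem_ker] at hv
    have h3 : E.σ ((y * v⁻¹ : R'ˣ) : R') = ((y * v⁻¹ : R'ˣ) : R') := by
      change ((E.sigU (y * v⁻¹) : R'ˣ) : R') = _
      congr 1
      rw [map_mul, map_inv, eq_inv_of_mul_eq_one_right hv, inv_inv]
      have : y = v ^ 2 * E.sigU y := by rw [h', inv_mul_cancel_right]
      conv_rhs => rw [this]
      rw [eq_mul_inv_iff_mul_eq, sq, mul_assoc, mul_comm]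
    have h4 : E.σ ((v * y⁻¹ : R'ˣ) : R') = ((v * y⁻¹ : R'ˣ) : R') := by
      have h5 : E.sigU (y * v⁻¹) = y * v⁻¹ := by ext; exact h3
      have h6 := congrArg (·⁻¹) h5
      simp only [← map_inv, mul_inv_rev, inv_inv] at h6
      exact congrArg Units.val h6
    obtain ⟨a, ha⟩ := E.fixed h3
    obtain ⟨b, hb⟩ := E.fixed h4
    have hab : a * b = 1 := E.inj (by rw [map_mul, ← ha, ← hb, ← Units.val_mul, map_one]; simp)
    refine ⟨⟨a, b, hab, by rw [mul_comm, hab]⟩, ?_⟩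
    have hy : y = E.inclU ⟨a, b, hab, by rw [mul_comm, hab]⟩ * v := by
      ext; rw [Units.val_mul, inclU_spec]; change _ = E.ι a * _; rw [← ha]; simp
    rw [hy, map_mul, nmU_inclU, (MonoidHom.mem_ker).1 ((E.mem_ker).2 hv), mul_one]

/-- the group of units that are norms up to squares -/
def QQ : Subgroup Rˣ where
  carrier := {t | ∃ c : R, c ≠ 0 ∧ ∃ x : R', E.ι (t * c ^ 2) = x * E.σ x}
  one_mem' := ⟨1, one_ne_zero, 1, by simp⟩
  mul_mem' := by
    rintro t t' ⟨c, hc, x, hx⟩ ⟨c', hc', x', hx'⟩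
    refine ⟨c * c', mul_ne_zero hc hc', x * x', ?_⟩
    have : ((t * t' : Rˣ) : R) * (c * c') ^ 2 = (t * c ^ 2) * (t' * c' ^ 2) := by push_cast; ring
    rw [this, map_mul E.ι, hx, hx', map_mul]; ring
  inv_mem' := by
    rintro t ⟨c, hc, x, hx⟩
    refine ⟨t * c, mul_ne_zero t.ne_zero hc, x, ?_⟩
    rw [← hx]
    congr 1
    have : (↑t⁻¹ : R) * t = 1 := by simp
    linear_combination ((t : R) * c ^ 2) * this

theorem step (hP : SqPrin R) (N : ℕ) (hU0 : (sqH Rˣ).index ≠ 0) (hU : (sqH Rˣ).index ≤ 2 ^ (N + 2))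
    (hL : 2 ^ (N + 1) ≤ (sqH E.nmU.ker).index)
    (s0 : Rˣ) (hs0 : ∀ (x : R') (c : R), c ≠ 0 → E.ι (s0 * c ^ 2) ≠ x * E.σ x) : SqPrin R' := by
  have hsq : sqH Rˣ ≤ E.nmU.range := by
    rintro _ ⟨r, rfl⟩
    exact ⟨E.inclU r, E.nmU_inclU r⟩
  have hidx := Subgroup.relIndex_mul_index hsq
  rw [E.index_eq hP] at hidx
  have hNM : E.nmU.range.index ≤ 2 := by
    by_contra hcon
    have h1 : 2 ^ (N + 1) * 3 ≤ 2 ^ (N + 2) := by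
      calc 2 ^ (N + 1) * 3 ≤ (sqH E.nmU.ker).index * E.nmU.range.index := Nat.mul_le_mul hL (by omega)
        _ ≤ _ := by rw [hidx]; exact hU
    have : 0 < 2 ^ (N + 1) := by positivity
    rw [pow_succ 2 (N + 1)] at h1
    omega
  have hNM0 : E.nmU.range.index ≠ 0 := by
    intro h; rw [h, mul_zero] at hidx; exact hU0 hidx.symm
  have hQ : E.nmU.range ≤ E.QQ := by
    rintro _ ⟨v, rfl⟩
    exact ⟨1, one_ne_zero, v, by rw [one_pow, mul_one, nmU_spec]⟩
  have hQ2 : E.QQ ≤ E.nmU.range := by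
    rw [← Subgroup.relIndex_eq_one]
    have h1 := Subgroup.relIndex_mul_index hQ
    have h2 : E.QQ.index ≠ 1 := by
      intro h
      rw [Subgroup.index_eq_one] at h
      have : s0 ∈ E.QQ := by rw [h]; trivial
      obtain ⟨c, hc, x, hx⟩ := this
      exact hs0 x c hc hx
    have h3 : E.nmU.range.relIndex E.QQ ≠ 0 := by intro h; rw [h, zero_mul] at h1; exact hNM0 h1.symm
    have h4 : E.QQ.index ≠ 0 := by intro h; rw [h, mul_zero] at h1; exact hNM0 h1.symm
    by_contra h5
    have : 2 * 2 ≤ E.nmU.range.relIndex E.QQ * E.QQ.index := Nat.mul_le_mul (by omega) (by omega)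
    omega
  intro I x hx hI
  have hcjcj : (I.map E.σ).map E.σ = I := by
    rw [Ideal.map_map]
    have : E.σ.comp E.σ = RingHom.id R' := RingHom.ext E.sigsig
    rw [this, Ideal.map_id]
  have hσI : I.map E.σ * I.map E.σ = Ideal.span {E.σ x} := by
    rw [← Ideal.map_mul, hI, Ideal.map_span, Set.image_singleton]
  obtain ⟨b, hb⟩ := E.inv_prin hP (I := I * I.map E.σ) (r := E.nm x) (by
    intro y hy
    have := Ideal.mem_map_of_mem E.σ hy
    rwa [Ideal.map_mul, hcjcj, mul_comm] at this) (E.nm_ne hx) (by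
    rw [mul_mul_mul_comm, hI, hσI, Ideal.span_singleton_mul_span_singleton, E.nm_spec])
  have hbb : Ideal.span {b ^ 2} = Ideal.span {E.nm x} := by
    apply E.map_inj
    rw [Ideal.map_span, Ideal.map_span, Set.image_singleton, Set.image_singleton, map_pow,
      ← Ideal.span_singleton_pow, ← hb, sq, mul_mul_mul_comm, hI, hσI, Ideal.span_singleton_mul_span_singleton, E.nm_spec]
  rw [Ideal.span_singleton_eq_span_singleton] at hbb
  obtain ⟨t, ht⟩ := hbb
  have hb0 : b ≠ 0 := by
    rintro rfl
    apply E.nm_ne hx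
    rw [← ht]; ring
  have hbι : E.ι b ≠ 0 := fun h => hb0 (E.inj (by rw [h, map_zero]))
  have htQ : t ∈ E.QQ := ⟨b, hb0, x, by rw [mul_comm, ht, nm_spec]⟩
  obtain ⟨m', hm'⟩ := hQ2 htQ
  have hm2 : E.ι t = m' * E.σ m' := by rw [← hm', nmU_spec]
  obtain ⟨w, hw, hxw⟩ := E.h90 (x := x) (y := E.ι b * m') (mul_ne_zero hbι m'.ne_zero) (by
    rw [← E.nm_spec, ← ht, map_mul E.ι, map_pow, hm2, map_mul E.σ, E.hσ]; ring)
  have hσw := E.sig_ne hw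
  have hkey : Ideal.span {E.σ w} * I * I = Ideal.span {E.ι b * w} := by
    rw [mul_assoc, hI, Ideal.span_singleton_mul_span_singleton, Ideal.span_singleton_eq_span_singleton]
    refine Associated.symm ⟨m', ?_⟩
    linear_combination -hxw
  have hinv : Ideal.span {w} * I.map E.σ = Ideal.span {E.σ w} * I := by
    have h1 : Ideal.span {w} * I.map E.σ * I = Ideal.span {E.σ w} * I * I := by
      rw [hkey, mul_assoc, mul_comm (I.map E.σ), hb, Ideal.span_singleton_mul_span_singleton, mul_comm]
    have h2 := congrArg (· * I) h1
    rw [mul_assoc _ I I, mul_assoc _ I I, hI] at h2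
    exact (Ideal.span_singleton_mul_left_inj hx).1 h2
  obtain ⟨c, hc⟩ := E.inv_prin hP (I := Ideal.span {E.σ w} * I) (r := b * E.nm w) (by
    intro y hy
    have := Ideal.mem_map_of_mem E.σ hy
    rwa [Ideal.map_mul, Ideal.map_span, Set.image_singleton, E.sigsig, hinv] at this) (mul_ne_zero hb0 (E.nm_ne hw)) (by
    rw [← mul_assoc, mul_comm _ (Ideal.span {E.σ w}), mul_assoc, hkey, Ideal.span_singleton_mul_span_singleton,
      map_mul, E.nm_spec]
    congr 2; ring)
  have hmem : E.ι c ∈ Ideal.span {E.σ w} * I := by rw [hc]; exact Ideal.mem_span_singleton_self _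
  obtain ⟨y, hy, hyc⟩ := Ideal.mem_span_singleton_mul.1 hmem
  refine ⟨y, ?_⟩
  rw [← hyc, ← Ideal.span_singleton_mul_span_singleton] at hc
  exact (Ideal.span_singleton_mul_right_inj hσw).1 hc

end QExt

end SecSquareExt

section SecTower

open Polynomial IntermediateField

namespace TwoG

/-- the root of unity `exp (π i / 2^j)` -/
noncomputable def zt (j : ℕ) : ℂ := Complex.exp (Real.pi * Complex.I / 2 ^ j)

lemma zt_zero : zt 0 = -1 := by rw [zt, pow_zero, div_one, Complex.exp_pi_mul_I]

lemma zt_sq (j : ℕ) : zt (j + 1) ^ 2 = zt j := by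
  rw [zt, zt, ← Complex.exp_nat_mul]
  congr 1
  rw [pow_succ]; push_cast; field_simp

lemma zt_pow (j : ℕ) : zt j ^ 2 ^ j = -1 := by
  induction j with
  | zero => rw [zt_zero]; simp
  | succ j ih => rw [pow_succ', pow_mul, zt_sq, ih]

lemma zt_ne (j : ℕ) : zt j ≠ 0 := Complex.exp_ne_zero _

lemma phi_irr (j : ℕ) : Irreducible (X ^ 2 ^ j + 1 : ℚ_[2][X]) := by
  have hm : (X ^ 2 ^ j + 1 : ℤ_[2][X]).Monic := by
    have := monic_X_pow_add_C (1 : ℤ_[2]) (n := 2 ^ j) (by positivity)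
    rwa [C_1] at this
  have hc : cyclotomic (2 ^ (j + 1)) ℤ = X ^ 2 ^ j + 1 := by
    rw [cyclotomic_prime_pow_eq_geom_sum Nat.prime_two]
    simp [Finset.sum_range_succ, add_comm]
  have hE := cyclotomic_prime_pow_comp_X_add_one_isEisensteinAt 2 j
  rw [hc] at hE
  have hE2 : ((X ^ 2 ^ j + 1 : ℤ_[2][X]).comp (X + C 1)).IsEisensteinAt (Ideal.span {(2 : ℤ_[2])}) := by
    have hmap : ((X ^ 2 ^ j + 1 : ℤ_[2][X]).comp (X + C 1)) = ((X ^ 2 ^ j + 1 : ℤ[X]).comp (X + 1)).map (Int.castRingHom ℤ_[2]) := by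
      simp
    have hdeg : ((X ^ 2 ^ j + 1 : ℤ_[2][X]).comp (X + C 1)).natDegree = ((X ^ 2 ^ j + 1 : ℤ[X]).comp (X + 1)).natDegree := by
      rw [hmap, natDegree_map_eq_of_injective]
      exact RingHom.injective_int _
    have hco : ∀ n, ((X ^ 2 ^ j + 1 : ℤ_[2][X]).comp (X + C 1)).coeff n = ((((X ^ 2 ^ j + 1 : ℤ[X]).comp (X + 1)).coeff n : ℤ) : ℤ_[2]) := by
      intro n
      rw [hmap, coeff_map]; rfl
    refine (hm.comp (monic_X_add_C 1) ?_).isEisensteinAt_of_mem_of_notMem ?_ ?_ ?_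
    · rw [natDegree_X_add_C]; exact one_ne_zero
    · intro h
      have : (2 : ℤ_[2]) ∣ 1 := by rw [← Ideal.mem_span_singleton, h]; trivial
      exact not_two_dvd_one this
    · intro n hn
      rw [hdeg] at hn
      have := hE.mem hn
      rw [hco, Ideal.mem_span_singleton]
      rw [Submodule.mem_span_singleton] at this
      obtain ⟨c, hc⟩ := this
      rw [← hc]
      exact ⟨c, by push_cast [smul_eq_mul]; ring⟩
    · have : ((X ^ 2 ^ j + 1 : ℤ_[2][X]).comp (X + C 1)).coeff 0 = 2 := by
        rw [coeff_zero_eq_eval_zero, eval_comp]; simp; norm_num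
      rw [this, Ideal.span_singleton_pow, Ideal.mem_span_singleton]
      rintro ⟨c, hc⟩
      apply not_two_dvd_one
      exact ⟨c, mul_left_cancel₀ (two_ne_zero (α := ℤ_[2])) (by linear_combination hc)⟩
  have hirr : Irreducible ((X ^ 2 ^ j + 1 : ℤ_[2][X]).comp (X + C 1)) := by
    apply hE2.irreducible
    · rw [Ideal.span_singleton_prime two_ne_zero]
      have := PadicInt.prime_p (p := 2)
      simpa using this
    · exact (hm.comp (monic_X_add_C 1) (by rw [natDegree_X_add_C]; exact one_ne_zero)).isPrimitive
    · rw [natDegree_comp, natDegree_X_add_C, mul_one]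
      have : (X ^ 2 ^ j + 1 : ℤ_[2][X]).natDegree = 2 ^ j := by
        rw [← C_1]; exact natDegree_X_pow_add_C
      rw [this]; positivity
  have hirr2 : Irreducible (X ^ 2 ^ j + 1 : ℤ_[2][X]) := by
    have : (algEquivAevalXAddC (1 : ℤ_[2])) (X ^ 2 ^ j + 1) = (X ^ 2 ^ j + 1 : ℤ_[2][X]).comp (X + C 1) := by
      simp
    rw [← this] at hirr
    exact (MulEquiv.irreducible_iff (algEquivAevalXAddC (1 : ℤ_[2]))).1 hirr
  have := (hm.irreducible_iff_irreducible_map_fraction_map (K := ℚ_[2])).1 hirr2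
  simpa using this

variable {k : IntermediateField ℚ ℂ}

lemma k_monic (R : Type*) [CommRing R] [Nontrivial R] (j : ℕ) : (X ^ 2 ^ j + 1 : R[X]).Monic := by
  have := monic_X_pow_add_C (1 : R) (n := 2 ^ j) (by positivity)
  rwa [C_1] at this

lemma k_irr (φ : k →+* ℚ_[2]) (j : ℕ) : Irreducible (X ^ 2 ^ j + 1 : k[X]) := by
  apply (k_monic k j).irreducible_of_irreducible_map φ
  have := phi_irr j
  simpa using this

lemma zt_minpoly (φ : k →+* ℚ_[2]) (j : ℕ) : minpoly k (zt j) = X ^ 2 ^ j + 1 := by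
  refine (minpoly.eq_of_irreducible_of_monic (k_irr φ j) ?_ (k_monic k j)).symm
  simp [zt_pow]

lemma zt_integral (j : ℕ) : IsIntegral k (zt j) := ⟨_, k_monic k j, by simp [zt_pow]⟩

lemma zt_integralZ (j : ℕ) : IsIntegral ℤ (zt j) := ⟨_, k_monic ℤ j, by simp [zt_pow]⟩

lemma zt_inv (j : ℕ) : (zt j)⁻¹ = -zt j ^ (2 ^ j - 1) := by
  apply inv_eq_of_mul_eq_one_right
  rw [mul_neg, ← pow_succ', Nat.sub_add_cancel Nat.one_le_two_pow, zt_pow, neg_neg]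

lemma zt_inv_integralZ (j : ℕ) : IsIntegral ℤ (zt j)⁻¹ := by
  rw [zt_inv]; exact ((zt_integralZ j).pow _).neg

variable (k) in
/-- the tower of fields -/
noncomputable def KK (j : ℕ) : IntermediateField ℚ ℂ := (adjoin k {zt j}).restrictScalars ℚ

lemma mem_KK {j : ℕ} {x : ℂ} : x ∈ KK k j ↔ ∃ f : k[X], aeval (zt j) f = x := by
  rw [KK, IntermediateField.mem_restrictScalars, ← IntermediateField.mem_toSubalgebra,
    IntermediateField.adjoin_simple_toSubalgebra_of_isAlgebraic (zt_integral j).isAlgebraic,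
    Algebra.adjoin_singleton_eq_range_aeval]
  rfl

lemma KK_zero : KK k 0 = k := by
  ext x
  rw [mem_KK]
  constructor
  · rintro ⟨f, rfl⟩
    rw [zt_zero]
    have : aeval (-1 : ℂ) f = ((f.eval (-1) : k) : ℂ) := by
      have := aeval_algebraMap_apply_eq_algebraMap_eval (A := ℂ) (-1 : k) f
      simpa using this
    rw [this]; exact Subtype.mem _
  · intro hx
    exact ⟨C ⟨x, hx⟩, by rw [aeval_C]; rfl⟩

lemma aeval_expand_zt (j : ℕ) (f : k[X]) : aeval (zt (j + 1)) (expand k 2 f) = aeval (zt j) f := by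
  rw [expand_aeval, zt_sq]

lemma KK_le (j : ℕ) : KK k j ≤ KK k (j + 1) := by
  intro x hx
  obtain ⟨f, rfl⟩ := mem_KK.1 hx
  exact mem_KK.2 ⟨expand k 2 f, aeval_expand_zt j f⟩

lemma zt_mem (j : ℕ) : zt j ∈ KK k j := mem_KK.2 ⟨X, aeval_X _⟩

lemma aeval_mem (j : ℕ) (f : k[X]) : aeval (zt j) f ∈ KK k j := mem_KK.2 ⟨f, rfl⟩

lemma k_le (j : ℕ) : k ≤ KK k j := fun x hx => mem_KK.2 ⟨C ⟨x, hx⟩, by rw [aeval_C]; rfl⟩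

lemma dvd_of_eq (φ : k →+* ℚ_[2]) {j : ℕ} {f g : k[X]} (h : aeval (zt j) f = aeval (zt j) g) :
    X ^ 2 ^ j + 1 ∣ f - g := by
  rw [← zt_minpoly φ]
  apply minpoly.dvd
  rw [map_sub, h, sub_self]

lemma neg_eq (φ : k →+* ℚ_[2]) {j : ℕ} {f g : k[X]} (h : aeval (zt (j + 1)) f = aeval (zt (j + 1)) g) :
    aeval (-zt (j + 1)) f = aeval (-zt (j + 1)) g := by
  obtain ⟨A, hA⟩ := dvd_of_eq φ h
  rw [← sub_eq_zero, ← map_sub, hA, map_mul]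
  have : aeval (-zt (j + 1)) (X ^ 2 ^ (j + 1) + 1 : k[X]) = 0 := by
    rw [map_add, map_pow, aeval_X, map_one, Even.neg_pow, zt_pow]
    · ring
    · exact ⟨2 ^ j, by ring⟩
  rw [this, zero_mul]

lemma aeval_neg_mem (j : ℕ) (f : k[X]) : aeval (-zt j) f ∈ KK k j :=
  mem_KK.2 ⟨f.comp (-X), by rw [aeval_comp]; simp⟩

/-- representing polynomial -/
noncomputable def rep {j : ℕ} (x : KK k j) : k[X] := (mem_KK.1 x.2).choose

lemma rep_spec {j : ℕ} (x : KK k j) : aeval (zt j) (rep x) = x := (mem_KK.1 x.2).choose_spec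

/-- the conjugation `zt (j+1) ↦ - zt (j+1)` -/
noncomputable def sg (φ : k →+* ℚ_[2]) (j : ℕ) : KK k (j + 1) →+* KK k (j + 1) where
  toFun x := ⟨aeval (-zt (j + 1)) (rep x), aeval_neg_mem _ _⟩
  map_one' := Subtype.ext (by
    change aeval (-zt (j + 1)) (rep 1) = 1
    rw [← map_one (aeval (-zt (j + 1)) : k[X] →ₐ[k] ℂ)]
    apply neg_eq φ
    rw [rep_spec, map_one]; rfl)
  map_zero' := Subtype.ext (by
    change aeval (-zt (j + 1)) (rep 0) = 0
    rw [← map_zero (aeval (-zt (j + 1)) : k[X] →ₐ[k] ℂ)]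
    apply neg_eq φ
    rw [rep_spec, map_zero]; rfl)
  map_mul' x y := Subtype.ext (by
    change aeval (-zt (j + 1)) (rep (x * y)) = aeval (-zt (j + 1)) (rep x) * aeval (-zt (j + 1)) (rep y)
    rw [← map_mul (aeval (-zt (j + 1)) : k[X] →ₐ[k] ℂ)]
    apply neg_eq φ
    rw [rep_spec, map_mul, rep_spec, rep_spec]; rfl)
  map_add' x y := Subtype.ext (by
    change aeval (-zt (j + 1)) (rep (x + y)) = aeval (-zt (j + 1)) (rep x) + aeval (-zt (j + 1)) (rep y)
    rw [← map_add (aeval (-zt (j + 1)) : k[X] →ₐ[k] ℂ)]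
    apply neg_eq φ
    rw [rep_spec, map_add, rep_spec, rep_spec]; rfl)

lemma sg_spec (φ : k →+* ℚ_[2]) (j : ℕ) {x : KK k (j + 1)} {f : k[X]} (h : aeval (zt (j + 1)) f = x) :
    (sg φ j x : ℂ) = aeval (-zt (j + 1)) f := by
  change aeval (-zt (j + 1)) (rep x) = _
  apply neg_eq φ
  rw [rep_spec, h]

lemma sg_fix (φ : k →+* ℚ_[2]) (j : ℕ) {x : KK k (j + 1)} (h : (x : ℂ) ∈ KK k j) : (sg φ j x : ℂ) = x := by
  obtain ⟨f, hf⟩ := mem_KK.1 h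
  rw [sg_spec φ j (f := expand k 2 f) (by rw [aeval_expand_zt, hf]), expand_aeval, neg_sq, zt_sq, hf]

lemma sg_zt (φ : k →+* ℚ_[2]) (j : ℕ) {x : KK k (j + 1)} (h : (x : ℂ) = zt (j + 1)) : (sg φ j x : ℂ) = -zt (j + 1) := by
  rw [sg_spec φ j (f := X) (by rw [aeval_X, h]), aeval_X]

lemma dec_KK {j : ℕ} {x : ℂ} (hx : x ∈ KK k (j + 1)) : ∃ a ∈ KK k j, ∃ b ∈ KK k j, x = a + b * zt (j + 1) := by
  obtain ⟨f, rfl⟩ := mem_KK.1 hx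
  refine ⟨_, aeval_mem j (fe f), _, aeval_mem j (fo f), ?_⟩
  conv_lhs => rw [decomp f]
  rw [map_add, map_mul, aeval_X, aeval_expand_zt, aeval_expand_zt, mul_comm (zt (j + 1))]

/-- the norm to `k` -/
noncomputable def nrm {j : ℕ} (x : KK k j) : k := nr j (rep x)

lemma nrm_spec (φ : k →+* ℚ_[2]) {j : ℕ} {x : KK k j} {f : k[X]} (h : aeval (zt j) f = x) : nrm x = nr j f := by
  apply nr_wd
  apply dvd_of_eq φ
  rw [rep_spec, h]

lemma nrm_mul (φ : k →+* ℚ_[2]) {j : ℕ} (x y : KK k j) : nrm (x * y) = nrm x * nrm y := by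
  rw [nrm_spec φ (f := rep x * rep y) (by rw [map_mul, rep_spec, rep_spec]; rfl), nr_mul]; rfl

lemma nrm_k (φ : k →+* ℚ_[2]) {j : ℕ} {x : KK k j} {a : k} (h : (x : ℂ) = a) : nrm x = a ^ 2 ^ j := by
  rw [nrm_spec φ (f := C a) (by rw [aeval_C, h]; rfl), nr_C]

lemma nrm_one (φ : k →+* ℚ_[2]) {j : ℕ} : nrm (1 : KK k j) = 1 := by
  rw [nrm_k φ (a := 1) rfl, one_pow]

lemma nrm_zero (φ : k →+* ℚ_[2]) {j : ℕ} : nrm (0 : KK k j) = 0 := by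
  rw [nrm_k φ (a := 0) rfl, zero_pow (by positivity)]

/-- norm as monoid hom -/
noncomputable def nrmH (φ : k →+* ℚ_[2]) (j : ℕ) : KK k j →* k where
  toFun := nrm
  map_one' := nrm_one φ
  map_mul' := nrm_mul φ

lemma nrm_pow (φ : k →+* ℚ_[2]) {j : ℕ} (x : KK k j) (n : ℕ) : nrm (x ^ n) = nrm x ^ n := map_pow (nrmH φ j) x n

lemma nrm_ne (φ : k →+* ℚ_[2]) {j : ℕ} {x : KK k j} (hx : x ≠ 0) : nrm x ≠ 0 := by
  intro h
  have := nrm_mul φ x x⁻¹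
  rw [h, zero_mul, mul_inv_cancel₀ hx, nrm_one φ] at this
  exact one_ne_zero this

lemma nrm_up (φ : k →+* ℚ_[2]) {j : ℕ} {x : KK k j} {y : KK k (j + 1)} (h : (x : ℂ) = y) : nrm y = nrm x ^ 2 := by
  rw [nrm_spec φ (x := y) (f := expand k 2 (rep x)) (by rw [aeval_expand_zt, rep_spec, h]), nr_expand]; rfl

lemma nrm_sg (φ : k →+* ℚ_[2]) {j : ℕ} {x : KK k j} {y : KK k (j + 1)} (h : (x : ℂ) = y * sg φ j y) : nrm x = nrm y := by
  rw [nrm_spec φ (x := x) (f := gG (rep y)) (by rw [← zt_sq, aeval_gG, h, rep_spec, sg_spec φ j (rep_spec y)]),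
    ← nr_succ]; rfl

lemma sg_mul_mem (φ : k →+* ℚ_[2]) {j : ℕ} (y : KK k (j + 1)) : (y * sg φ j y : ℂ) ∈ KK k j :=
  mem_KK.2 ⟨gG (rep y), by rw [← zt_sq, aeval_gG, rep_spec, sg_spec φ j (rep_spec y)]⟩

lemma nrm_lam (φ : k →+* ℚ_[2]) {j : ℕ} {x : KK k j} (h : (x : ℂ) = 1 - zt j) : nrm x = 2 := by
  rw [nrm_spec φ (f := 1 - X) (by rw [h]; simp), nr_one_sub]

lemma nrm_U (φ : k →+* ℚ_[2]) {j : ℕ} {x : KK k j} (hx : x ≠ 0) : U (j + 1) (φ (nrm x)) := by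
  have h : φ (nrm x) = nr j ((rep x).map φ) := (nr_map j φ _).symm
  rw [h]
  apply nr_U
  rw [← h]
  exact (map_ne_zero φ).2 (nrm_ne φ hx)

lemma int_coe {F : IntermediateField ℚ ℂ} {x : F} : IsIntegral ℤ x ↔ IsIntegral ℤ (x : ℂ) :=
  (isIntegral_algHom_iff ((F.val).restrictScalars ℤ) Subtype.val_injective).symm

lemma sg_int (φ : k →+* ℚ_[2]) {j : ℕ} {y : KK k (j + 1)} (h : IsIntegral ℤ (y : ℂ)) : IsIntegral ℤ (sg φ j y : ℂ) := by
  rw [← int_coe] at h ⊢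
  exact map_isIntegral_int (sg φ j) h

lemma nrm_int (φ : k →+* ℚ_[2]) : ∀ {j : ℕ} {x : KK k j}, IsIntegral ℤ (x : ℂ) → IsIntegral ℤ (nrm x : ℂ) := by
  intro j
  induction j with
  | zero =>
    intro x h
    have hx : (x : ℂ) ∈ k := (le_of_eq (KK_zero (k := k))) x.2
    rw [nrm_k φ (a := ⟨x, hx⟩) rfl, pow_zero, pow_one]
    exact h
  | succ j ih =>
    intro y h
    rw [← nrm_sg φ (x := ⟨_, sg_mul_mem φ y⟩) rfl]
    exact ih (h.mul (sg_int φ h))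

end TwoG

end SecTower

section SecBaseData

open Polynomial IntermediateField NumberField

namespace TwoG

/-- the ring of `2`-integers -/
def RR (F : IntermediateField ℚ ℂ) : Subring ℂ where
  carrier := {x | x ∈ F ∧ ∃ n : ℕ, IsIntegral ℤ (2 ^ n * x)}
  mul_mem' := by
    rintro x y ⟨hx, n, hn⟩ ⟨hy, m, hm⟩
    refine ⟨mul_mem hx hy, n + m, ?_⟩
    have := hn.mul hm
    have e : (2 : ℂ) ^ (n + m) * (x * y) = 2 ^ n * x * (2 ^ m * y) := by ring
    rwa [e]
  one_mem' := ⟨one_mem _, 0, by simpa using isIntegral_one⟩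
  add_mem' := by
    rintro x y ⟨hx, n, hn⟩ ⟨hy, m, hm⟩
    refine ⟨add_mem hx hy, n + m, ?_⟩
    have h2 : IsIntegral ℤ (2 : ℂ) := by
      have := isIntegral_algebraMap (R := ℤ) (A := ℂ) (x := 2)
      simpa using this
    have := (((h2.pow m).mul hn).add ((h2.pow n).mul hm))
    have e : (2 : ℂ) ^ (n + m) * (x + y) = 2 ^ m * (2 ^ n * x) + 2 ^ n * (2 ^ m * y) := by ring
    rwa [e]
  zero_mem' := ⟨zero_mem _, 0, by simpa using isIntegral_zero⟩
  neg_mem' := by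
    rintro x ⟨hx, n, hn⟩
    exact ⟨neg_mem hx, n, by rw [mul_neg]; exact hn.neg⟩

variable {F : IntermediateField ℚ ℂ}

lemma RR_int {x : ℂ} (hx : x ∈ F) (h : IsIntegral ℤ x) : x ∈ RR F := ⟨hx, 0, by simpa using h⟩

lemma half_mem : (2⁻¹ : ℂ) ∈ RR F :=
  ⟨inv_mem (by have := _root_.natCast_mem F 2; exact_mod_cast this), 1, by
    rw [pow_one, mul_inv_cancel₀ two_ne_zero]; exact isIntegral_one⟩

lemma two_unit_RR : IsUnit (2 : RR F) :=
  IsUnit.of_mul_eq_one (⟨2⁻¹, half_mem⟩ : RR F) (Subtype.ext (by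
    change (2 : ℂ) * 2⁻¹ = 1
    exact mul_inv_cancel₀ two_ne_zero))

lemma RR_mono {F F' : IntermediateField ℚ ℂ} (h : F ≤ F') : RR F ≤ RR F' := fun _ hx => ⟨h hx.1, hx.2⟩

/-- inclusion of the ring of integers -/
noncomputable def toRR (F : IntermediateField ℚ ℂ) : 𝓞 F →+* RR F where
  toFun x := ⟨((x : F) : ℂ), RR_int (x : F).2 (int_coe.1 x.2)⟩
  map_one' := rfl
  map_zero' := rfl
  map_add' _ _ := rfl
  map_mul' _ _ := rfl

lemma toRR_inj : Function.Injective (toRR F) := fun x y h => by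
  apply RingOfIntegers.ext
  exact Subtype.ext (congrArg (fun z : RR F => (z : ℂ)) h)

lemma toRR_coe (x : 𝓞 F) : (toRR F x : ℂ) = ((x : F) : ℂ) := rfl

lemma toRR_surj (r : RR F) : ∃ n : ℕ, ∃ x : 𝓞 F, toRR F x = 2 ^ n * r := by
  obtain ⟨hx, n, hn⟩ := r.2
  have h2 : (2 : ℂ) ^ n * r ∈ F := mul_mem (pow_mem (by have := _root_.natCast_mem F 2; exact_mod_cast this) _) hx
  exact ⟨n, ⟨⟨_, h2⟩, int_coe.2 hn⟩, rfl⟩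

variable {k : IntermediateField ℚ ℂ}

/-- conjugation on the ring of `2`-integers -/
noncomputable def sgR (φ : k →+* ℚ_[2]) (j : ℕ) : RR (KK k (j + 1)) →+* RR (KK k (j + 1)) where
  toFun x := ⟨sg φ j ⟨x, x.2.1⟩, (sg φ j ⟨x, x.2.1⟩).2, by
    obtain ⟨n, hn⟩ := x.2.2
    refine ⟨n, ?_⟩
    have h2 : (2 : ℂ) ^ n * x ∈ KK k (j + 1) := mul_mem (pow_mem (by have := _root_.natCast_mem (KK k (j + 1)) 2; exact_mod_cast this) _) x.2.1
    have := sg_int φ (y := ⟨_, h2⟩) hn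
    have e : (⟨_, h2⟩ : KK k (j + 1)) = 2 ^ n * ⟨x, x.2.1⟩ := rfl
    rw [e, map_mul, map_pow, map_ofNat] at this
    exact this⟩
  map_one' := Subtype.ext (congrArg (fun z : KK k (j + 1) => (z : ℂ)) (map_one (sg φ j)))
  map_zero' := Subtype.ext (congrArg (fun z : KK k (j + 1) => (z : ℂ)) (map_zero (sg φ j)))
  map_add' x y := Subtype.ext (congrArg (fun z : KK k (j + 1) => (z : ℂ)) (map_add (sg φ j) ⟨x, x.2.1⟩ ⟨y, y.2.1⟩))
  map_mul' x y := Subtype.ext (congrArg (fun z : KK k (j + 1) => (z : ℂ)) (map_mul (sg φ j) ⟨x, x.2.1⟩ ⟨y, y.2.1⟩))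

lemma sgR_coe (φ : k →+* ℚ_[2]) (j : ℕ) (x : RR (KK k (j + 1))) : (sgR φ j x : ℂ) = sg φ j ⟨x, x.2.1⟩ := rfl

lemma zt_RR (j : ℕ) : zt j ∈ RR (KK k j) := RR_int (zt_mem j) (zt_integralZ j)

lemma zti_RR (j : ℕ) : (zt j)⁻¹ ∈ RR (KK k j) := RR_int (inv_mem (zt_mem j)) (zt_inv_integralZ j)

/-- the generator -/
noncomputable def ztR (k : IntermediateField ℚ ℂ) (j : ℕ) : RR (KK k j) := ⟨zt j, zt_RR j⟩

lemma ztR_coe (j : ℕ) : (ztR k j : ℂ) = zt j := rfl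

/-- its inverse -/
noncomputable def ztiR (k : IntermediateField ℚ ℂ) (j : ℕ) : RR (KK k j) := ⟨(zt j)⁻¹, zti_RR j⟩

lemma ztiR_coe (j : ℕ) : (ztiR k j : ℂ) = (zt j)⁻¹ := rfl

lemma ztR_mul (j : ℕ) : ztR k j * ztiR k j = 1 := Subtype.ext (by
  rw [Subring.coe_mul, ztR_coe, ztiR_coe, mul_inv_cancel₀ (zt_ne j), Subring.coe_one])

/-- generic inclusion -/
def incS {S T : Subring ℂ} (h : S ≤ T) : S →+* T where
  toFun x := ⟨x, h x.2⟩
  map_one' := rfl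
  map_zero' := rfl
  map_add' _ _ := rfl
  map_mul' _ _ := rfl

lemma incS_coe {S T : Subring ℂ} (h : S ≤ T) (x : S) : (incS h x : ℂ) = x := rfl

/-- the inclusion -/
noncomputable def incR (k : IntermediateField ℚ ℂ) (j : ℕ) : RR (KK k j) →+* RR (KK k (j + 1)) :=
  incS (RR_mono (KK_le j))

lemma incR_coe (j : ℕ) (x : RR (KK k j)) : (incR k j x : ℂ) = x := incS_coe (RR_mono (KK_le j)) x

lemma incR_inj (j : ℕ) : Function.Injective (incR k j) := fun x y h => by
  apply Subtype.ext
  rw [← incR_coe, h, incR_coe]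

lemma incR_mem (j : ℕ) (a : RR (KK k j)) : (incR k j a : ℂ) ∈ KK k j := by
  rw [incR_coe]; exact a.2.1

lemma ztR_sq (j : ℕ) : ztR k (j + 1) ^ 2 = incR k j (ztR k j) := Subtype.ext (by
  rw [Subring.coe_pow, ztR_coe, incR_coe, ztR_coe, zt_sq])

lemma sgR_fix (φ : k →+* ℚ_[2]) (j : ℕ) (a : RR (KK k j)) : sgR φ j (incR k j a) = incR k j a := Subtype.ext (by
  rw [sgR_coe]
  exact sg_fix φ j (x := ⟨_, (incR k j a).2.1⟩) (incR_mem j a))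

lemma sgR_zt (φ : k →+* ℚ_[2]) (j : ℕ) : sgR φ j (ztR k (j + 1)) = -ztR k (j + 1) := Subtype.ext (by
  rw [sgR_coe, sg_zt φ j (by rfl), Subring.coe_neg, ztR_coe])

lemma dec_RR (φ : k →+* ℚ_[2]) (j : ℕ) (x : RR (KK k (j + 1))) : ∃ a b : RR (KK k j), (x : ℂ) = a + b * zt (j + 1) := by
  obtain ⟨a, ha, b, hb, h⟩ := dec_KK x.2.1
  have hs1 : sg φ j ⟨zt (j + 1), zt_mem _⟩ = -zt (j + 1) := sg_zt φ j rfl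
  have h1 : (sgR φ j x : ℂ) = a - b * zt (j + 1) := by
    rw [sgR_coe]
    have e : (⟨x, x.2.1⟩ : KK k (j + 1)) = ⟨a, KK_le j ha⟩ + ⟨b, KK_le j hb⟩ * ⟨zt (j + 1), zt_mem _⟩ := Subtype.ext h
    rw [e, map_add, map_mul]
    push_cast
    rw [hs1, sg_fix φ j (x := ⟨a, KK_le j ha⟩) ha, sg_fix φ j (x := ⟨b, KK_le j hb⟩) hb]
    ring
  have ha2 : a ∈ RR (KK k j) := by
    have : a ∈ RR (KK k (j + 1)) := by
      have e : a = 2⁻¹ * (x + sgR φ j x) := by rw [h1, h]; ring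
      rw [e]
      exact mul_mem half_mem (add_mem x.2 (sgR φ j x).2)
    exact ⟨ha, this.2⟩
  have hb2 : b ∈ RR (KK k j) := by
    have : b ∈ RR (KK k (j + 1)) := by
      have e : b = 2⁻¹ * (x - sgR φ j x) * (zt (j + 1))⁻¹ := by
        rw [h1, h]; field_simp [zt_ne (j + 1)]; ring
      rw [e]
      exact mul_mem (mul_mem half_mem (sub_mem x.2 (sgR φ j x).2)) (zti_RR _)
    exact ⟨hb, this.2⟩
  exact ⟨⟨a, ha2⟩, ⟨b, hb2⟩, h⟩

/-- the quadratic extension of `2`-integers -/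
noncomputable def EE (φ : k →+* ℚ_[2]) (j : ℕ) : QExt (RR (KK k j)) (RR (KK k (j + 1))) where
  ι := incR k j
  inj := incR_inj j
  s := ztR k (j + 1)
  u := ⟨ztR k j, ztiR k j, ztR_mul j, by rw [mul_comm, ztR_mul]⟩
  hs := ztR_sq j
  h2 := two_unit_RR
  σ := sgR φ j
  hσ a := sgR_fix φ j a
  hσs := sgR_zt φ j
  dec x := by
    obtain ⟨a, b, h⟩ := dec_RR φ j x
    exact ⟨a, b, Subtype.ext (by rw [Subring.coe_add, Subring.coe_mul, incR_coe, incR_coe, ztR_coe, h])⟩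

lemma EE_ι (φ : k →+* ℚ_[2]) (j : ℕ) : (EE φ j).ι = incR k j := rfl

lemma EE_σ (φ : k →+* ℚ_[2]) (j : ℕ) : (EE φ j).σ = sgR φ j := rfl

/-- non-norm criterion -/
lemma nonnorm (φ : k →+* ℚ_[2]) (j : ℕ) (s : RR (KK k j)) (hs : s ≠ 0) (h : ¬ U (j + 2) (φ (nrm ⟨s, s.2.1⟩)))
    (x : RR (KK k (j + 1))) (c : RR (KK k j)) (hc : c ≠ 0) : (EE φ j).ι (s * c ^ 2) ≠ x * (EE φ j).σ x := by
  intro h1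
  apply h
  set S : KK k j := ⟨s, s.2.1⟩ with hS
  set D : KK k j := ⟨c, c.2.1⟩ with hD
  set W : KK k (j + 1) := ⟨x, x.2.1⟩ with hW
  have hS0 : S ≠ 0 := fun e => hs (Subtype.ext (congrArg (fun z : KK k j => (z : ℂ)) e))
  have hD0 : D ≠ 0 := fun e => hc (Subtype.ext (congrArg (fun z : KK k j => (z : ℂ)) e))
  have h2 : ((S * D ^ 2 : KK k j) : ℂ) = W * sg φ j W := by
    rw [EE_ι, EE_σ] at h1
    have := congrArg (fun z : RR (KK k (j + 1)) => (z : ℂ)) h1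
    simp only [Subring.coe_mul, incR_coe, Subring.coe_pow, sgR_coe] at this
    exact this
  have h3 := nrm_sg φ h2
  have hW0 : W ≠ 0 := by
    intro e
    rw [e] at h2
    have : S * D ^ 2 = 0 := Subtype.ext (by rw [h2]; simp)
    exact (mul_ne_zero hS0 (pow_ne_zero 2 hD0)) this
  have h4 := nrm_U φ hW0
  rw [nrm_mul φ, nrm_pow φ] at h3
  have h5 : U (j + 2) (φ (nrm D) ^ 2) := U_sq (by omega) (nrm_U φ hD0)
  have h6 : φ (nrm S) = φ (nrm W) * (φ (nrm D) ^ 2)⁻¹ := by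
    rw [← h3, map_mul, map_pow, mul_inv_cancel_right₀]
    exact pow_ne_zero 2 ((map_ne_zero φ).2 (nrm_ne φ hD0))
  rw [h6]
  exact U_mul h4 (U_inv (by omega) h5)

/-- all the data on the base field -/
structure Base (k : IntermediateField ℚ ℂ) where
  φ : k →+* ℚ_[2]
  φ' : k →+* ℚ_[2]
  α : k
  α' : k
  ia : IsIntegral ℤ α
  ia' : IsIntegral ℤ α'
  t : ℤ
  ht : Odd t
  m : ℕ
  hm : Odd m
  hadd : α + α' = t
  hmul : α * α' = 2 ^ (8 * m)
  w : ℤ_[2]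
  hw : φ α = 5 + 8 * (w : ℚ_[2])
  w' : ℤ_[2]
  hw' : φ' α' = 5 + 8 * (w' : ℚ_[2])
  hunit : ∀ x : k, IsIntegral ℤ x → IsIntegral ℤ x⁻¹ → x ≠ 0 → x = 1 ∨ x = -1
  g : KK k 1
  v : KK k 1
  hv0 : v ≠ 0
  iv : IsIntegral ℤ v
  iv' : IsIntegral ℤ v⁻¹
  hg : (g : ℂ) ^ 2 = α * v
  hfin : Module.finrank ℚ k = 2
  δ : k
  d : ℕ
  hd : 0 < d
  hδ : δ ^ 2 = -(d : k)

end TwoG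

end SecBaseData

section SecUnits

open NumberField

namespace TwoG

open QExt

lemma sq_index_ne_zero (H : Type*) [CommGroup H] [Group.FG H] : (sqH H).index ≠ 0 := by
  have : Finite (H ⧸ sqH H) := by
    apply CommGroup.finite_of_fg_torsion
    intro x
    induction x using QuotientGroup.induction_on with
    | H x =>
      rw [isOfFinOrder_iff_pow_eq_one]
      refine ⟨2, by norm_num, ?_⟩
      rw [← QuotientGroup.mk_pow, QuotientGroup.eq_one_iff]
      exact ⟨x, rfl⟩
  rw [Subgroup.index]
  exact Nat.card_pos.ne'

lemma sq_index_le {H : Type*} [CommGroup H] {ι : Type*} [Fintype ι] (f : ι → H)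
    (hf : ∀ x : H, ∃ e : ι → ℤ, x = ∏ i, f i ^ e i) : (sqH H).index ≤ 2 ^ Fintype.card ι := by
  have hs : Function.Surjective (fun e : ι → Fin 2 => (QuotientGroup.mk (∏ i, f i ^ (e i : ℕ)) : H ⧸ sqH H)) := by
    intro x
    induction x using QuotientGroup.induction_on with
    | H x =>
      obtain ⟨e, rfl⟩ := hf x
      refine ⟨fun i => ⟨(e i % 2).toNat, by omega⟩, ?_⟩
      simp only
      rw [QuotientGroup.eq]
      refine ⟨∏ i, f i ^ (e i / 2), ?_⟩
      rw [powMonoidHom_apply, ← Finset.prod_pow, ← Finset.prod_inv_distrib, ← Finset.prod_mul_distrib]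
      apply Finset.prod_congr rfl
      intro i _
      rw [← zpow_natCast, ← zpow_natCast, ← zpow_mul, ← zpow_neg, ← zpow_add]
      congr 1
      push_cast
      omega
  have := Nat.card_le_card_of_surjective _ hs
  rw [Subgroup.index]
  refine this.trans (le_of_eq ?_)
  rw [Nat.card_fun, Nat.card_eq_fintype_card, Nat.card_eq_fintype_card, Fintype.card_fin]

lemma sq_index_ge (H : Type*) [CommGroup H] [Group.FG H] (N : ℕ) (hN : N ≤ Module.finrank ℤ (Additive H))
    (x : H) (hx : x ≠ 1) (hx2 : x ^ 2 = 1) : 2 ^ (N + 1) ≤ (sqH H).index := by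
  obtain ⟨n, ι, _, p, hp, e, ⟨f⟩⟩ := AddCommGroup.equiv_free_prod_directSum_zmod (G := Additive H)
  classical
  have hD : ∃ D : ℕ, D ≠ 0 ∧ ∀ t : DirectSum ι (fun i => ZMod (p i ^ e i)), D • t = 0 := by
    refine ⟨∏ i, p i ^ e i, Finset.prod_ne_zero_iff.2 fun i _ => pow_ne_zero _ (hp i).ne_zero, fun t => ?_⟩
    apply DFinsupp.ext
    intro i
    rw [DFinsupp.smul_apply, nsmul_eq_mul]
    have : ((∏ i, p i ^ e i : ℕ) : ZMod (p i ^ e i)) = 0 := by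
      rw [ZMod.natCast_eq_zero_iff]
      exact Finset.dvd_prod_of_mem _ (Finset.mem_univ i)
    rw [this, zero_mul]; rfl
  obtain ⟨D, hD0, hD⟩ := hD
  have hNn : N ≤ n := by
    obtain ⟨v, hv⟩ := exists_linearIndependent_of_le_finrank hN
    have : LinearIndependent ℤ (fun i => (f (v i)).1) := by
      rw [Fintype.linearIndependent_iff] at hv ⊢
      intro g hg i
      have h1 : (f (∑ i, g i • v i)).1 = 0 := by
        rw [map_sum, Prod.fst_sum, ← hg]
        apply Finset.sum_congr rfl
        intro i _
        rw [map_zsmul]; rfl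
      have h2 : f (D • ∑ i, g i • v i) = 0 := by
        rw [map_nsmul]
        ext1
        · rw [Prod.smul_fst, h1, smul_zero]; rfl
        · rw [Prod.smul_snd, hD]; rfl
      have h3 : D • ∑ i, g i • v i = 0 := f.injective (by rw [h2, map_zero])
      have h4 := hv (fun i => D * g i) (by
        rw [← h3, Finset.smul_sum]
        apply Finset.sum_congr rfl
        intro i _
        rw [mul_smul, natCast_zsmul]) i
      have h5 : (D : ℤ) ≠ 0 := by exact_mod_cast hD0
      exact (mul_eq_zero.1 h4).resolve_left h5
    have := this.fintype_card_le_finrank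
    simpa using this
  have hi : ∃ i, p i = 2 ∧ e i ≠ 0 := by
    by_contra hcon
    push Not at hcon
    set y := f (Additive.ofMul x) with hy
    have hy2 : (2 : ℕ) • y = 0 := by
      rw [hy, ← map_nsmul, ← ofMul_pow, hx2, ofMul_one, map_zero]
    have h1 : y = 0 := by
      ext1
      · have := congrArg Prod.fst hy2
        rw [Prod.smul_fst] at this
        ext i
        have := DFunLike.congr_fun this i
        rw [Finsupp.smul_apply] at this
        change (2 : ℕ) • y.1 i = 0 at this
        change y.1 i = 0
        rw [nsmul_eq_mul] at this
        push_cast at this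
        omega
      · have := congrArg Prod.snd hy2
        rw [Prod.smul_snd] at this
        apply DFinsupp.ext
        intro i
        have := DFunLike.congr_fun this i
        rw [DFinsupp.smul_apply] at this
        change (2 : ℕ) • y.2 i = 0 at this
        change y.2 i = 0
        by_cases he : e i = 0
        · have : Subsingleton (ZMod (p i ^ e i)) := by rw [he, pow_zero]; infer_instance
          exact Subsingleton.elim _ _
        · have hp2 : p i ≠ 2 := fun h => he (hcon i h)
          have hu : IsUnit ((2 : ℕ) : ZMod (p i ^ e i)) := by
            rw [ZMod.isUnit_iff_coprime]
            apply Nat.Coprime.pow_right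
            exact (Nat.coprime_primes Nat.prime_two (hp i)).2 (Ne.symm hp2)
          rw [nsmul_eq_mul] at this
          exact (hu.mul_right_eq_zero).1 this
    apply hx
    have : Additive.ofMul x = 0 := f.injective (by rw [← hy, h1, map_zero])
    exact this
  obtain ⟨i0, hp0, he0⟩ := hi
  have hdvd : 2 ∣ p i0 ^ e i0 := by rw [hp0]; exact dvd_pow_self 2 he0
  let c : ZMod (p i0 ^ e i0) →+ ZMod 2 := (ZMod.castHom hdvd (ZMod 2)).toAddMonoidHom
  let G : Additive H →+ (Fin n → ZMod 2) × ZMod 2 :=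
    { toFun := fun a => (fun i => (((f a).1 i : ℤ) : ZMod 2), c ((f a).2 i0))
      map_zero' := by
        ext1
        · funext i; simp
        · simp
      map_add' := fun a b => by
        ext1
        · funext i; simp
        · simp }
  have hG : Function.Surjective G := by
    rintro ⟨a, b⟩
    obtain ⟨b', hb'⟩ := ZMod.castHom_surjective hdvd b
    refine ⟨f.symm (Finsupp.equivFunOnFinite.symm (fun i => ((a i).val : ℤ)), DirectSum.of _ i0 b'), ?_⟩
    change ((fun i => (((f (f.symm _)).1 i : ℤ) : ZMod 2), c ((f (f.symm _)).2 i0)) : (Fin n → ZMod 2) × ZMod 2) = _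
    rw [AddEquiv.apply_symm_apply]
    ext1
    · funext i
      simp
    · simp only [DirectSum.of_eq_same]
      exact hb'
  let G' : H →* Multiplicative ((Fin n → ZMod 2) × ZMod 2) := AddMonoidHom.toMultiplicativeRight G
  have hG' : Function.Surjective G' := fun y => by
    obtain ⟨a, ha⟩ := hG y.toAdd
    exact ⟨a.toMul, congrArg Multiplicative.ofAdd ha⟩
  have hk : sqH H ≤ G'.ker := by
    rintro _ ⟨y, rfl⟩
    rw [MonoidHom.mem_ker, powMonoidHom_apply, map_pow]
    apply Multiplicative.toAdd.injective
    rw [toAdd_pow, toAdd_one]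
    have h22 : ∀ w : ZMod 2, 2 • w = 0 := fun w => by
      rw [two_nsmul]; exact CharTwo.add_self_eq_zero w
    have : ∀ z : (Fin n → ZMod 2) × ZMod 2, 2 • z = 0 := by
      intro z
      ext1
      · funext i
        exact h22 (z.1 i)
      · exact h22 z.2
    exact this _
  have h1 := Nat.card_congr (Equiv.refl (Multiplicative ((Fin n → ZMod 2) × ZMod 2)))
  have h2 : G'.ker.index = 2 ^ (n + 1) := by
    rw [Subgroup.index_ker, MonoidHom.range_eq_top.2 hG', Subgroup.card_top]
    rw [Nat.card_congr (Multiplicative.toAdd), Nat.card_prod, Nat.card_fun]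
    simp [pow_succ]
  have h3 := Subgroup.index_dvd_of_le hk
  rw [h2] at h3
  exact (Nat.pow_le_pow_right (by norm_num) (by omega)).trans (Nat.le_of_dvd (Nat.pos_of_ne_zero (sq_index_ne_zero H)) h3)

lemma fg_sub {H : Type*} [CommGroup H] [Group.FG H] (S : Subgroup H) : Group.FG S := by
  have h1 : Module.Finite ℤ (Additive H) := Module.Finite.iff_addGroup_fg.2 inferInstance
  have h2 : IsNoetherian ℤ (Additive H) := inferInstance
  have h3 : (AddSubgroup.toIntSubmodule (Subgroup.toAddSubgroup S)).FG := IsNoetherian.noetherian _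
  rw [Group.fg_iff_subgroup_fg, Subgroup.fg_iff_add_fg]
  rw [← AddSubgroup.toIntSubmodule_toAddSubgroup (Subgroup.toAddSubgroup S)]
  exact (Submodule.fg_iff_addSubgroup_fg _).1 h3

lemma rank_lower {E E' W W' : Type*} [CommGroup E] [CommGroup E'] [CommGroup W] [CommGroup W']
    [Group.FG E] [Group.FG E'] [Group.FG W'] (i : E →* W) (i' : E' →* W') (hi' : Function.Injective i') (N : W' →* W)
    (h : ∀ x, ∃ y, N (i' x) = i y) :
    Module.finrank ℤ (Additive E') ≤ Module.finrank ℤ (Additive E) + Module.finrank ℤ (Additive N.ker) := by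
  have f1 : Module.Finite ℤ (Additive E) := Module.Finite.iff_addGroup_fg.2 inferInstance
  have f2 : Module.Finite ℤ (Additive E') := Module.Finite.iff_addGroup_fg.2 inferInstance
  have f3 : Module.Finite ℤ (Additive N.ker) := by
    have := fg_sub N.ker
    exact Module.Finite.iff_addGroup_fg.2 inferInstance
  let I : Additive E →ₗ[ℤ] Additive W := (MonoidHom.toAdditive i).toIntLinearMap
  let Ψ : Additive E' →ₗ[ℤ] Additive W := (MonoidHom.toAdditive (N.comp i')).toIntLinearMap
  have h0 := Submodule.finrank_quotient_add_finrank (LinearMap.ker Ψ)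
  have h1 : Module.finrank ℤ (Additive E' ⧸ LinearMap.ker Ψ) = Module.finrank ℤ (LinearMap.range Ψ) :=
    (LinearMap.quotKerEquivRange Ψ).finrank_eq
  have h2 : LinearMap.range Ψ ≤ LinearMap.range I := by
    rintro _ ⟨x, rfl⟩
    obtain ⟨y, hy⟩ := h x.toMul
    exact ⟨Additive.ofMul y, congrArg Additive.ofMul hy.symm⟩
  have h3 : Module.finrank ℤ (LinearMap.range Ψ) ≤ Module.finrank ℤ (LinearMap.range I) :=
    Submodule.finrank_mono h2
  have h4 : Module.finrank ℤ (LinearMap.range I) ≤ Module.finrank ℤ (Additive E) := LinearMap.finrank_range_le I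
  let J : LinearMap.ker Ψ →+ Additive N.ker :=
    { toFun := fun x => Additive.ofMul ⟨i' x.1.toMul, x.2⟩
      map_zero' := by
        apply Additive.toMul.injective
        apply Subtype.ext
        exact map_one i'
      map_add' := fun x y => by
        apply Additive.toMul.injective
        apply Subtype.ext
        exact map_mul i' _ _ }
  have h5 : Module.finrank ℤ (LinearMap.ker Ψ) ≤ Module.finrank ℤ (Additive N.ker) := by
    apply LinearMap.finrank_le_finrank_of_injective (f := J.toIntLinearMap)
    intro x y hxy
    apply Subtype.ext
    have h6 : J x = J y := hxy
    have h7 : i' x.1.toMul = i' y.1.toMul := congrArg (fun z : Additive N.ker => (z.toMul : W')) h6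
    exact Additive.toMul.injective (hi' h7)
  omega

section NF
variable (K : Type*) [Field K] [NumberField K]

lemma rank_cx [IsTotallyComplex K] {j : ℕ} (h : Module.finrank ℚ K = 2 * 2 ^ j) :
    Units.rank K + 1 = 2 ^ j := by
  have h1 := IsTotallyComplex.finrank (K := K)
  have h2 := InfinitePlace.card_eq_nrRealPlaces_add_nrComplexPlaces K
  rw [IsTotallyComplex.nrRealPlaces_eq_zero, zero_add] at h2
  rw [Units.rank, h2]
  have : 0 < 2 ^ j := by positivity
  omega

lemma units_gen : ∃ f : Option (Fin (Units.rank K)) → (𝓞 K)ˣ, ∀ x : (𝓞 K)ˣ, ∃ e : Option (Fin (Units.rank K)) → ℤ,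
    x = ∏ i, f i ^ e i := by
  obtain ⟨ζ, hζ⟩ := IsCyclic.exists_generator (α := Units.torsion K)
  refine ⟨fun i => i.elim (ζ : (𝓞 K)ˣ) (Units.fundSystem K), fun x => ?_⟩
  obtain ⟨⟨z, e⟩, h, -⟩ := Units.exist_unique_eq_mul_prod K x
  obtain ⟨a, ha⟩ := Subgroup.mem_zpowers_iff.1 (hζ z)
  refine ⟨fun i => i.elim a e, ?_⟩
  rw [Fintype.prod_option, h, ← ha]
  simp

end NF

end TwoG

end SecUnits

section SecLocalise

namespace TwoG

/-- `R = O[1/2]`, with `(λ) = P P'` supported at `2` -/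
structure LocD (O R : Type) [CommRing O] [IsDedekindDomain O] [CommRing R] where
  i : O →+* R
  inj : Function.Injective i
  h2 : IsUnit (2 : R)
  surj : ∀ r, ∃ n : ℕ, ∃ x, i x = 2 ^ n * r
  P : Ideal O
  P' : Ideal O
  hP : P.IsPrime
  hP' : P'.IsPrime
  P0 : P ≠ ⊥
  P0' : P' ≠ ⊥
  lam : O
  mulP : P * P' = Ideal.span {lam}
  l2 : lam ∣ 2
  N : ℕ
  l2' : 2 ∣ lam ^ N

set_option linter.unusedSectionVars false

namespace LocD

variable {O R : Type} [CommRing O] [IsDedekindDomain O] [CommRing R] [IsDomain R] (L : LocD O R)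

lemma mem_map {J : Ideal O} {z : R} (h : z ∈ J.map L.i) : ∃ n : ℕ, ∃ y ∈ J, L.i y = 2 ^ n * z := by
  induction h using Submodule.span_induction with
  | mem x hx =>
    obtain ⟨a, ha, rfl⟩ := hx
    exact ⟨0, a, ha, by simp⟩
  | zero => exact ⟨0, 0, J.zero_mem, by simp⟩
  | add x y _ _ hx hy =>
    obtain ⟨n, a, ha, h1⟩ := hx
    obtain ⟨m, b, hb, h2⟩ := hy
    refine ⟨n + m, 2 ^ m * a + 2 ^ n * b, J.add_mem (J.mul_mem_left _ ha) (J.mul_mem_left _ hb), ?_⟩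
    simp only [map_add, map_mul, map_pow, map_ofNat, h1, h2]
    ring
  | smul r x _ hx =>
    obtain ⟨n, a, ha, h1⟩ := hx
    obtain ⟨m, b, h2⟩ := L.surj r
    refine ⟨m + n, b * a, J.mul_mem_left _ ha, ?_⟩
    rw [map_mul, h1, h2, smul_eq_mul]
    ring

lemma mem_map' {J : Ideal O} {x : O} (h : L.i x ∈ J.map L.i) : ∃ n : ℕ, 2 ^ n * x ∈ J := by
  obtain ⟨n, y, hy, h1⟩ := L.mem_map h
  refine ⟨n, ?_⟩
  have : y = 2 ^ n * x := L.inj (by rw [h1, map_mul, map_pow, map_ofNat])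
  rwa [← this]

lemma span_scale (r : R) : ∃ x, Ideal.span {r} = (Ideal.span {x}).map L.i := by
  obtain ⟨n, x, h⟩ := L.surj r
  refine ⟨x, ?_⟩
  rw [Ideal.map_span, Set.image_singleton, h, Ideal.span_singleton_mul_left_unit (L.h2.pow n)]

lemma map_comap (I : Ideal R) : (I.comap L.i).map L.i = I := by
  apply le_antisymm Ideal.map_comap_le
  intro r hr
  obtain ⟨n, x, h⟩ := L.surj r
  have h1 : L.i x ∈ (I.comap L.i).map L.i := by
    apply Ideal.mem_map_of_mem
    rw [Ideal.mem_comap, h]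
    exact I.mul_mem_left _ hr
  rw [h] at h1
  exact (Ideal.unit_mul_mem_iff_mem _ (L.h2.pow n)).1 h1

lemma map_ne_bot {J : Ideal O} (h : J ≠ ⊥) : J.map L.i ≠ ⊥ := by
  intro h1
  rw [Ideal.map_eq_bot_iff_of_injective L.inj] at h1
  exact h h1

lemma lam_unit : IsUnit (L.i L.lam) := by
  have := map_dvd L.i L.l2
  rw [map_ofNat] at this
  exact isUnit_of_dvd_unit this L.h2

lemma map_P : L.P.map L.i = ⊤ := by
  apply Ideal.eq_top_of_isUnit_mem _ _ L.lam_unit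
  apply Ideal.mem_map_of_mem
  exact Ideal.mul_le_left (I := L.P) (J := L.P') (by rw [L.mulP]; exact Ideal.mem_span_singleton_self _)

lemma map_P' : L.P'.map L.i = ⊤ := by
  apply Ideal.eq_top_of_isUnit_mem _ _ L.lam_unit
  apply Ideal.mem_map_of_mem
  exact Ideal.mul_le_right (I := L.P) (J := L.P') (by rw [L.mulP]; exact Ideal.mem_span_singleton_self _)

lemma dvd_form {C : Ideal O} {n : ℕ} (h : C ∣ Ideal.span {(2 : O) ^ n}) : ∃ a b : ℕ, C = L.P ^ a * L.P' ^ b := by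
  have h1 : Ideal.span {(2 : O) ^ n} ∣ (L.P * L.P') ^ (L.N * n) := by
    rw [L.mulP, Ideal.span_singleton_pow, Ideal.dvd_span_singleton, Ideal.mem_span_singleton, pow_mul]
    exact pow_dvd_pow_of_dvd L.l2' n
  have h2 := h.trans h1
  rw [mul_pow] at h2
  obtain ⟨C1, C2, h3, h4, rfl⟩ := exists_dvd_and_dvd_of_dvd_mul h2
  have p1 : Prime L.P := Ideal.prime_of_isPrime L.P0 L.hP
  have p2 : Prime L.P' := Ideal.prime_of_isPrime L.P0' L.hP'
  obtain ⟨a, -, ha⟩ := (dvd_prime_pow p1 _).1 h3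
  obtain ⟨b, -, hb⟩ := (dvd_prime_pow p2 _).1 h4
  exact ⟨a, b, by rw [associated_iff_eq.1 ha, associated_iff_eq.1 hb]⟩

lemma icl_P' : icl L.P' = (icl L.P)⁻¹ := by
  rw [eq_inv_iff_mul_eq_one, mul_comm, ← icl_mul L.P0 L.P0', L.mulP, icl_span]

lemma icl_form (a b : ℕ) : icl (L.P ^ a * L.P' ^ b) = icl L.P ^ ((a : ℤ) - b) := by
  rw [icl_mul (pow_ne_zero _ L.P0) (pow_ne_zero _ L.P0'), icl_pow L.P0, icl_pow L.P0', icl_P', zpow_sub, inv_pow]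
  simp

lemma unif {I J : Ideal O} (h : I.map L.i ≤ J.map L.i) : ∃ n : ℕ, Ideal.span {(2 : O) ^ n} * I ≤ J := by
  obtain ⟨S, rfl⟩ := IsNoetherian.noetherian I
  have h1 : ∀ s : O, ∃ n : ℕ, s ∈ S → 2 ^ n * s ∈ J := by
    intro s
    by_cases hs : s ∈ S
    · obtain ⟨n, hn⟩ := L.mem_map' (h (Ideal.mem_map_of_mem L.i (Ideal.subset_span hs)))
      exact ⟨n, fun _ => hn⟩
    · exact ⟨0, fun h => absurd h hs⟩
  choose f hf using h1
  refine ⟨S.sup f, ?_⟩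
  rw [Ideal.span_singleton_mul_le_iff]
  intro z hz
  have hz' : z ∈ Submodule.span O (S : Set O) := hz
  induction hz' using Submodule.span_induction with
  | mem x hx =>
    obtain ⟨c, hc⟩ := Nat.exists_eq_add_of_le (Finset.le_sup (f := f) hx)
    rw [hc, pow_add, mul_comm ((2 : O) ^ f x), mul_assoc]
    exact J.mul_mem_left _ (hf x hx)
  | zero => rw [mul_zero]; exact J.zero_mem
  | add x y hx0 hy0 hx hy => rw [mul_add]; exact J.add_mem (hx hx0) (hy hy0)
  | smul r x hx0 hx => rw [smul_eq_mul, mul_left_comm]; exact J.mul_mem_left _ (hx hx0)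

lemma two_ne (L : LocD O R) : (2 : O) ≠ 0 := by
  intro h
  have := L.h2.ne_zero
  rw [← map_ofNat L.i 2, h, map_zero] at this
  exact this rfl

lemma loc_form {I J : Ideal O} (hJ : J ≠ ⊥) (h : I.map L.i = J.map L.i) :
    ∃ n a b : ℕ, Ideal.span {(2 : O) ^ n} * I = J * (L.P ^ a * L.P' ^ b) := by
  obtain ⟨n, hn⟩ := L.unif h.le
  obtain ⟨m, hm⟩ := L.unif h.ge
  obtain ⟨C, hC⟩ := Ideal.dvd_iff_le.2 hn
  obtain ⟨D, hD⟩ := Ideal.dvd_iff_le.2 hm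
  have h1 : C * D = Ideal.span {(2 : O) ^ (n + m)} := by
    apply mul_left_cancel₀ hJ
    rw [← mul_assoc, ← hC, mul_assoc, ← hD, pow_add, ← Ideal.span_singleton_mul_span_singleton]
    ring
  obtain ⟨a, b, rfl⟩ := L.dvd_form (C := C) ⟨D, h1.symm⟩
  exact ⟨n, a, b, hC⟩

lemma loc_class {I J : Ideal O} (hI : I ≠ ⊥) (hJ : J ≠ ⊥) (h : I.map L.i = J.map L.i) :
    ∃ e : ℤ, icl I = icl J * icl L.P ^ e := by
  obtain ⟨n, a, b, h1⟩ := L.loc_form hJ h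
  refine ⟨a - b, ?_⟩
  rw [← L.icl_form, ← icl_mul hJ (mul_ne_zero (pow_ne_zero _ L.P0) (pow_ne_zero _ L.P0')), ← h1,
    icl_mul (span_ne_bot (pow_ne_zero _ L.two_ne)) hI, icl_span, one_mul]

lemma zp_rep (e : ℤ) : ∃ Q : Ideal O, Q ≠ ⊥ ∧ Q.map L.i = ⊤ ∧ icl Q = icl L.P ^ e := by
  rcases Int.eq_nat_or_neg e with ⟨n, rfl | rfl⟩
  · refine ⟨L.P ^ n, pow_ne_zero _ L.P0, ?_, ?_⟩
    · rw [Ideal.map_pow, map_P, Ideal.top_pow]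
    · rw [icl_pow L.P0, zpow_natCast]
  · refine ⟨L.P' ^ n, pow_ne_zero _ L.P0', ?_, ?_⟩
    · rw [Ideal.map_pow, map_P', Ideal.top_pow]
    · rw [icl_pow L.P0', icl_P', zpow_neg, zpow_natCast, inv_pow]

theorem sqPrin_of (h : ∀ c : ClassGroup O, c ^ 2 ∈ Subgroup.zpowers (icl L.P) → c ∈ Subgroup.zpowers (icl L.P)) :
    SqPrin R := by
  intro I x hx hI
  obtain ⟨x0, hx0⟩ := L.span_scale x
  set J := I.comap L.i with hJd
  have hJm : J.map L.i = I := L.map_comap I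
  have hIb : I ≠ ⊥ := by
    rintro rfl
    rw [Ideal.bot_mul, eq_comm, Ideal.span_singleton_eq_bot] at hI
    exact hx hI
  have hJb : J ≠ ⊥ := by
    intro e
    rw [e, Ideal.map_bot] at hJm
    exact hIb hJm.symm
  have hx0b : Ideal.span {x0} ≠ ⊥ := by
    intro e
    rw [e, Ideal.map_bot, Ideal.span_singleton_eq_bot] at hx0
    exact hx hx0
  obtain ⟨e, he⟩ := L.loc_class (I := J * J) (J := Ideal.span {x0}) (mul_ne_zero hJb hJb) hx0b (by
    rw [Ideal.map_mul, hJm, hI, hx0])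
  rw [icl_span, one_mul, icl_mul hJb hJb, ← sq] at he
  obtain ⟨e', he'⟩ := Subgroup.mem_zpowers_iff.1 (h (icl J) (Subgroup.mem_zpowers_iff.2 ⟨e, he.symm⟩))
  obtain ⟨Q, hQ0, hQ, hQe⟩ := L.zp_rep (-e')
  have h1 : icl (J * Q) = 1 := by
    rw [icl_mul hJb hQ0, hQe, ← he', zpow_neg, mul_inv_cancel]
  obtain ⟨y, hy⟩ := (icl_eq_one_iff (mul_ne_zero hJb hQ0)).1 h1
  refine ⟨L.i y, ?_⟩
  have := congrArg (Ideal.map L.i) hy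
  rw [Ideal.map_mul, hJm, hQ, Ideal.mul_top, Ideal.map_span, Set.image_singleton] at this
  exact this

theorem of_sqPrin (h : SqPrin R) (c : ClassGroup O) (hc : c ^ 2 ∈ Subgroup.zpowers (icl L.P)) :
    c ∈ Subgroup.zpowers (icl L.P) := by
  obtain ⟨J, hJ, rfl⟩ := icl_surj c
  obtain ⟨e, he⟩ := Subgroup.mem_zpowers_iff.1 hc
  obtain ⟨Q, hQ0, hQ, hQe⟩ := L.zp_rep (-e)
  have h1 : icl (J * J * Q) = 1 := by
    rw [icl_mul (mul_ne_zero hJ hJ) hQ0, icl_mul hJ hJ, hQe, ← sq, ← he, zpow_neg, mul_inv_cancel]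
  obtain ⟨x, hx⟩ := (icl_eq_one_iff (mul_ne_zero (mul_ne_zero hJ hJ) hQ0)).1 h1
  have h2 := congrArg (Ideal.map L.i) hx
  rw [Ideal.map_mul, Ideal.map_mul, hQ, Ideal.mul_top, Ideal.map_span, Set.image_singleton] at h2
  have hx0 : x ≠ 0 := by
    rintro rfl
    rw [Ideal.span_singleton_eq_bot.2 rfl] at hx
    exact mul_ne_zero (mul_ne_zero hJ hJ) hQ0 hx
  obtain ⟨y, hy⟩ := h (J.map L.i) (L.i x) (by rwa [Ne, map_eq_zero_iff _ L.inj]) h2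
  obtain ⟨y0, hy0⟩ := L.span_scale y
  have hyb : Ideal.span {y0} ≠ ⊥ := by
    intro e
    rw [e, Ideal.map_bot] at hy0
    exact L.map_ne_bot hJ (hy.trans hy0)
  obtain ⟨e', he'⟩ := L.loc_class hJ hyb (hy.trans hy0)
  rw [icl_span, one_mul] at he'
  exact Subgroup.mem_zpowers_iff.2 ⟨e', he'.symm⟩

theorem units_gen (L : LocD O R) [Finite (ClassGroup O)] {ι : Type*} [Fintype ι] (f : ι → Oˣ)
    (hf : ∀ x : Oˣ, ∃ e : ι → ℤ, x = ∏ i, f i ^ e i) :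
    ∃ F : Option (Option ι) → Rˣ, ∀ x : Rˣ, ∃ e : Option (Option ι) → ℤ, x = ∏ i, F i ^ e i := by
  set h := orderOf (icl L.P) with hh
  have hpos : 0 < h := orderOf_pos _
  obtain ⟨π, hπ⟩ : ∃ π, L.P ^ h = Ideal.span {π} := by
    rw [← icl_eq_one_iff (pow_ne_zero _ L.P0), icl_pow L.P0, hh, pow_orderOf_eq_one]
  have hπu : IsUnit (L.i π) := by
    rw [← Ideal.span_singleton_eq_top, ← Set.image_singleton, ← Ideal.map_span, ← hπ, Ideal.map_pow, map_P,
      Ideal.top_pow]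
  obtain ⟨Pu, hPu⟩ := hπu
  obtain ⟨Lu, hLu⟩ := L.lam_unit
  let Φ : Oˣ →* Rˣ := Units.map (L.i : O →* R)
  let F : Option (Option ι) → Rˣ := fun o => o.elim Pu (fun o => o.elim Lu (fun i => Φ (f i)))
  -- the set of products
  let S : Set Rˣ := {x | ∃ e : Option (Option ι) → ℤ, x = ∏ i, F i ^ e i}
  have hmul : ∀ x y, x ∈ S → y ∈ S → x * y ∈ S := by
    rintro x y ⟨e, rfl⟩ ⟨e', rfl⟩
    refine ⟨e + e', ?_⟩
    rw [← Finset.prod_mul_distrib]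
    apply Finset.prod_congr rfl
    intro i _
    rw [Pi.add_apply, zpow_add]
  have hinv : ∀ x, x ∈ S → x⁻¹ ∈ S := by
    rintro x ⟨e, rfl⟩
    refine ⟨-e, ?_⟩
    rw [← Finset.prod_inv_distrib]
    apply Finset.prod_congr rfl
    intro i _
    rw [Pi.neg_apply, zpow_neg]
  have hpow : ∀ x, x ∈ S → ∀ n : ℕ, x ^ n ∈ S := by
    rintro x ⟨e, rfl⟩ n
    refine ⟨fun i => n * e i, ?_⟩
    rw [← Finset.prod_pow]
    apply Finset.prod_congr rfl
    intro i _
    simp only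
    rw [mul_comm, zpow_mul, zpow_natCast]
  have hPuS : Pu ∈ S := ⟨fun o => o.elim 1 (fun _ => 0), by
    rw [Fintype.prod_option]; simp [F]⟩
  have hLuS : Lu ∈ S := ⟨fun o => o.elim 0 (fun o => o.elim 1 (fun _ => 0)), by
    rw [Fintype.prod_option, Fintype.prod_option]; simp [F]⟩
  have hES : ∀ x : Oˣ, Φ x ∈ S := by
    intro x
    obtain ⟨e, rfl⟩ := hf x
    refine ⟨fun o => o.elim 0 (fun o => o.elim 0 e), ?_⟩
    rw [Fintype.prod_option, Fintype.prod_option]; simp [F]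
  -- elements with ideals
  have key : ∀ (x y : O) (X Y : Rˣ), L.i x = X → L.i y = Y → Ideal.span {x} = Ideal.span {y} → Y ∈ S → X ∈ S := by
    intro x y X Y hX hY hxy hYS
    rw [Ideal.span_singleton_eq_span_singleton] at hxy
    obtain ⟨u, hu⟩ := hxy.symm
    have : X = Y * Φ u := by
      apply Units.ext
      rw [Units.val_mul, ← hX, ← hY, ← hu, map_mul]; rfl
    rw [this]
    exact hmul _ _ hYS (hES u)
  have hinteg : ∀ (x : O) (X : Rˣ), L.i x = X → X ∈ S := by
    intro x X hX
    have htop : (Ideal.span {x}).map L.i = (⊤ : Ideal O).map L.i := by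
      rw [Ideal.map_top, Ideal.map_span, Set.image_singleton, Ideal.span_singleton_eq_top, hX]
      exact X.isUnit
    have hx0 : x ≠ 0 := by
      rintro rfl
      rw [map_zero] at hX
      exact X.ne_zero hX.symm
    obtain ⟨n, a, b, hab⟩ := L.loc_form top_ne_bot htop
    rw [Ideal.top_mul, Ideal.span_singleton_mul_span_singleton] at hab
    have hform : ∀ (z : O) (Z : Rˣ), L.i z = Z → ∀ a b : ℕ, Ideal.span {z} = L.P ^ a * L.P' ^ b → Z ∈ S := by
      intro z Z hZ a b hab
      have h1 : icl L.P ^ ((a : ℤ) - b) = 1 := by rw [← L.icl_form, ← hab, icl_span]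
      have h2 : (h : ℤ) ∣ (a : ℤ) - b := orderOf_dvd_iff_zpow_eq_one.2 h1
      rcases le_total b a with hle | hle
      · obtain ⟨c, hc⟩ : h ∣ a - b := by
          have : ((a - b : ℕ) : ℤ) = (a : ℤ) - b := by push_cast [hle]; ring
          rw [← this] at h2
          exact_mod_cast h2
        apply key z (L.lam ^ b * π ^ c) Z (Lu ^ b * Pu ^ c) hZ
        · rw [map_mul, map_pow, map_pow, ← hLu, ← hPu]; simp
        · rw [hab, ← Ideal.span_singleton_mul_span_singleton, ← Ideal.span_singleton_pow, ← Ideal.span_singleton_pow,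
            ← L.mulP, ← hπ, ← pow_mul, ← hc, mul_pow]
          have : a = b + (a - b) := by omega
          conv_lhs => rw [this, pow_add]
          ring
        · exact hmul _ _ (hpow _ hLuS _) (hpow _ hPuS _)
      · obtain ⟨c, hc⟩ : h ∣ b - a := by
          have : ((b - a : ℕ) : ℤ) = -((a : ℤ) - b) := by push_cast [hle]; ring
          have h3 := (dvd_neg (a := (h : ℤ))).2 h2
          rw [← this] at h3
          exact_mod_cast h3
        have : Z * Pu ^ c ∈ S := by
          apply key (z * π ^ c) (L.lam ^ b) _ (Lu ^ b)
          · rw [map_mul, map_pow, ← hPu, hZ]; simp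
          · rw [map_pow, ← hLu]; simp
          · rw [← Ideal.span_singleton_mul_span_singleton, ← Ideal.span_singleton_pow, ← Ideal.span_singleton_pow,
              ← L.mulP, ← hπ, ← pow_mul, ← hc, mul_pow, hab]
            have : a + (b - a) = b := by omega
            rw [mul_right_comm, ← pow_add, this]
          · exact hpow _ hLuS _
        have h5 := hmul _ _ this (hinv _ (hpow _ hPuS c))
        rwa [mul_inv_cancel_right] at h5
    obtain ⟨T, hT⟩ := L.h2
    have hTn : L.i (2 ^ n) = ((T ^ n : Rˣ) : R) := by rw [map_pow, map_ofNat, Units.val_pow_eq_pow_val, hT]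
    have h1 : X * T ^ n ∈ S := by
      apply hform (2 ^ n * x) _ _ a b hab
      rw [map_mul, hTn, hX, Units.val_mul, mul_comm]
    have h2 : T ^ n ∈ S := by
      obtain ⟨a', b', hab'⟩ := L.dvd_form (C := Ideal.span {(2 : O) ^ n}) (n := n) dvd_rfl
      exact hform (2 ^ n) _ hTn a' b' hab'
    have h5 := hmul _ _ h1 (hinv _ h2)
    rwa [mul_inv_cancel_right] at h5
  refine ⟨F, fun X => ?_⟩
  obtain ⟨n, x, hx⟩ := L.surj X
  obtain ⟨T, hT⟩ := L.h2
  have h1 : T ^ n ∈ S := hpow _ (hinteg 2 T (by rw [map_ofNat, hT])) n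
  have h2 : T ^ n * X ∈ S := hinteg x _ (by rw [hx, Units.val_mul, Units.val_pow_eq_pow_val, hT])
  have h5 := hmul _ _ (hinv _ h1) h2
  rwa [inv_mul_cancel_left] at h5

end LocD

end TwoG

end SecLocalise

section SecPrimes

open Polynomial IntermediateField NumberField

namespace TwoG

lemma odd_ne_two_mul {a b : ℤ_[2]} (h : (1 + 2 * a : ℤ_[2]) = 2 * b) : False :=
  not_two_dvd_one ⟨b - a, by linear_combination h⟩

lemma U_odd {t : ℕ} {u : ℤ_[2]} (h : U (t + 1) ((1 + 2 * u : ℤ_[2]) : ℚ_[2])) : ∃ z : ℤ_[2], 2 * u = 2 ^ (t + 1) * z := by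
  obtain ⟨e, z, h⟩ := h
  have n1 : ‖((1 + 2 * u : ℤ_[2]) : ℚ_[2])‖ = 1 := by
    rw [PadicInt.padic_norm_e_of_padicInt]; exact PadicInt.isUnit_iff.1 (isUnit_odd u)
  have e1 : (1 + 2 ^ (t + 1) * (z : ℚ_[2])) = ((1 + 2 * (2 ^ t * z) : ℤ_[2]) : ℚ_[2]) := by
    push_cast; rw [coe_two]; ring
  have n2 : ‖(1 + 2 ^ (t + 1) * (z : ℚ_[2]))‖ = 1 := by
    rw [e1, PadicInt.padic_norm_e_of_padicInt]; exact PadicInt.isUnit_iff.1 (isUnit_odd _)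
  have n3 := congrArg norm h
  rw [n1, norm_mul, n2, mul_one, norm_zpow] at n3
  have n4 : ‖(2 : ℚ_[2])‖ = 2⁻¹ := by
    have := Padic.norm_p (p := 2)
    simpa using this
  rw [n4] at n3
  have he : e = 0 := by
    by_contra hne
    have := zpow_eq_one_iff_right₀ (a := (2⁻¹ : ℝ)) (by norm_num) (by norm_num) (n := e)
    exact hne (this.1 n3.symm)
  rw [he, zpow_zero, one_mul, e1] at h
  have h2 : (1 + 2 * u : ℤ_[2]) = 1 + 2 * (2 ^ t * z) := Subtype.ext h
  exact ⟨z, by linear_combination h2⟩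

lemma neg_one_U : ¬ U 2 (-1 : ℚ_[2]) := by
  intro h
  have e : (-1 : ℚ_[2]) = ((1 + 2 * (-1) : ℤ_[2]) : ℚ_[2]) := by push_cast; rw [coe_two]; norm_num
  rw [e] at h
  obtain ⟨z, hz⟩ := U_odd (t := 1) h
  exact odd_ne_two_mul (a := -1) (b := z) (mul_left_cancel₀ (two_ne_zero (α := ℤ_[2])) (by linear_combination hz))

lemma pow_five (w : ℤ_[2]) (i : ℕ) : ∃ y : ℤ_[2], (5 + 8 * w) ^ 2 ^ i = 1 + 2 ^ (i + 2) * (1 + 2 * y) := by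
  induction i with
  | zero => exact ⟨w, by ring⟩
  | succ i ih =>
    obtain ⟨y, hy⟩ := ih
    refine ⟨y + 2 ^ i * (1 + 2 * y) ^ 2, ?_⟩
    rw [pow_succ 2 i, pow_mul, hy]; ring

lemma five_U (w : ℤ_[2]) (i : ℕ) : ¬ U (i + 3) (((5 + 8 * w) ^ 2 ^ i : ℤ_[2]) : ℚ_[2]) := by
  intro h
  obtain ⟨y, hy⟩ := pow_five w i
  rw [hy, show (1 + 2 ^ (i + 2) * (1 + 2 * y) : ℤ_[2]) = 1 + 2 * (2 ^ (i + 1) * (1 + 2 * y)) by ring] at h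
  obtain ⟨z, hz⟩ := U_odd (t := i + 2) h
  have : (2 : ℤ_[2]) ^ (i + 2) ≠ 0 := pow_ne_zero _ two_ne_zero
  exact odd_ne_two_mul (a := y) (b := z) (mul_left_cancel₀ this (by linear_combination hz))

lemma neg_five_U (w : ℤ_[2]) : ¬ U 3 ((-(5 + 8 * w) : ℤ_[2]) : ℚ_[2]) := by
  intro h
  rw [show (-(5 + 8 * w) : ℤ_[2]) = 1 + 2 * (-3 - 4 * w) by ring] at h
  obtain ⟨z, hz⟩ := U_odd (t := 2) h
  exact odd_ne_two_mul (a := -2 - 2 * w) (b := 2 * z) (mul_left_cancel₀ (two_ne_zero (α := ℤ_[2])) (by linear_combination hz))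

lemma sq_neg {x y : ℚ_[2]} (hy : y ≠ 0) (h : x ^ 2 = -y ^ 2) : False := by
  have hx : x ≠ 0 := by
    rintro rfl
    have : y ^ 2 = 0 := by linear_combination h
    exact hy (pow_eq_zero_iff two_ne_zero |>.1 this)
  apply neg_one_U
  have h1 : (-1 : ℚ_[2]) = x ^ 2 * (y ^ 2)⁻¹ := by
    rw [h, neg_mul, mul_inv_cancel₀ (pow_ne_zero 2 hy)]
  rw [h1]
  exact U_mul (U_sq le_rfl (U_one hx)) (U_inv (by norm_num) (U_sq le_rfl (U_one hy)))

variable {k : IntermediateField ℚ ℂ}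

lemma phi_int (φ : k →+* ℚ_[2]) {x : k} (h : IsIntegral ℤ x) : ∃ z : ℤ_[2], φ x = z := by
  have h1 : IsIntegral ℤ (φ x) := map_isIntegral_int φ h
  have h2 : IsIntegral ℤ_[2] (φ x) := h1.tower_top
  obtain ⟨z, hz⟩ := IsIntegrallyClosed.isIntegral_iff.1 h2
  exact ⟨z, hz.symm⟩

/-- build an algebraic integer -/
def mkO {F : IntermediateField ℚ ℂ} (x : ℂ) (hx : x ∈ F) (h : IsIntegral ℤ x) : 𝓞 F := ⟨⟨x, hx⟩, int_coe.2 h⟩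

lemma mkO_coe {F : IntermediateField ℚ ℂ} (x : ℂ) (hx : x ∈ F) (h : IsIntegral ℤ x) : (((mkO x hx h : 𝓞 F) : F) : ℂ) = x := rfl

lemma O_ext {F : IntermediateField ℚ ℂ} {x y : 𝓞 F} (h : ((x : F) : ℂ) = ((y : F) : ℂ)) : x = y :=
  RingOfIntegers.ext (Subtype.ext h)

lemma O_int {F : IntermediateField ℚ ℂ} (x : 𝓞 F) : IsIntegral ℤ ((x : F) : ℂ) := int_coe.1 x.2

/-- `1 - ζ` -/
noncomputable def lamO (k : IntermediateField ℚ ℂ) (j : ℕ) : 𝓞 (KK k j) :=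
  1 - mkO (zt j) (zt_mem j) (zt_integralZ j)

lemma lamO_coe (j : ℕ) : ((lamO k j : KK k j) : ℂ) = 1 - zt j := rfl

lemma ztO_pow (j : ℕ) : (mkO (zt j) (zt_mem j) (zt_integralZ j) : 𝓞 (KK k j)) ^ 2 ^ j = -1 := by
  apply O_ext
  have := zt_pow j
  push_cast
  exact this

lemma lam_gen1 {S : Type*} [CommRing S] (j : ℕ) : ∀ z : S, z ^ 2 ^ j = -1 → (1 - z) ^ 2 ^ j ∣ 2 := by
  induction j with
  | zero =>
    intro z hz
    rw [pow_zero, pow_one] at hz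
    rw [hz]; norm_num
  | succ j ih =>
    intro z hz
    have h1 := ih (z ^ 2) (by rw [← pow_mul, ← pow_succ', hz])
    have h2 : (1 - z) ∣ 1 + z := by
      have : 1 + z = 1 ^ (2 ^ (j + 1) + 1) - z ^ (2 ^ (j + 1) + 1) := by
        rw [one_pow, pow_succ, hz]; ring
      rw [this]
      exact sub_dvd_pow_sub_pow 1 z _
    have h3 : (1 - z) ^ 2 ∣ 1 - z ^ 2 := by
      obtain ⟨c, hc⟩ := h2
      exact ⟨c, by linear_combination (1 - z) * hc⟩
    rw [pow_succ', pow_mul]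
    exact (pow_dvd_pow_of_dvd h3 _).trans h1

lemma lam_gen2 {S : Type*} [CommRing S] (j : ℕ) (z : S) : ∃ c, (1 - z) ^ 2 ^ j = 1 + z ^ 2 ^ j + 2 * c := by
  induction j with
  | zero => exact ⟨-z, by ring⟩
  | succ j ih =>
    obtain ⟨c, hc⟩ := ih
    refine ⟨z ^ 2 ^ j + 2 * c * (1 + z ^ 2 ^ j) + 2 * c ^ 2, ?_⟩
    rw [pow_succ, pow_mul, hc, pow_mul]; ring

lemma lam_dvd (j : ℕ) : lamO k j ^ 2 ^ j ∣ 2 := lam_gen1 j _ (ztO_pow j)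

lemma lam_dvd1 (j : ℕ) : lamO k j ∣ 2 := (dvd_pow_self _ (by positivity)).trans (lam_dvd j)

lemma dvd_lam (j : ℕ) : 2 ∣ lamO k j ^ 2 ^ j := by
  obtain ⟨c, hc⟩ := lam_gen2 j (mkO (zt j) (zt_mem j) (zt_integralZ j) : 𝓞 (KK k j))
  rw [ztO_pow] at hc
  exact ⟨c, by rw [lamO, hc]; ring⟩

namespace Base

variable (B : Base k) (j : ℕ)

lemma finDimk (B : Base k) : FiniteDimensional ℚ k := FiniteDimensional.of_finrank_pos (by rw [B.hfin]; norm_num)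

lemma finDim (B : Base k) : FiniteDimensional ℚ (KK k j) := by
  have := B.finDimk
  have h2 : FiniteDimensional k (adjoin k {zt j}) := adjoin.finiteDimensional (zt_integral j)
  have : FiniteDimensional ℚ (adjoin k {zt j}) := FiniteDimensional.trans ℚ k _
  exact this

lemma finrk (B : Base k) : Module.finrank ℚ (KK k j) = 2 * 2 ^ j := by
  have h1 : Module.finrank ℚ k * Module.finrank k (adjoin k {zt j}) = Module.finrank ℚ (adjoin k {zt j}) :=
    Module.finrank_mul_finrank ℚ k _
  have h2 : Module.finrank k (adjoin k {zt j}) = 2 ^ j := by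
    rw [adjoin.finrank (zt_integral j), zt_minpoly B.φ, ← C_1, natDegree_X_pow_add_C]
  rw [h2, B.hfin] at h1
  exact h1.symm

lemma nf (B : Base k) : NumberField (KK k j) where
  to_charZero := inferInstance
  to_finiteDimensional := B.finDim j

lemma tc (B : Base k) : IsTotallyComplex (KK k j) where
  isComplex := by
    intro w
    rw [← InfinitePlace.not_isReal_iff_isComplex, InfinitePlace.isReal_iff, ComplexEmbedding.isReal_iff]
    intro h
    set e : KK k j := ⟨B.δ, k_le j B.δ.2⟩ with he
    have h1 : e ^ 2 = -(B.d : KK k j) := by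
      apply Subtype.ext
      have := congrArg (fun z : k => (z : ℂ)) B.hδ
      push_cast at this ⊢
      exact this
    set z := w.embedding e with hz
    have h2 : z ^ 2 = -(B.d : ℂ) := by rw [hz, ← map_pow, h1, map_neg, map_natCast]
    have h3 : (starRingEnd ℂ) z = z := by
      have := RingHom.congr_fun h e
      rwa [ComplexEmbedding.conjugate_coe_eq] at this
    obtain ⟨r, hr⟩ := Complex.conj_eq_iff_real.1 h3
    rw [hr] at h2
    have h4 : r ^ 2 = -(B.d : ℝ) := by exact_mod_cast h2
    have h5 : (0 : ℝ) < B.d := by exact_mod_cast B.hd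
    nlinarith [sq_nonneg r]

/-- `α` as an integer of `KK k j` -/
noncomputable def aO : 𝓞 (KK k j) := mkO B.α (k_le j B.α.2) (int_coe.1 B.ia)

/-- `α'` as an integer of `KK k j` -/
noncomputable def aO' : 𝓞 (KK k j) := mkO B.α' (k_le j B.α'.2) (int_coe.1 B.ia')

lemma aO_add : B.aO j + B.aO' j = (B.t : 𝓞 (KK k j)) := by
  apply O_ext
  have := congrArg (fun z : k => (z : ℂ)) B.hadd
  push_cast at this ⊢
  exact this

lemma aO_mul : B.aO j * B.aO' j = 2 ^ (8 * B.m) := by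
  apply O_ext
  have := congrArg (fun z : k => (z : ℂ)) B.hmul
  push_cast at this ⊢
  exact this

/-- the prime above 2 -/
noncomputable def P : Ideal (𝓞 (KK k j)) := Ideal.span {lamO k j, B.aO j}

/-- the other prime above 2 -/
noncomputable def P' : Ideal (𝓞 (KK k j)) := Ideal.span {lamO k j, B.aO' j}

lemma mpos : 0 < B.m := B.hm.pos

lemma mulP : B.P j * B.P' j = Ideal.span {lamO k j} := by
  obtain ⟨c, hc⟩ := lam_dvd1 (k := k) j
  obtain ⟨s, hs⟩ := B.ht
  have hadd := B.aO_add j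
  have hmul := B.aO_mul j
  rw [P, P', Ideal.span_pair_mul_span_pair]
  apply le_antisymm
  · rw [Ideal.span_le]
    intro x hx
    simp only [Set.mem_insert_iff, Set.mem_singleton_iff] at hx
    rw [SetLike.mem_coe, Ideal.mem_span_singleton]
    rcases hx with rfl | rfl | rfl | rfl
    · exact dvd_mul_right _ _
    · exact dvd_mul_right _ _
    · exact dvd_mul_left _ _
    · rw [hmul]
      exact (lam_dvd1 j).trans (dvd_pow_self _ (by have := B.mpos; omega))
  · rw [Ideal.span_singleton_le_iff_mem]
    have e : lamO k j = (-(c * s)) * (lamO k j * lamO k j) + 1 * (lamO k j * B.aO' j) + 1 * (B.aO j * lamO k j) := by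
      rw [hs] at hadd
      push_cast at hadd
      linear_combination (-lamO k j) * hadd + (-lamO k j * s) * hc
    refine Eq.mpr (congrArg (fun y => y ∈ Ideal.span {lamO k j * lamO k j, lamO k j * B.aO' j, B.aO j * lamO k j, B.aO j * B.aO' j}) e) ?_
    refine Ideal.add_mem _ (Ideal.add_mem _ ?_ ?_) ?_ <;> apply Ideal.mul_mem_left <;> apply Ideal.subset_span <;> simp

lemma lam_ne : lamO k j ≠ 0 := by
  intro h
  have := dvd_lam (k := k) j
  have h2 := lam_dvd1 (k := k) j
  rw [h, zero_dvd_iff] at h2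
  exact two_ne_zero h2

lemma aO_nd : ¬ lamO k j ∣ B.aO j := by
  rintro ⟨y, hy⟩
  have h1 : nrm (B.aO j : KK k j) = nrm (lamO k j : KK k j) * nrm (y : KK k j) := by
    rw [← nrm_mul B.φ, hy]; rfl
  rw [nrm_k B.φ (a := B.α) rfl, nrm_lam B.φ (lamO_coe j)] at h1
  have h2 := congrArg B.φ h1
  obtain ⟨z, hz⟩ := phi_int B.φ (int_coe.2 (nrm_int B.φ (O_int y)))
  rw [map_pow, map_mul, map_ofNat, hz, B.hw] at h2
  have h3 : ((5 + 8 * B.w) ^ 2 ^ j : ℤ_[2]) = 2 * z := by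
    have : (((5 + 8 * B.w) ^ 2 ^ j : ℤ_[2]) : ℚ_[2]) = ((2 * z : ℤ_[2]) : ℚ_[2]) := by
      push_cast; rw [coe_two]; exact_mod_cast h2
    exact Subtype.ext this
  obtain ⟨y, hy⟩ := pow_five B.w j
  rw [hy] at h3
  exact odd_ne_two_mul (a := 2 ^ (j + 1) * (1 + 2 * y)) (b := z) (by linear_combination h3)

lemma aO'_nd : ¬ lamO k j ∣ B.aO' j := by
  rintro ⟨y, hy⟩
  have h1 : nrm (B.aO' j : KK k j) = nrm (lamO k j : KK k j) * nrm (y : KK k j) := by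
    rw [← nrm_mul B.φ, hy]; rfl
  rw [nrm_k B.φ (a := B.α') rfl, nrm_lam B.φ (lamO_coe j)] at h1
  have h2 := congrArg B.φ' h1
  obtain ⟨z, hz⟩ := phi_int B.φ' (int_coe.2 (nrm_int B.φ (O_int y)))
  rw [map_pow, map_mul, map_ofNat, hz, B.hw'] at h2
  have h3 : ((5 + 8 * B.w') ^ 2 ^ j : ℤ_[2]) = 2 * z := by
    have : (((5 + 8 * B.w') ^ 2 ^ j : ℤ_[2]) : ℚ_[2]) = ((2 * z : ℤ_[2]) : ℚ_[2]) := by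
      push_cast; rw [coe_two]; exact_mod_cast h2
    exact Subtype.ext this
  obtain ⟨y, hy⟩ := pow_five B.w' j
  rw [hy] at h3
  exact odd_ne_two_mul (a := 2 ^ (j + 1) * (1 + 2 * y)) (b := z) (by linear_combination h3)

lemma P_ne_top : B.P j ≠ ⊤ := by
  intro h
  have h1 := B.mulP j
  rw [h, Ideal.top_mul] at h1
  apply B.aO'_nd j
  rw [← Ideal.mem_span_singleton, ← h1]
  exact Ideal.subset_span (by simp)

lemma P'_ne_top : B.P' j ≠ ⊤ := by
  intro h
  have h1 := B.mulP j
  rw [h, Ideal.mul_top] at h1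
  apply B.aO_nd j
  rw [← Ideal.mem_span_singleton, ← h1]
  exact Ideal.subset_span (by simp)

end Base

/-- prime pair lemma -/
lemma prime_pair {K : Type*} [Field K] [NumberField K] {P P' : Ideal (𝓞 K)} {l : 𝓞 K} (h : P * P' = Ideal.span {l})
    (hn : Ideal.absNorm (Ideal.span {l}) = 4) (h1 : P ≠ ⊤) (h2 : P' ≠ ⊤) : P.IsPrime ∧ P'.IsPrime := by
  rw [← h, map_mul] at hn
  have a1 : Ideal.absNorm P ≠ 1 := fun e => h1 (Ideal.absNorm_eq_one_iff.1 e)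
  have a2 : Ideal.absNorm P' ≠ 1 := fun e => h2 (Ideal.absNorm_eq_one_iff.1 e)
  have a3 : Ideal.absNorm P = 2 ∧ Ideal.absNorm P' = 2 := by
    generalize Ideal.absNorm P = x at *
    generalize Ideal.absNorm P' = y at *
    have hx : x ∣ 4 := ⟨y, hn.symm⟩
    have hx4 : x ≤ 4 := Nat.le_of_dvd (by norm_num) hx
    interval_cases x <;> omega
  constructor
  · apply Ideal.isPrime_of_irreducible_absNorm
    rw [a3.1]; exact Nat.prime_two
  · apply Ideal.isPrime_of_irreducible_absNorm
    rw [a3.2]; exact Nat.prime_two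

lemma absNorm_two (K : Type*) [Field K] [NumberField K] : Ideal.absNorm (Ideal.span {(2 : 𝓞 K)}) = 2 ^ Module.finrank ℚ K := by
  rw [Ideal.absNorm_span_singleton]
  have : (2 : 𝓞 K) = algebraMap ℤ (𝓞 K) 2 := by simp
  rw [this, Algebra.norm_algebraMap, RingOfIntegers.rank, Int.natAbs_pow]; rfl

namespace Base

variable (B : Base k) (j : ℕ)

lemma primes : (B.P j).IsPrime ∧ (B.P' j).IsPrime := by
  have := B.nf j
  apply prime_pair (B.mulP j) _ (B.P_ne_top j) (B.P'_ne_top j)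
  have h1 : Ideal.span {lamO k j} ^ 2 ^ j = Ideal.span {(2 : 𝓞 (KK k j))} := by
    rw [Ideal.span_singleton_pow]
    apply le_antisymm
    · rw [Ideal.span_singleton_le_span_singleton]; exact dvd_lam j
    · rw [Ideal.span_singleton_le_span_singleton]; exact lam_dvd j
  have h2 := congrArg Ideal.absNorm h1
  rw [map_pow, absNorm_two, B.finrk, pow_mul] at h2
  exact Nat.pow_left_injective (n := 2 ^ j) (by have : 0 < 2 ^ j := by positivity
                                                omega) h2

/-- localisation data -/
noncomputable def loc [NumberField (KK k j)] : LocD (𝓞 (KK k j)) (RR (KK k j)) where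
  i := toRR _
  inj := toRR_inj
  h2 := two_unit_RR
  surj := toRR_surj
  P := B.P j
  P' := B.P' j
  hP := (B.primes j).1
  hP' := (B.primes j).2
  P0 := fun h => lam_ne j (by
    have : lamO k j ∈ B.P j := Ideal.subset_span (by simp)
    rwa [h] at this)
  P0' := fun h => lam_ne j (by
    have : lamO k j ∈ B.P' j := Ideal.subset_span (by simp)
    rwa [h] at this)
  lam := lamO k j
  mulP := B.mulP j
  l2 := lam_dvd1 j
  N := 2 ^ j
  l2' := dvd_lam j

end Base

end TwoG

end SecPrimes

section SecSqPrincipal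

open Polynomial IntermediateField NumberField

namespace TwoG

lemma fg_of_gen {H : Type*} [CommGroup H] {ι : Type*} [Fintype ι] (f : ι → H)
    (hf : ∀ x : H, ∃ e : ι → ℤ, x = ∏ i, f i ^ e i) : Group.FG H := by
  rw [Group.fg_iff]
  refine ⟨Set.range f, ?_, Set.finite_range f⟩
  rw [eq_top_iff]
  intro x _
  obtain ⟨e, rfl⟩ := hf x
  exact Subgroup.prod_mem _ fun i _ => Subgroup.zpow_mem _ (Subgroup.subset_closure (Set.mem_range_self i)) _

namespace Base

variable {k : IntermediateField ℚ ℂ} (B : Base k) (j : ℕ)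

lemma unitsR (B : Base k) : ∃ F : Option (Option (Option (Fin (2 ^ j - 1)))) → (RR (KK k j))ˣ,
    ∀ x, ∃ e : Option (Option (Option (Fin (2 ^ j - 1)))) → ℤ, x = ∏ i, F i ^ e i := by
  have := B.nf j
  have := B.tc j
  have h1 := rank_cx (K := KK k j) (B.finrk j)
  have h2 : Units.rank (KK k j) = 2 ^ j - 1 := by omega
  have h3 := units_gen (K := KK k j)
  rw [h2] at h3
  obtain ⟨f, hf⟩ := h3
  exact (B.loc j).units_gen f hf

lemma idx (B : Base k) : (QExt.sqH (RR (KK k j))ˣ).index ≤ 2 ^ (2 ^ j + 2) := by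
  obtain ⟨F, hF⟩ := B.unitsR j
  have := sq_index_le F hF
  rw [Fintype.card_option, Fintype.card_option, Fintype.card_option, Fintype.card_fin] at this
  have h : 0 < 2 ^ j := by positivity
  have e : 2 ^ j - 1 + 1 + 1 + 1 = 2 ^ j + 2 := by omega
  rwa [e] at this

lemma fgR (B : Base k) : Group.FG (RR (KK k j))ˣ := by
  obtain ⟨F, hF⟩ := B.unitsR j
  exact fg_of_gen F hF

/-- units of the ring of integers into units of `RR` -/
noncomputable def uR (F : IntermediateField ℚ ℂ) : (𝓞 F)ˣ →* (RR F)ˣ := Units.map (toRR F : 𝓞 F →* RR F)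

lemma uR_coe {F : IntermediateField ℚ ℂ} (x : (𝓞 F)ˣ) : (((uR F x : (RR F)ˣ) : RR F) : ℂ) = (((x : 𝓞 F) : F) : ℂ) := rfl

lemma uR_inj (F : IntermediateField ℚ ℂ) : Function.Injective (uR F) := fun x y h => by
  apply Units.ext
  apply O_ext
  rw [← uR_coe, h, uR_coe]

lemma fgO (B : Base k) : Group.FG (𝓞 (KK k j))ˣ := by
  have := B.nf j
  obtain ⟨f, hf⟩ := units_gen (K := KK k j)
  exact fg_of_gen f hf

lemma nm_unit (x : (𝓞 (KK k (j + 1)))ˣ) : ∃ y, (EE B.φ j).nmU (uR _ x) = uR (KK k j) y := by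
  have key : ∀ z : 𝓞 (KK k (j + 1)), IsIntegral ℤ ((z : KK k (j + 1)) * sg B.φ j z : ℂ) :=
    fun z => (O_int z).mul (sg_int B.φ (O_int z))
  set a : 𝓞 (KK k j) := mkO _ (sg_mul_mem B.φ ((x : 𝓞 (KK k (j + 1))) : KK k (j + 1))) (key _) with ha
  set b : 𝓞 (KK k j) := mkO _ (sg_mul_mem B.φ ((x⁻¹ : (𝓞 (KK k (j + 1)))ˣ) : 𝓞 (KK k (j + 1)))) (key _) with hb
  have hx : (((x : 𝓞 (KK k (j + 1))) : KK k (j + 1))) * (((x⁻¹ : (𝓞 (KK k (j + 1)))ˣ) : 𝓞 (KK k (j + 1))) : KK k (j + 1)) = 1 := by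
    rw [← map_mul, Units.mul_inv, map_one]
  have hab : a * b = 1 := by
    apply O_ext
    have e1 : (((a * b : 𝓞 (KK k j)) : KK k j) : ℂ) = ((a : KK k j) : ℂ) * ((b : KK k j) : ℂ) := rfl
    have e2 : (((1 : 𝓞 (KK k j)) : KK k j) : ℂ) = 1 := rfl
    rw [e1, e2, ha, hb, mkO_coe, mkO_coe]
    have h1 := congrArg (fun z : KK k (j + 1) => (z : ℂ)) hx
    have h2 := congrArg (fun z : KK k (j + 1) => (sg B.φ j z : ℂ)) hx
    simp only [map_mul, map_one, MulMemClass.coe_mul, OneMemClass.coe_one] at h1 h2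
    rw [mul_mul_mul_comm, h1, h2]; simp
  refine ⟨⟨a, b, hab, by rw [mul_comm, hab]⟩, ?_⟩
  apply Units.ext
  apply (EE B.φ j).inj
  rw [QExt.nmU_spec, EE_ι, EE_σ]
  apply Subtype.ext
  rw [incR_coe, Subring.coe_mul, sgR_coe, uR_coe (F := KK k j)]
  rfl

lemma idxL : 2 ^ (2 ^ j + 1) ≤ (QExt.sqH (EE B.φ j).nmU.ker).index := by
  have i1 := B.fgO j
  have i2 := B.fgO (j + 1)
  have i3 := B.fgR (j + 1)
  have i4 := fg_sub (EE B.φ j).nmU.ker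
  have h := rank_lower (uR (KK k j)) (uR (KK k (j + 1))) (uR_inj _) (EE B.φ j).nmU (B.nm_unit j)
  have r1 : Module.finrank ℤ (Additive (𝓞 (KK k j))ˣ) + 1 = 2 ^ j := by
    have := B.nf j
    have := B.tc j
    rw [Units.finrank_eq]
    exact rank_cx (K := KK k j) (B.finrk j)
  have r2 : Module.finrank ℤ (Additive (𝓞 (KK k (j + 1)))ˣ) + 1 = 2 ^ (j + 1) := by
    have := B.nf (j + 1)
    have := B.tc (j + 1)
    rw [Units.finrank_eq]
    exact rank_cx (K := KK k (j + 1)) (B.finrk (j + 1))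
  rw [pow_succ] at r2
  have hm : (-1 : (RR (KK k (j + 1)))ˣ) ∈ (EE B.φ j).nmU.ker := by
    rw [QExt.mem_ker]
    apply Units.ext
    rw [Units.val_mul, QExt.sigU_spec]
    simp
  refine sq_index_ge _ _ (by omega) ⟨-1, hm⟩ ?_ ?_
  · intro e
    have e1 : (-1 : (RR (KK k (j + 1)))ˣ) = 1 := congrArg Subtype.val e
    have e2 := congrArg (fun z : (RR (KK k (j + 1)))ˣ => ((z : RR (KK k (j + 1))) : ℂ)) e1
    simp only [Units.val_neg, Units.val_one, Subring.coe_neg, Subring.coe_one] at e2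
    norm_num at e2
  · apply Subtype.ext
    change (-1 : (RR (KK k (j + 1)))ˣ) ^ 2 = 1
    rw [neg_one_sq]

lemma a_ne : B.α ≠ 0 := by
  intro h
  have := B.hmul
  rw [h, zero_mul] at this
  exact pow_ne_zero _ two_ne_zero this.symm

lemma nrm_unit (B : Base k) {x : KK k j} (h0 : x ≠ 0) (h1 : IsIntegral ℤ x) (h2 : IsIntegral ℤ x⁻¹) : nrm x = 1 ∨ nrm x = -1 := by
  have hn := nrm_ne B.φ h0
  have e : nrm x * nrm x⁻¹ = 1 := by rw [← nrm_mul B.φ, mul_inv_cancel₀ h0, nrm_one B.φ]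
  have e2 : (nrm x)⁻¹ = nrm x⁻¹ := inv_eq_of_mul_eq_one_right e
  apply B.hunit _ (int_coe.2 (nrm_int B.φ (int_coe.1 h1))) _ hn
  rw [e2]
  exact int_coe.2 (nrm_int B.φ (int_coe.1 h2))

lemma nrm_g1 : nrm B.g = B.α ∨ nrm B.g = -B.α := by
  have h : B.g ^ 2 = ⟨B.α, k_le 1 B.α.2⟩ * B.v := Subtype.ext B.hg
  have h1 := congrArg nrm h
  rw [nrm_pow B.φ, nrm_mul B.φ, nrm_k B.φ (x := ⟨B.α, k_le 1 B.α.2⟩) (a := B.α) rfl] at h1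
  rcases B.nrm_unit 1 B.hv0 B.iv B.iv' with e | e
  · rw [e] at h1
    apply sq_eq_sq_iff_eq_or_eq_neg.1
    rw [h1]; ring
  · rw [e] at h1
    exfalso
    apply sq_neg (x := B.φ (nrm B.g)) (y := B.φ B.α) ((_root_.map_ne_zero _).2 B.a_ne)
    rw [← map_pow, h1]; simp

lemma nrm_g {i : ℕ} (hi : (B.g : ℂ) ∈ KK k (i + 1)) : nrm ⟨(B.g : ℂ), hi⟩ = (nrm B.g) ^ 2 ^ i := by
  induction i with
  | zero => rw [pow_zero, pow_one]
  | succ i ih =>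
    have hi' : (B.g : ℂ) ∈ KK k (i + 1) := by
      clear ih hi
      induction i with
      | zero => exact B.g.2
      | succ i ih => exact KK_le _ ih
    rw [nrm_up B.φ (x := ⟨(B.g : ℂ), hi'⟩) rfl, ih hi', ← pow_mul, pow_succ]

lemma g_mem (i : ℕ) : (B.g : ℂ) ∈ KK k (i + 1) := by
  induction i with
  | zero => exact B.g.2
  | succ i ih => exact KK_le _ ih

lemma v_mem (i : ℕ) : (B.v : ℂ) ∈ KK k (i + 1) := by
  induction i with
  | zero => exact B.v.2
  | succ i ih => exact KK_le _ ih

lemma g_int : IsIntegral ℤ (B.g : ℂ) := by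
  apply IsIntegral.of_pow (n := 2) two_pos
  rw [B.hg]
  exact (int_coe.1 B.ia).mul (int_coe.1 B.iv)

lemma vinv_int : IsIntegral ℤ ((B.v : ℂ)⁻¹) := by
  have := int_coe.1 B.iv'
  exact this

/-- `g` as a unit -/
noncomputable def gU (i : ℕ) : (RR (KK k (i + 1)))ˣ :=
  Units.mkOfMulEqOne ⟨(B.g : ℂ), RR_int (B.g_mem i) B.g_int⟩
    (⟨(B.g : ℂ), RR_int (B.g_mem i) B.g_int⟩ * ⟨(B.v : ℂ)⁻¹, RR_int (inv_mem (B.v_mem i)) B.vinv_int⟩ *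
      ⟨(B.α' : ℂ), RR_int (k_le _ B.α'.2) (int_coe.1 B.ia')⟩ * ⟨2⁻¹, half_mem⟩ ^ (8 * B.m)) (Subtype.ext (by
    rw [Subring.coe_mul, Subring.coe_mul, Subring.coe_mul, Subring.coe_mul, Subring.coe_pow, Subring.coe_one]
    have hv : (B.v : ℂ) ≠ 0 := fun e => B.hv0 (Subtype.ext e)
    have hm := congrArg (fun z : k => (z : ℂ)) B.hmul
    have hm : (B.α : ℂ) * B.α' = 2 ^ (8 * B.m) := hm
    have e : (B.g : ℂ) * (B.g * (B.v : ℂ)⁻¹ * B.α' * 2⁻¹ ^ (8 * B.m)) = (B.g : ℂ) ^ 2 * (B.v : ℂ)⁻¹ * B.α' * 2⁻¹ ^ (8 * B.m) := by ring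
    rw [e, B.hg, mul_inv_cancel_right₀ hv, hm, inv_pow, mul_inv_cancel₀ (pow_ne_zero _ two_ne_zero)]))

lemma gU_coe (i : ℕ) : ((B.gU i : RR (KK k (i + 1))) : ℂ) = B.g := rfl

lemma s0 (B : Base k) : ∃ s : (RR (KK k j))ˣ, ¬ U (j + 2) (B.φ (nrm ⟨((s : RR (KK k j)) : ℂ), (s : RR (KK k j)).2.1⟩)) := by
  rcases j with _ | i
  · refine ⟨-1, ?_⟩
    rw [nrm_k B.φ (a := -1) (by push_cast; rfl)]
    rw [pow_zero, pow_one, map_neg, map_one]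
    exact neg_one_U
  · refine ⟨B.gU i, ?_⟩
    have e : nrm (⟨((B.gU i : RR (KK k (i + 1))) : ℂ), (B.gU i : RR (KK k (i + 1))).2.1⟩ : KK k (i + 1)) = (nrm B.g) ^ 2 ^ i := B.nrm_g _
    rw [e]
    rcases B.nrm_g1 with h | h
    · rw [h, map_pow, B.hw]
      have := five_U B.w i
      intro h2
      apply this
      have e3 : ((5 + 8 * B.w : ℤ_[2]) : ℚ_[2]) = 5 + 8 * (B.w : ℚ_[2]) := by push_cast; rfl
      rw [PadicInt.coe_pow, e3]
      exact h2
    · rcases i with _ | i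
      · rw [h, pow_zero, pow_one, map_neg, B.hw]
        have := neg_five_U B.w
        intro h2
        apply this
        have e3 : ((-(5 + 8 * B.w) : ℤ_[2]) : ℚ_[2]) = -(5 + 8 * (B.w : ℚ_[2])) := by push_cast; rfl
        rw [e3]
        exact h2
      · rw [h, Even.neg_pow (by rw [pow_succ]; exact Even.mul_left even_two _), map_pow, B.hw]
        have := five_U B.w (i + 1)
        intro h2
        apply this
        have e3 : ((5 + 8 * B.w : ℤ_[2]) : ℚ_[2]) = 5 + 8 * (B.w : ℚ_[2]) := by push_cast; rfl
        rw [PadicInt.coe_pow, e3]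
        exact h2

theorem sqPrin (B : Base k) (h0 : SqPrin (RR (KK k 0))) : SqPrin (RR (KK k j)) := by
  induction j with
  | zero => exact h0
  | succ j ih =>
    obtain ⟨s, hs⟩ := B.s0 j
    have := B.fgR j
    refine (EE B.φ j).step ih (2 ^ j) (sq_index_ne_zero _) (B.idx j) (B.idxL j) s ?_
    intro x c hc
    exact nonnorm B.φ j s s.ne_zero hs x c hc

end Base

end TwoG

end SecSqPrincipal

section SecFinal

open Polynomial IntermediateField NumberField

namespace TwoG

lemma one_add_pow2 (t : ℕ) (y : ℤ_[2]) (r : ℕ) : ∃ y', (1 + 2 ^ (t + 1) * y) ^ 2 ^ r = 1 + 2 ^ (t + 1 + r) * y' := by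
  induction r with
  | zero => exact ⟨y, by ring⟩
  | succ r ih =>
    obtain ⟨a, ha⟩ := ih
    refine ⟨a + 2 ^ (t + r) * a ^ 2, ?_⟩
    rw [pow_succ 2 r, pow_mul, ha]; ring

lemma one_add_pow (t : ℕ) (y : ℤ_[2]) (r : ℕ) : ∃ y', (1 + 2 ^ t * y) ^ r = 1 + 2 ^ t * y' := by
  induction r with
  | zero => exact ⟨0, by ring⟩
  | succ r ih =>
    obtain ⟨a, ha⟩ := ih
    refine ⟨a + y + 2 ^ t * a * y, ?_⟩
    rw [pow_succ, ha]; ring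

lemma odd_pow_form (t : ℕ) (y : ℤ_[2]) (l : ℕ) :
    ∃ y', (1 + 2 ^ (t + 1) * (1 + 2 * y)) ^ (2 * l + 1) = 1 + 2 ^ (t + 1) * (1 + 2 * y') := by
  obtain ⟨a, ha⟩ := one_add_pow2 t (1 + 2 * y) 1
  rw [pow_one] at ha
  obtain ⟨b, hb⟩ := one_add_pow (t + 1 + 1) a l
  refine ⟨y + b + 2 ^ (t + 1) * (1 + 2 * y) * b, ?_⟩
  rw [pow_add, pow_one, pow_mul, ha, hb]; ring

lemma adic_end {j m K : ℕ} (hj : 1 ≤ j) {z w : ℤ_[2]} (hm : m ≠ 0) (hU : U (j + 1) (z : ℚ_[2]))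
    (h : z ^ (2 ^ j * (8 * m)) = (5 + 8 * w) ^ (2 ^ j * K) ∨ z ^ (2 ^ j * (8 * m)) = -(5 + 8 * w) ^ (2 ^ j * K)) :
    2 ^ (j + 2) ∣ K := by
  rcases Nat.eq_zero_or_pos K with rfl | hK
  · exact dvd_zero _
  obtain ⟨s, K', hK', rfl⟩ := Nat.exists_eq_two_pow_mul_odd hK.ne'
  obtain ⟨l, rfl⟩ := hK'
  have hA : ∃ A, (5 + 8 * w) ^ (2 ^ j * (2 ^ s * (2 * l + 1))) = 1 + 2 ^ (j + s + 2) * (1 + 2 * A) := by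
    obtain ⟨y, hy⟩ := pow_five w (j + s)
    obtain ⟨y', hy'⟩ := odd_pow_form (j + s + 1) y l
    refine ⟨y', ?_⟩
    rw [← mul_assoc, ← pow_add, pow_mul, hy, hy']
  obtain ⟨A, hA⟩ := hA
  have hz : ¬ (2 : ℤ_[2]) ∣ z := by
    intro hd
    have hd2 : (2 : ℤ_[2]) ∣ z ^ (2 ^ j * (8 * m)) := hd.trans (dvd_pow_self _ (by positivity))
    obtain ⟨c, hc⟩ := hd2
    rcases h with h | h
    · exact odd_ne_two_mul (a := 2 ^ (j + s + 1) * (1 + 2 * A)) (b := c) (by rw [← hc, h, hA]; ring)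
    · exact odd_ne_two_mul (a := 2 ^ (j + s + 1) * (1 + 2 * A)) (b := -c) (by rw [mul_neg, ← hc, h, hA]; ring)
  obtain ⟨u, rfl⟩ := unit_odd hz
  obtain ⟨y, hy⟩ := U_odd hU
  have hB : ∃ C, (1 + 2 * u) ^ (2 ^ j * (8 * m)) = 1 + 2 ^ (2 * j + 4) * C := by
    obtain ⟨a, ha⟩ := one_add_pow2 j y (j + 3)
    obtain ⟨b, hb⟩ := one_add_pow (j + 1 + (j + 3)) a m
    refine ⟨b, ?_⟩
    rw [hy, show 2 ^ j * (8 * m) = 2 ^ (j + 3) * m by ring, pow_mul, ha, hb]; ring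
  obtain ⟨C, hC⟩ := hB
  rw [hC, hA] at h
  rcases h with h | h
  · by_contra hcon
    have hs : s < j + 2 := by
      by_contra hs
      exact hcon (Dvd.dvd.mul_right (pow_dvd_pow 2 (by omega)) _)
    obtain ⟨e, he⟩ : ∃ e, j + 2 = s + 1 + e := ⟨j + 2 - s - 1, by omega⟩
    have : (2 : ℤ_[2]) ^ (j + s + 2) ≠ 0 := pow_ne_zero _ two_ne_zero
    refine odd_ne_two_mul (a := A) (b := 2 ^ e * C) (mul_left_cancel₀ this ?_)
    have e2 : (2 : ℤ_[2]) ^ (2 * j + 4) = 2 ^ (j + s + 2) * (2 * 2 ^ e) := by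
      rw [show 2 * j + 4 = (j + s + 2) + (1 + e) by omega]; ring
    linear_combination -h + e2 * C
  · have h' : (2 : ℤ_[2]) * (1 + 2 ^ (2 * j + 3) * C + 2 ^ (j + s + 1) * (1 + 2 * A)) = 2 * 0 := by linear_combination h
    have h3 := mul_left_cancel₀ (two_ne_zero (α := ℤ_[2])) h'
    exfalso
    refine odd_ne_two_mul (a := 2 ^ (2 * j + 2) * C + 2 ^ (j + s) * (1 + 2 * A)) (b := 0) ?_
    linear_combination h3

/-- the group theoretic end -/
lemma grp_end {G : Type*} [CommGroup G] (c : G) (N m : ℕ) (hm : Odd m) (h1 : ∀ K : ℕ, c ^ K = 1 → 2 ^ N ∣ K)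
    (h2 : c ^ (2 ^ N * m) = 1) (h3 : ∀ x : G, x ^ 2 ∈ Subgroup.zpowers c → x ∈ Subgroup.zpowers c) :
    Nonempty (CommGroup.primaryComponent G 2 ≃* Multiplicative (ZMod (2 ^ N))) := by
  have hcop : ∀ r : ℕ, Nat.Coprime m (2 ^ r) := fun r => (Nat.coprime_two_right.2 hm).pow_right r
  have ho : orderOf (c ^ m) = 2 ^ N := by
    apply Nat.dvd_antisymm
    · rw [orderOf_dvd_iff_pow_eq_one, ← pow_mul, mul_comm, h2]
    · have := pow_orderOf_eq_one (c ^ m)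
      rw [← pow_mul] at this
      exact (hcop N).symm.dvd_of_dvd_mul_left (h1 _ this)
  have hP : CommGroup.primaryComponent G 2 = Subgroup.zpowers (c ^ m) := by
    apply le_antisymm
    · rintro x ⟨r, hr⟩
      have hx : ∀ r : ℕ, ∀ x : G, x ^ 2 ^ r ∈ Subgroup.zpowers c → x ∈ Subgroup.zpowers c := by
        intro r
        induction r with
        | zero => intro x hx; simpa using hx
        | succ r ih =>
          intro x hx
          apply h3
          apply ih
          rwa [← pow_mul, ← pow_succ']
      obtain ⟨a, rfl⟩ := hx r x (by rw [hr]; exact one_mem _)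
      simp only at hr
      have hb := Int.isCoprime_iff_gcd_eq_one.2 (show Int.gcd (m : ℤ) ((2 ^ r : ℕ) : ℤ) = 1 from hcop r)
      obtain ⟨e, f, hef⟩ := hb
      refine ⟨a * e, ?_⟩
      have h4 : c ^ a = (c ^ a) ^ (e * m + f * ((2 ^ r : ℕ) : ℤ)) := by rw [hef, zpow_one]
      have h5 : (c ^ a) ^ (f * ((2 ^ r : ℕ) : ℤ)) = 1 := by
        rw [mul_comm, zpow_mul, zpow_natCast, hr, one_zpow]
      rw [zpow_add, h5, mul_one] at h4
      refine Eq.trans ?_ h4.symm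
      simp only
      rw [← zpow_natCast, ← zpow_mul, ← zpow_mul]
      congr 1; ring
    · rw [Subgroup.zpowers_le]
      exact ⟨N, by rw [← pow_mul, mul_comm, h2]⟩
  rw [hP]
  have hc : Nat.card (Subgroup.zpowers (c ^ m)) = 2 ^ N := by rw [Nat.card_zpowers, ho]
  have f := zmodCyclicMulEquiv (G := Subgroup.zpowers (c ^ m)) inferInstance
  rw [hc] at f
  exact ⟨f.symm⟩

namespace Base

variable {k : IntermediateField ℚ ℂ} (B : Base k) (j : ℕ)

lemma P_ne : B.P j ≠ ⊥ := fun h => lam_ne (k := k) j (by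
    have : lamO k j ∈ B.P j := Ideal.subset_span (by simp)
    rwa [h] at this)

lemma cop_aux {O : Type} [CommRing O] {I J : Ideal O} {a b l : O} {t : ℤ} (ha : a ∈ I) (hb : b ∈ J) (hl : l ∈ J) (ht : Odd t)
    (hab : a + b = t) (h2 : l ∣ 2) : IsCoprime I J := by
  rw [Ideal.isCoprime_iff_exists]
  obtain ⟨s, rfl⟩ := ht
  obtain ⟨c, hc⟩ := h2
  refine ⟨a, ha, b - l * (c * s), sub_mem hb (J.mul_mem_right _ hl), ?_⟩
  push_cast at hab
  linear_combination hab + s * hc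

lemma two_P : Ideal.span {(2 : 𝓞 (KK k j))} = B.P j ^ 2 ^ j * B.P' j ^ 2 ^ j := by
  rw [← mul_pow, B.mulP, Ideal.span_singleton_pow]
  apply le_antisymm
  · rw [Ideal.span_singleton_le_span_singleton]; exact lam_dvd j
  · rw [Ideal.span_singleton_le_span_singleton]; exact dvd_lam j

lemma a_span : Ideal.span {B.aO j} = B.P j ^ (2 ^ j * (8 * B.m)) := by
  have := B.nf j
  have hmul : Ideal.span {B.aO j} * Ideal.span {B.aO' j} = B.P j ^ (2 ^ j * (8 * B.m)) * B.P' j ^ (2 ^ j * (8 * B.m)) := by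
    rw [Ideal.span_singleton_mul_span_singleton, B.aO_mul, ← Ideal.span_singleton_pow, B.two_P, mul_pow, ← pow_mul, ← pow_mul]
  have c1 : IsCoprime (Ideal.span {B.aO j}) (B.P' j) :=
    cop_aux (a := B.aO j) (b := B.aO' j) (l := lamO k j) (Ideal.mem_span_singleton_self _) (Ideal.subset_span (by simp))
      (Ideal.subset_span (by simp)) B.ht (B.aO_add j) (lam_dvd1 j)
  have c2 : IsCoprime (Ideal.span {B.aO' j}) (B.P j) :=
    cop_aux (a := B.aO' j) (b := B.aO j) (l := lamO k j) (Ideal.mem_span_singleton_self _) (Ideal.subset_span (by simp))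
      (Ideal.subset_span (by simp)) B.ht (by rw [add_comm]; exact B.aO_add j) (lam_dvd1 j)
  have d1 : Ideal.span {B.aO j} ∣ B.P j ^ (2 ^ j * (8 * B.m)) :=
    (c1.pow_right).dvd_of_dvd_mul_right (Dvd.intro _ hmul)
  have d2 : B.P j ^ (2 ^ j * (8 * B.m)) ∣ Ideal.span {B.aO j} :=
    (c2.pow_right (n := 2 ^ j * (8 * B.m))).symm.dvd_of_dvd_mul_right (Dvd.intro _ hmul.symm)
  exact le_antisymm (Ideal.dvd_iff_le.1 d2) (Ideal.dvd_iff_le.1 d1)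

lemma O_mul {F : IntermediateField ℚ ℂ} (x y : 𝓞 F) : (((x * y : 𝓞 F) : F) : ℂ) = ((x : F) : ℂ) * ((y : F) : ℂ) := rfl

lemma O_pow {F : IntermediateField ℚ ℂ} (x : 𝓞 F) (n : ℕ) : (((x ^ n : 𝓞 F) : F) : ℂ) = ((x : F) : ℂ) ^ n := by
  rw [RingOfIntegers.coe_eq_algebraMap, map_pow]; rfl

lemma O_one {F : IntermediateField ℚ ℂ} : (((1 : 𝓞 F) : F) : ℂ) = 1 := rfl

lemma aO_coe : ((B.aO j : KK k j) : ℂ) = B.α := rfl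

lemma sq_ideal {O : Type} [CommRing O] [IsDedekindDomain O] {I J : Ideal O} (h : I ^ 2 = J ^ 2) : I = J := by
  apply le_antisymm
  · rw [← Ideal.dvd_iff_le, ← UniqueFactorizationMonoid.pow_dvd_pow_iff_dvd (n := 2) two_ne_zero, h]
  · rw [← Ideal.dvd_iff_le, ← UniqueFactorizationMonoid.pow_dvd_pow_iff_dvd (n := 2) two_ne_zero, h]

/-- `g` as an integer -/
noncomputable def gO (i : ℕ) : 𝓞 (KK k (i + 1)) := mkO B.g (B.g_mem i) B.g_int

lemma g_sq (i : ℕ) : Ideal.span {B.gO i ^ 2} = Ideal.span {B.aO (i + 1)} := by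
  have hv : (B.v : ℂ) ≠ 0 := fun e => B.hv0 (Subtype.ext e)
  set v : 𝓞 (KK k (i + 1)) := mkO B.v (B.v_mem i) (int_coe.1 B.iv)
  set v' : 𝓞 (KK k (i + 1)) := mkO (B.v : ℂ)⁻¹ (inv_mem (B.v_mem i)) B.vinv_int
  have h1 : B.gO i ^ 2 = B.aO (i + 1) * v := O_ext (by rw [O_pow, O_mul, gO, mkO_coe, aO_coe, mkO_coe, B.hg])
  have h2 : v * v' = 1 := O_ext (by rw [O_mul, O_one, mkO_coe, mkO_coe, mul_inv_cancel₀ hv])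
  rw [h1, Ideal.span_singleton_mul_right_unit (IsUnit.of_mul_eq_one _ h2)]

lemma g_span (i : ℕ) : Ideal.span {B.gO i} = B.P (i + 1) ^ (2 ^ (i + 3) * B.m) := by
  have := B.nf (i + 1)
  have h := B.g_sq i
  rw [B.a_span, ← Ideal.span_singleton_pow, show 2 ^ (i + 1) * (8 * B.m) = (2 ^ (i + 3) * B.m) * 2 by ring, pow_mul] at h
  exact sq_ideal h

lemma ord_P (hj : 1 ≤ j) {K : ℕ} {b : 𝓞 (KK k j)} (h : B.P j ^ K = Ideal.span {b}) : 2 ^ (j + 2) ∣ K := by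
  have := B.nf j
  have h1 : Ideal.span {b ^ (2 ^ j * (8 * B.m))} = Ideal.span {B.aO j ^ K} := by
    rw [← Ideal.span_singleton_pow, ← Ideal.span_singleton_pow, ← h, B.a_span, ← pow_mul, ← pow_mul, mul_comm]
  rw [Ideal.span_singleton_eq_span_singleton] at h1
  obtain ⟨e, he⟩ := h1.symm
  have hb0 : b ≠ 0 := by
    rintro rfl
    rw [Ideal.span_singleton_eq_bot.2 rfl] at h
    exact pow_ne_zero K (B.P_ne j) h
  have he1 : (B.aO j : KK k j) ^ K * ((e : 𝓞 (KK k j)) : KK k j) = (b : KK k j) ^ (2 ^ j * (8 * B.m)) := by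
    have := congrArg (fun z : 𝓞 (KK k j) => (z : KK k j)) he
    simp only [map_mul, map_pow] at this
    exact this
  have hx : (((e : 𝓞 (KK k j)) : KK k j)) * (((e⁻¹ : (𝓞 (KK k j))ˣ) : 𝓞 (KK k j)) : KK k j) = 1 := by
    rw [← map_mul, Units.mul_inv, map_one]
  have he0 : ((e : 𝓞 (KK k j)) : KK k j) ≠ 0 := left_ne_zero_of_mul_eq_one hx
  have hen : nrm ((e : 𝓞 (KK k j)) : KK k j) = 1 ∨ nrm ((e : 𝓞 (KK k j)) : KK k j) = -1 := by
    apply B.nrm_unit j he0 (e : 𝓞 (KK k j)).2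
    rw [inv_eq_of_mul_eq_one_right hx]
    exact ((e⁻¹ : (𝓞 (KK k j))ˣ) : 𝓞 (KK k j)).2
  have h2 := congrArg nrm he1
  rw [nrm_mul B.φ, nrm_pow B.φ, nrm_pow B.φ, nrm_k B.φ (x := (B.aO j : KK k j)) (a := B.α) rfl, ← pow_mul] at h2
  have hb : (b : KK k j) ≠ 0 := fun e => hb0 (RingOfIntegers.ext e)
  have hU := nrm_U B.φ hb
  obtain ⟨z, hz⟩ := phi_int B.φ (int_coe.2 (nrm_int B.φ (O_int b)))
  rw [hz] at hU
  have h3 := congrArg B.φ h2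
  rw [map_mul, map_pow, map_pow, hz, B.hw] at h3
  have e3 : ((5 + 8 * B.w : ℤ_[2]) : ℚ_[2]) = 5 + 8 * (B.w : ℚ_[2]) := by push_cast; rfl
  rw [← e3] at h3
  apply adic_end hj B.mpos.ne' hU (w := B.w)
  rcases hen with hen | hen
  · left
    rw [hen, map_one, mul_one] at h3
    apply Subtype.ext
    rw [PadicInt.coe_pow, PadicInt.coe_pow, h3]
  · right
    rw [hen, map_neg, map_one] at h3
    apply Subtype.ext
    rw [PadicInt.coe_neg, PadicInt.coe_pow, PadicInt.coe_pow, ← h3]; ring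

theorem final (B : Base k) (h0 : SqPrin (RR (KK k 0))) (n : ℕ) :
    Nonempty (CommGroup.primaryComponent (ClassGroup (𝓞 (KK k (n + 1)))) 2 ≃* Multiplicative (ZMod (2 ^ (n + 3)))) := by
  have := B.nf (n + 1)
  apply grp_end (icl (B.P (n + 1))) (n + 3) B.m B.hm
  · intro K hK
    rw [← icl_pow (B.P_ne _), icl_eq_one_iff (pow_ne_zero _ (B.P_ne _))] at hK
    obtain ⟨b, hb⟩ := hK
    exact B.ord_P (n + 1) (by omega) hb
  · rw [← icl_pow (B.P_ne _), ← B.g_span, icl_span]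
  · intro x hx
    exact (B.loc (n + 1)).of_sqPrin (B.sqPrin (n + 1) h0) x hx

end Base

end TwoG

end SecFinal

section SecQuadField

open Polynomial IntermediateField NumberField

namespace TwoG

/-- the square root of `-D` -/
noncomputable def dl (D : ℕ) : ℂ := Complex.I * (Real.sqrt D : ℝ)

lemma dl_sq (D : ℕ) : dl D ^ 2 = -(D : ℂ) := by
  rw [dl, mul_pow, Complex.I_sq, ← Complex.ofReal_pow, Real.sq_sqrt (Nat.cast_nonneg D)]
  simp

lemma rat_dl {D : ℕ} (hD : 0 < D) {r t r' t' : ℚ} (h : (r : ℂ) + t * dl D = r' + t' * dl D) : r = r' ∧ t = t' := by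
  have h1 := congrArg Complex.re h
  have h2 := congrArg Complex.im h
  simp [dl] at h1 h2
  have : ¬ D = 0 := by omega
  refine ⟨by exact_mod_cast h1, ?_⟩
  rcases h2 with h2 | h2
  · exact h2
  · exact absurd h2 this

/-- the field `ℚ(√-D)` -/
noncomputable def kD (D : ℕ) : IntermediateField ℚ ℂ where
  carrier := {x | ∃ r t : ℚ, x = r + t * dl D}
  mul_mem' := by
    rintro x y ⟨r, t, rfl⟩ ⟨r', t', rfl⟩
    refine ⟨r * r' - D * t * t', r * t' + t * r', ?_⟩
    push_cast
    linear_combination (t * t' : ℂ) * dl_sq D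
  one_mem' := ⟨1, 0, by simp⟩
  add_mem' := by
    rintro x y ⟨r, t, rfl⟩ ⟨r', t', rfl⟩
    refine ⟨r + r', t + t', ?_⟩
    push_cast
    ring
  zero_mem' := ⟨0, 0, by simp⟩
  algebraMap_mem' r := ⟨r, 0, by simp⟩
  inv_mem' := by
    rintro x ⟨r, t, rfl⟩
    refine ⟨r / (r ^ 2 + D * t ^ 2), -t / (r ^ 2 + D * t ^ 2), ?_⟩
    by_cases h0 : r ^ 2 + D * t ^ 2 = 0
    · have hr : r = 0 := by
        have : r ^ 2 = 0 := by
          have h1 := sq_nonneg r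
          have h2 : 0 ≤ D * t ^ 2 := by positivity
          linarith
        exact pow_eq_zero_iff two_ne_zero |>.1 this
      have h3 : (D : ℚ) * t ^ 2 = 0 := by rw [hr] at h0; linarith
      have h4 : (t : ℂ) * dl D = 0 := by
        have : ((t : ℂ) * dl D) ^ 2 = 0 := by
          rw [mul_pow, dl_sq]
          have : ((D : ℂ)) * t ^ 2 = 0 := by exact_mod_cast h3
          linear_combination -this
        exact pow_eq_zero_iff two_ne_zero |>.1 this
      rw [h4, h0, hr]; simp
    · have h1 : ((r : ℂ) ^ 2 + D * t ^ 2) ≠ 0 := by exact_mod_cast h0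
      apply inv_eq_of_mul_eq_one_right
      push_cast
      have h2 : ((r : ℂ) ^ 2 + D * t ^ 2) * ((r : ℂ) ^ 2 + D * t ^ 2)⁻¹ = 1 := mul_inv_cancel₀ h1
      rw [div_eq_mul_inv, div_eq_mul_inv]
      linear_combination h2 - (t : ℂ) ^ 2 * ((r : ℂ) ^ 2 + D * t ^ 2)⁻¹ * dl_sq D

variable {D : ℕ}

lemma mem_kD {x : ℂ} : x ∈ kD D ↔ ∃ r t : ℚ, x = r + t * dl D := Iff.rfl

/-- coordinates -/
noncomputable def c1 (x : kD D) : ℚ := (mem_kD.1 x.2).choose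
/-- coordinates -/
noncomputable def c2 (x : kD D) : ℚ := (mem_kD.1 x.2).choose_spec.choose

lemma c_spec (x : kD D) : (x : ℂ) = c1 x + c2 x * dl D := (mem_kD.1 x.2).choose_spec.choose_spec

lemma c_uniq (hD : 0 < D) {x : kD D} {r t : ℚ} (h : (x : ℂ) = r + t * dl D) : c1 x = r ∧ c2 x = t := by
  rw [c_spec] at h
  exact rat_dl hD h

/-- embeddings given by the image of `√-D` -/
noncomputable def emb {L : Type} [Field L] [CharZero L] (hD : 0 < D) (e : L) (he : e ^ 2 = -(D : L)) : kD D →+* L where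
  toFun x := c1 x + c2 x * e
  map_one' := by
    have := c_uniq hD (x := 1) (r := 1) (t := 0) (by simp)
    rw [this.1, this.2]; simp
  map_zero' := by
    have := c_uniq hD (x := 0) (r := 0) (t := 0) (by simp)
    rw [this.1, this.2]; simp
  map_add' x y := by
    have := c_uniq hD (x := x + y) (r := c1 x + c1 y) (t := c2 x + c2 y) (by
      rw [AddMemClass.coe_add, c_spec x, c_spec y]; push_cast; ring)
    rw [this.1, this.2]; push_cast; ring
  map_mul' x y := by
    have := c_uniq hD (x := x * y) (r := c1 x * c1 y - D * c2 x * c2 y) (t := c1 x * c2 y + c2 x * c1 y) (by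
      rw [MulMemClass.coe_mul, c_spec x, c_spec y]; push_cast
      linear_combination (c2 x * c2 y : ℂ) * dl_sq D)
    rw [this.1, this.2]; push_cast
    linear_combination (-(c2 x * c2 y) : L) * he

lemma emb_apply {L : Type} [Field L] [CharZero L] (hD : 0 < D) (e : L) (he : e ^ 2 = -(D : L)) {x : kD D} {r t : ℚ}
    (h : (x : ℂ) = r + t * dl D) : emb hD e he x = r + t * e := by
  change (c1 x : L) + c2 x * e = _
  rw [(c_uniq hD h).1, (c_uniq hD h).2]

lemma kD_fin (hD : 0 < D) : Module.finrank ℚ (kD D) = 2 := by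
  let f : (ℚ × ℚ) →ₗ[ℚ] kD D :=
    { toFun := fun x => ⟨x.1 + x.2 * dl D, mem_kD.2 ⟨_, _, rfl⟩⟩
      map_add' := fun x y => Subtype.ext (by
        rw [AddMemClass.coe_add]
        change ((x.1 + y.1 : ℚ) : ℂ) + ((x.2 + y.2 : ℚ) : ℂ) * dl D = (x.1 + x.2 * dl D) + (y.1 + y.2 * dl D)
        push_cast; ring)
      map_smul' := fun c x => Subtype.ext (by
        rw [RingHom.id_apply, IntermediateField.coe_smul, Algebra.smul_def]
        change ((c * x.1 : ℚ) : ℂ) + ((c * x.2 : ℚ) : ℂ) * dl D = algebraMap ℚ ℂ c * (x.1 + x.2 * dl D)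
        rw [eq_ratCast]
        push_cast; ring) }
  have hf : Function.Bijective f := by
    constructor
    · intro x y h
      have h1 : (x.1 : ℂ) + x.2 * dl D = y.1 + y.2 * dl D := congrArg (fun z : kD D => (z : ℂ)) h
      exact Prod.ext (rat_dl hD h1).1 (rat_dl hD h1).2
    · intro x
      exact ⟨(c1 x, c2 x), Subtype.ext (c_spec x).symm⟩
  rw [← (LinearEquiv.ofBijective f hf).finrank_eq, Module.finrank_prod, Module.finrank_self]

lemma kD_nf (hD : 0 < D) : NumberField (kD D) where
  to_charZero := inferInstance
  to_finiteDimensional := FiniteDimensional.of_finrank_pos (by rw [kD_fin hD]; norm_num)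

/-- `√-D` in the field -/
noncomputable def dk (D : ℕ) : kD D := ⟨dl D, mem_kD.2 ⟨0, 1, by simp⟩⟩

lemma dk_coe : (dk D : ℂ) = dl D := rfl

lemma dk_sq : dk D ^ 2 = -(D : kD D) := Subtype.ext (by
  rw [SubmonoidClass.coe_pow, dk_coe, dl_sq]; push_cast; rfl)

/-- conjugation -/
noncomputable def kc (hD : 0 < D) : kD D →+* kD D := emb hD (-dk D) (by rw [neg_sq, dk_sq])

lemma kc_dk (hD : 0 < D) : kc hD (dk D) = -dk D := by
  rw [kc, emb_apply hD _ _ (r := 0) (t := 1) (by rw [dk_coe]; simp)]; simp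

lemma kD_rep (x : kD D) : x = (c1 x : kD D) + c2 x * dk D := Subtype.ext (by
  rw [AddMemClass.coe_add, MulMemClass.coe_mul, dk_coe]
  exact c_spec x)

lemma rat_int {k : IntermediateField ℚ ℂ} {r : ℚ} (h : IsIntegral ℤ (r : k)) : ∃ n : ℤ, r = n := by
  have h1 : IsIntegral ℤ r := by
    have e : (r : k) = algebraMap ℚ k r := by simp
    rw [e] at h
    exact (isIntegral_algebraMap_iff (algebraMap ℚ k).injective).1 h
  obtain ⟨n, hn⟩ := IsIntegrallyClosed.isIntegral_iff.1 h1
  exact ⟨n, by rw [← hn]; simp⟩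

lemma sqfree_rat {D : ℕ} (hs : Squarefree D) {b : ℚ} {n : ℤ} (h : D * b ^ 2 = n) : ∃ m : ℤ, b = m := by
  have hD : D ≠ 0 := hs.ne_zero
  have h1 : (D : ℤ) * b.num ^ 2 = n * (b.den : ℤ) ^ 2 := by
    have h2 : b = b.num / b.den := (Rat.num_div_den b).symm
    have h3 : (b.den : ℚ) ≠ 0 := by exact_mod_cast b.den_nz
    have : (D : ℚ) * b.num ^ 2 = n * (b.den : ℚ) ^ 2 := by
      rw [← h]
      nth_rewrite 2 [h2]
      field_simp
    exact_mod_cast this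
  have h4 : (b.den : ℤ) ^ 2 ∣ (D : ℤ) := by
    have hc : IsCoprime ((b.den : ℤ) ^ 2) (b.num ^ 2) := by
      apply IsCoprime.pow
      rw [Int.isCoprime_iff_gcd_eq_one, Int.gcd_comm]
      exact b.reduced
    exact hc.dvd_of_dvd_mul_right (Dvd.intro_left _ h1.symm)
  have h5 : b.den * b.den ∣ D := by
    rw [← sq]; exact_mod_cast h4
  have h6 := Nat.isUnit_iff.1 (hs _ h5)
  exact ⟨b.num, (Rat.coe_int_num_of_den_eq_one h6).symm⟩

lemma kD_int (hD : 0 < D) (hs : Squarefree D) {x : kD D} (h : IsIntegral ℤ x) :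
    ∃ a b n : ℤ, 2 * x = a + b * dk D ∧ a ^ 2 + D * b ^ 2 = 4 * n ∧ x * kc hD x = n := by
  have hc : IsIntegral ℤ (kc hD x) := map_isIntegral_int (kc hD) h
  have hx := kD_rep x
  have hcx : kc hD x = (c1 x : kD D) - c2 x * dk D := by
    nth_rewrite 1 [hx]
    rw [map_add, map_mul, map_ratCast, map_ratCast, kc_dk]; ring
  obtain ⟨a, ha⟩ := rat_int (k := kD D) (r := 2 * c1 x) (by
    have e : ((2 * c1 x : ℚ) : kD D) = x + kc hD x := by
      rw [hcx]; push_cast; linear_combination -hx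
    rw [e]
    exact h.add hc)
  have hxx : x * kc hD x = ((c1 x ^ 2 + D * c2 x ^ 2 : ℚ) : kD D) := by
    rw [hcx]
    nth_rewrite 1 [hx]
    push_cast
    linear_combination (-(c2 x : kD D) ^ 2) * dk_sq (D := D)
  obtain ⟨n, hn⟩ := rat_int (k := kD D) (r := c1 x ^ 2 + D * c2 x ^ 2) (by
    rw [← hxx]; exact h.mul hc)
  obtain ⟨b, hb⟩ := sqfree_rat hs (b := 2 * c2 x) (n := 4 * n - a ^ 2) (by
    push_cast
    rw [← hn, ← ha]; ring)
  refine ⟨a, b, n, ?_, ?_, by rw [hxx, hn]; simp⟩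
  · have h1 : ((2 * c1 x : ℚ) : kD D) = (a : kD D) := by rw [ha]; simp
    have h2 : ((2 * c2 x : ℚ) : kD D) = (b : kD D) := by rw [hb]; simp
    rw [← h1, ← h2]
    nth_rewrite 1 [hx]
    push_cast; ring
  · have : (a : ℚ) ^ 2 + D * (b : ℚ) ^ 2 = 4 * n := by
      rw [← ha, ← hb, ← hn]; ring
    exact_mod_cast this

lemma kD_unit (hD : 0 < D) (hs : Squarefree D) (hD5 : 4 < D) (x : kD D) (h : IsIntegral ℤ x) (h' : IsIntegral ℤ x⁻¹) (h0 : x ≠ 0) :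
    x = 1 ∨ x = -1 := by
  obtain ⟨a, b, n, h1, h2, h3⟩ := kD_int hD hs h
  obtain ⟨a', b', n', h1', h2', h3'⟩ := kD_int hD hs h'
  have h4 : n * n' = 1 := by
    have : ((n * n' : ℤ) : kD D) = ((1 : ℤ) : kD D) := by
      push_cast
      rw [← h3, ← h3', map_inv₀]
      have : kc hD x ≠ 0 := (_root_.map_ne_zero _).2 h0
      field_simp
    exact_mod_cast this
  have h5 : n = 1 := by
    have : 0 ≤ n := by
      have : (0 : ℤ) ≤ D * b ^ 2 := by positivity
      nlinarith [sq_nonneg a]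
    rcases Int.isUnit_iff.1 (IsUnit.of_mul_eq_one _ h4) with h | h
    · exact h
    · omega
  have hD5' : (4 : ℤ) < D := by exact_mod_cast hD5
  have hb : b = 0 := by
    by_contra hb
    have : 1 ≤ b ^ 2 := by
      have := pow_pos (abs_pos.2 hb) 2
      rw [sq_abs] at this; omega
    nlinarith [sq_nonneg a]
  rw [hb, h5] at h2
  have ha : (a - 2) * (a + 2) = 0 := by linear_combination h2
  rw [hb] at h1
  have two : (2 : kD D) ≠ 0 := two_ne_zero
  rcases mul_eq_zero.1 ha with h | h
  · left
    have : a = 2 := by omega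
    rw [this] at h1
    apply mul_left_cancel₀ two
    rw [h1]; push_cast; ring
  · right
    have : a = -2 := by omega
    rw [this] at h1
    apply mul_left_cancel₀ two
    rw [h1]; push_cast; ring

lemma half_int (h8 : D % 8 = 7) {x : kD D} {a b : ℤ} (ha : Odd a) (hb : Odd b) (h : 2 * x = a + b * dk D) : IsIntegral ℤ x := by
  have hn : (a ^ 2 + D * b ^ 2) % 4 = 0 := by
    obtain ⟨s, rfl⟩ := ha
    obtain ⟨t, rfl⟩ := hb
    obtain ⟨r, hr⟩ : ∃ r : ℤ, (D : ℤ) = 8 * r + 7 := ⟨D / 8, by omega⟩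
    rw [hr]
    ring_nf
    omega
  obtain ⟨n, hn⟩ := Int.dvd_of_emod_eq_zero hn
  refine ⟨X ^ 2 - C a * X + C n, by monicity!, ?_⟩
  have h4 : (4 : kD D) ≠ 0 := by norm_num
  apply mul_left_cancel₀ h4
  have hn' : (a : kD D) ^ 2 + D * (b : kD D) ^ 2 = 4 * n := by exact_mod_cast hn
  simp only [eval₂_add, eval₂_sub, eval₂_mul, eval₂_pow, eval₂_X, eval₂_C]
  simp only [eq_intCast]
  linear_combination (2 * x - a + b * dk D) * h - hn' + (b : kD D) ^ 2 * dk_sq (D := D)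

lemma hensel_sqrt (h8 : D % 8 = 7) : ∃ e : ℤ_[2], e ^ 2 = -(D : ℤ_[2]) := by
  obtain ⟨r, hr⟩ : ∃ r : ℕ, D + 1 = 8 * r := ⟨(D + 1) / 8, by omega⟩
  have n2 : ‖(2 : ℤ_[2])‖ = 2⁻¹ := by
    have := PadicInt.norm_p (p := 2)
    simpa using this
  obtain ⟨z, hz, -⟩ := hensels_lemma (p := 2) (F := (X ^ 2 + C (D : ℤ_[2]) : ℤ_[2][X])) (a := (1 : ℤ_[2])) (by
    simp only [coe_aeval_eq_eval, eval_add, eval_pow, eval_X, eval_C, derivative_add, derivative_X_pow, derivative_C]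
    have e1 : (1 : ℤ_[2]) ^ 2 + D = 2 ^ 3 * (r : ℤ_[2]) := by
      have : ((D + 1 : ℕ) : ℤ_[2]) = ((8 * r : ℕ) : ℤ_[2]) := by rw [hr]
      push_cast at this
      linear_combination this
    rw [e1, norm_mul, norm_pow, n2]
    have e2 : ‖(r : ℤ_[2])‖ ≤ 1 := PadicInt.norm_le_one _
    have e3 : ‖eval (1 : ℤ_[2]) (C ((2 : ℕ) : ℤ_[2]) * X ^ (2 - 1)) + eval 1 0‖ = 2⁻¹ := by
      simp [n2]
    rw [e3]
    nlinarith)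
  refine ⟨z, ?_⟩
  simp at hz
  linear_combination hz

end TwoG

end SecQuadField

section SecBaseArith

open Polynomial IntermediateField NumberField

namespace TwoG

section arith

variable {p q : ℕ}

lemma pq_sqfree (hp : p.Prime) (hq : q.Prime) (hne : p ≠ q) : Squarefree (p * q) :=
  (Nat.squarefree_mul ((Nat.coprime_primes hp hq).2 hne)).2 ⟨hp.prime.squarefree, hq.prime.squarefree⟩

lemma qd (p q : ℕ) (hD : 0 < p * q) (h8 : p * q % 8 = 7) (hs : Squarefree (p * q)) :
    Nonempty (QData (𝓞 (kD (p * q))) p q) := by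
  have hdi : IsIntegral ℤ (dk (p * q)) := by
    refine ⟨X ^ 2 + C ((p * q : ℕ) : ℤ), by monicity!, ?_⟩
    simp only [eval₂_add, eval₂_pow, eval₂_X, eval₂_C]
    rw [dk_sq]; simp
  have hw : IsIntegral ℤ ((1 + dk (p * q)) / 2) :=
    half_int h8 (a := 1) (b := 1) odd_one odd_one (by push_cast; ring)
  obtain ⟨d, hd⟩ : ∃ d : 𝓞 (kD (p * q)), algebraMap (𝓞 (kD (p * q))) (kD (p * q)) d = dk (p * q) := ⟨⟨_, hdi⟩, rfl⟩
  obtain ⟨w, hw⟩ : ∃ w : 𝓞 (kD (p * q)), algebraMap (𝓞 (kD (p * q))) (kD (p * q)) w = (1 + dk (p * q)) / 2 := ⟨⟨_, hw⟩, rfl⟩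
  have inj : Function.Injective (algebraMap (𝓞 (kD (p * q))) (kD (p * q))) := FaithfulSMul.algebraMap_injective _ _
  refine ⟨
    { δ := d
      ω := w
      σ := RingOfIntegers.mapRingHom (kc hD)
      hδ := ?_
      hω := ?_
      hσ := ?_
      hO := ?_ }⟩
  · apply inj
    rw [map_pow, map_neg, map_mul, map_natCast, map_natCast, hd, dk_sq]; push_cast; rfl
  · apply inj
    rw [map_mul, map_add, map_ofNat, map_one, hd, hw]; ring
  · apply inj
    rw [map_neg]
    have : algebraMap (𝓞 (kD (p * q))) (kD (p * q)) (RingOfIntegers.mapRingHom (kc hD) d) = kc hD (algebraMap (𝓞 (kD (p * q))) (kD (p * q)) d) := rfl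
    rw [this, hd, kc_dk]
  · intro x
    obtain ⟨a, b, n, h1, -, -⟩ := kD_int hD hs (x := algebraMap (𝓞 (kD (p * q))) (kD (p * q)) x) x.2
    refine ⟨a, b, ?_⟩
    apply inj
    rw [map_mul, map_add, map_mul, map_ofNat, map_intCast, map_intCast, hd, h1]

lemma sq0 (hp : p.Prime) (hq : q.Prime) (hne : p ≠ q) (hp8 : p % 8 = 5) (h8 : p * q % 8 = 7) :
    SqPrin (RR (KK (kD (p * q)) 0)) := by
  have hs := pq_sqfree hp hq hne
  have hD : 0 < p * q := Nat.pos_of_ne_zero hs.ne_zero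
  rw [KK_zero]
  haveI := kD_nf hD
  obtain ⟨Q⟩ := qd p q hD h8 hs
  have hpt : Q.pp ≠ ⊤ := by
    intro h
    apply Q.pb_ne_top h8
    rw [← Q.cj_pp, h]
    exact Ideal.map_top _
  have hpr := prime_pair (Q.pp_mul_pb h8) (by rw [absNorm_two, kD_fin hD]; norm_num) hpt (Q.pb_ne_top h8)
  let L : LocD (𝓞 (kD (p * q))) (RR (kD (p * q))) :=
    { i := toRR _
      inj := toRR_inj
      h2 := two_unit_RR
      surj := toRR_surj
      P := Q.pp
      P' := Q.pb
      hP := hpr.1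
      hP' := hpr.2
      P0 := Q.pp_ne
      P0' := Q.pb_ne
      lam := 2
      mulP := Q.pp_mul_pb h8
      l2 := dvd_rfl
      N := 1
      l2' := by rw [pow_one] }
  exact L.sqPrin_of (Q.SPodd hp hq hne hp8 h8)

end arith

section local5

variable {k : IntermediateField ℚ ℂ}

lemma two_dvd_succ (z : ℤ_[2]) : (2 : ℤ_[2]) ∣ z * (z + 1) := by
  by_cases h : (2 : ℤ_[2]) ∣ z
  · exact h.mul_right _
  · obtain ⟨y, hy⟩ := unit_odd h
    exact ⟨z * (1 + y), by rw [hy]; ring⟩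

lemma phi_five {p : ℕ} (hp8 : p % 8 = 5) (φ : k →+* ℚ_[2]) {α γ : k} (hγ : γ ^ 2 = p * α) (iγ : IsIntegral ℤ γ)
    {a : ℤ_[2]} (ha : φ α = a) (h2 : ¬ (2 : ℤ_[2]) ∣ a) : ∃ w : ℤ_[2], φ α = 5 + 8 * (w : ℚ_[2]) := by
  obtain ⟨c, hc⟩ := phi_int φ iγ
  have h1 : c ^ 2 = p * a := by
    have := congrArg φ hγ
    rw [map_pow, map_mul, map_natCast, ha, hc] at this
    have h : ((c ^ 2 : ℤ_[2]) : ℚ_[2]) = ((p * a : ℤ_[2]) : ℚ_[2]) := by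
      push_cast; exact this
    exact Subtype.ext h
  obtain ⟨s, hs⟩ : ∃ s : ℕ, p = 5 + 8 * s := ⟨p / 8, by omega⟩
  have hps : (p : ℤ_[2]) = 5 + 8 * s := by rw [hs]; push_cast; ring
  have hcn : ¬ (2 : ℤ_[2]) ∣ c := by
    rintro ⟨y, hy⟩
    apply h2
    refine ⟨c * y - 2 * a - 4 * s * a, ?_⟩
    rw [hps] at h1
    linear_combination -h1 + c * hy
  obtain ⟨z, hz⟩ := unit_odd hcn
  obtain ⟨y, hy⟩ := two_dvd_succ z
  refine ⟨5 * (y - s * a) - 3 * a, ?_⟩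
  rw [ha]
  have : a = 5 + 8 * (5 * (y - s * a) - 3 * a) := by
    rw [hps, hz] at h1
    linear_combination (-5 : ℤ_[2]) * h1 + 20 * hy
  have h3 := congrArg (fun x : ℤ_[2] => (x : ℚ_[2])) this
  rw [h3]
  push_cast
  rfl

end local5

section gv

lemma i_sq : zt 1 ^ 2 = -1 := by rw [zt_sq, zt_zero]

lemma gv_aux {k : IntermediateField ℚ ℂ} {p q : ℕ} {s α γ c u u' : ℂ} {a b κ ε e : ℤ} (hp : p ≠ 0)
    (hs : s ^ 2 = (p : ℂ) * q) (hsm : s ∈ KK k 1) (is : IsIntegral ℤ s) (hκ : κ ≠ 0) (hε : ε ^ 2 = 1) (he : e * κ = 2)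
    (hpell : p * a ^ 2 - q * b ^ 2 = ε * κ) (hγ : γ ^ 2 = p * α) (hγm : γ ∈ KK k 1)
    (hc : c ^ 2 = κ * u) (hcm : c ∈ KK k 1) (hu : u * u' = 1) (hum : u ∈ KK k 1) (hum' : u' ∈ KK k 1)
    (iu : IsIntegral ℤ u) (iu' : IsIntegral ℤ u') :
    ∃ g v : KK k 1, v ≠ 0 ∧ IsIntegral ℤ v ∧ IsIntegral ℤ v⁻¹ ∧ (g : ℂ) ^ 2 = α * v := by
  have hpell' : (p : ℂ) * a ^ 2 - q * b ^ 2 = ε * κ := by exact_mod_cast hpell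
  have hε' : (ε : ℂ) ^ 2 = 1 := by exact_mod_cast hε
  have he' : (e : ℂ) * κ = 2 := by exact_mod_cast he
  have hp' : (p : ℂ) ≠ 0 := by exact_mod_cast hp
  have hκ' : (κ : ℂ) ≠ 0 := by exact_mod_cast hκ
  have ii : ∀ n : ℤ, IsIntegral ℤ (n : ℂ) := fun n => isIntegral_intCast n
  have im : ∀ n : ℤ, (n : ℂ) ∈ KK k 1 := fun n => intCast_mem _ n
  have iq : IsIntegral ℤ (q : ℂ) := by exact_mod_cast ii q
  have mq : (q : ℂ) ∈ KK k 1 := by exact_mod_cast im q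
  have mp : (p : ℂ) ∈ KK k 1 := by exact_mod_cast im p
  obtain ⟨E, hE⟩ : ∃ E : ℂ, E = e * (q * b ^ 2 + a * b * s) + ε := ⟨_, rfl⟩
  obtain ⟨E', hE'⟩ : ∃ E' : ℂ, E' = e * (q * b ^ 2 - a * b * s) + ε := ⟨_, rfl⟩
  obtain ⟨ρ, hρ⟩ : ∃ ρ : ℂ, ρ = p * a + b * s := ⟨_, rfl⟩
  have hEE : E * E' = 1 := by
    rw [hE, hE']
    linear_combination hε' - (e : ℂ) ^ 2 * a ^ 2 * b ^ 2 * hs - (e : ℂ) ^ 2 * q * b ^ 2 * hpell' - (e : ℂ) * q * b ^ 2 * ε * he'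
  have hρ2 : ρ ^ 2 = p * κ * E := by
    rw [hρ, hE]
    linear_combination (b : ℂ) ^ 2 * hs + (p : ℂ) * hpell' - (p : ℂ) * (q * b ^ 2 + a * b * s) * he'
  have hρ0 : ρ ≠ 0 := by
    intro h
    rw [h] at hρ2
    have hE0 : E ≠ 0 := left_ne_zero_of_mul_eq_one hEE
    exact mul_ne_zero (mul_ne_zero hp' hκ') hE0 (by rw [← hρ2]; ring)
  have mE' : E' ∈ KK k 1 := by
    rw [hE']
    exact add_mem (mul_mem (im _) (sub_mem (mul_mem mq (pow_mem (im _) 2)) (mul_mem (mul_mem (im _) (im _)) hsm))) (im _)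
  have mρ : ρ ∈ KK k 1 := by
    rw [hρ]
    exact add_mem (mul_mem mp (im _)) (mul_mem (im _) hsm)
  have iE : IsIntegral ℤ E := by
    rw [hE]
    exact ((ii _).mul ((iq.mul ((ii _).pow 2)).add (((ii _).mul (ii _)).mul is))).add (ii _)
  have iE' : IsIntegral ℤ E' := by
    rw [hE']
    exact ((ii _).mul ((iq.mul ((ii _).pow 2)).sub (((ii _).mul (ii _)).mul is))).add (ii _)
  have hvv : (u * E') * (u' * E) = 1 := by linear_combination (u * u') * hEE + hu
  refine ⟨⟨γ * c / ρ, div_mem (mul_mem hγm hcm) mρ⟩, ⟨u * E', mul_mem hum mE'⟩, ?_, ?_, ?_, ?_⟩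
  · intro h
    have h1 : u * E' = 0 := congrArg (fun z : KK k 1 => (z : ℂ)) h
    rw [h1, zero_mul] at hvv
    exact zero_ne_one hvv
  · rw [int_coe]
    exact iu.mul iE'
  · rw [int_coe, IntermediateField.coe_inv]
    have : (u * E')⁻¹ = u' * E := inv_eq_of_mul_eq_one_right hvv
    change IsIntegral ℤ (u * E')⁻¹
    rw [this]
    exact iu'.mul iE
  · change (γ * c / ρ) ^ 2 = α * (u * E')
    rw [div_pow, div_eq_iff (pow_ne_zero 2 hρ0), mul_pow, hγ, hc, hρ2]
    linear_combination (-(p : ℂ) * κ * α * u) * hEE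

lemma gv {p q : ℕ} (hp : p.Prime) (hq : q.Prime) (hp8 : p % 8 = 5) (hq8 : q % 8 = 3)
    {α γ : kD (p * q)} (hγ : γ ^ 2 = p * α) :
    ∃ g v : KK (kD (p * q)) 1, v ≠ 0 ∧ IsIntegral ℤ v ∧ IsIntegral ℤ v⁻¹ ∧ (g : ℂ) ^ 2 = α * v := by
  obtain ⟨a, b, κ, ε, hκ, hε, hpell⟩ := p0_pell p q hp hq hp8 hq8
  have hε2 : ε ^ 2 = 1 := by rcases hε with h | h <;> rw [h] <;> norm_num
  have hγ' : (γ : ℂ) ^ 2 = p * (α : ℂ) := by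
    have := congrArg (fun z : kD (p * q) => (z : ℂ)) hγ
    simpa using this
  have hdl : IsIntegral ℤ (dl (p * q)) := by
    refine ⟨X ^ 2 + C ((p * q : ℕ) : ℤ), by monicity!, ?_⟩
    simp only [eval₂_add, eval₂_pow, eval₂_X, eval₂_C]
    rw [dl_sq]; simp
  have hs : (-zt 1 * dl (p * q)) ^ 2 = (p : ℂ) * q := by
    rw [mul_pow, neg_sq, i_sq, dl_sq]; push_cast; ring
  have hsm : -zt 1 * dl (p * q) ∈ KK (kD (p * q)) 1 := mul_mem (neg_mem (zt_mem 1)) (k_le 1 (dk (p * q)).2)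
  have is : IsIntegral ℤ (-zt 1 * dl (p * q)) := (zt_integralZ 1).neg.mul hdl
  rcases hκ with rfl | rfl
  · exact gv_aux (e := 2) (c := 1) (u := 1) (u' := 1) hp.ne_zero hs hsm is one_ne_zero hε2 (by norm_num) hpell hγ' (k_le 1 γ.2)
      (by norm_num) (one_mem _) (by norm_num) (one_mem _) (one_mem _) isIntegral_one isIntegral_one
  · exact gv_aux (e := 1) (c := 1 + zt 1) (u := zt 1) (u' := -zt 1) hp.ne_zero hs hsm is two_ne_zero hε2 (by norm_num) hpell hγ' (k_le 1 γ.2)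
      (by push_cast; linear_combination i_sq) (add_mem (one_mem _) (zt_mem 1)) (by linear_combination -i_sq) (zt_mem 1)
      (neg_mem (zt_mem 1)) (zt_integralZ 1) (zt_integralZ 1).neg

end gv

end TwoG

end SecBaseArith

namespace TwoG

section build

variable {p q : ℕ}

lemma kc_kc {D : ℕ} (hD : 0 < D) (x : kD D) : kc hD (kc hD x) = x := by
  have hx := kD_rep x
  nth_rewrite 1 [hx]
  rw [map_add, map_mul, map_ratCast, map_ratCast, kc_dk, map_add, map_mul, map_ratCast, map_ratCast, map_neg, kc_dk, neg_neg, ← hx]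

lemma base_exists (hp : p.Prime) (hq : q.Prime) (hp8 : p % 8 = 5) (hq8 : q % 8 = 3) (h8 : p * q % 8 = 7)
    (hs : Squarefree (p * q)) {m : ℕ} {A B : ℤ} (hm : Odd m) (hA : Odd A) (hB : Odd B)
    (h : p * A ^ 2 + q * B ^ 2 = 4 * 16 ^ m) : Nonempty (Base (kD (p * q))) := by
  have hD : 0 < p * q := Nat.pos_of_ne_zero hs.ne_zero
  have hpodd : Odd (p : ℤ) := by
    have : Odd p := Nat.odd_iff.2 (by omega)
    exact_mod_cast this
  have hD4 : 4 < p * q := by omega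
  obtain ⟨t, ht⟩ : ∃ t : ℤ, t = p * A ^ 2 - 2 * 16 ^ m := ⟨_, rfl⟩
  have hto : Odd t := by
    rw [ht]
    exact (hpodd.mul hA.pow).sub_even (even_two_mul _)
  have hK : (p : kD (p * q)) * (A : kD (p * q)) ^ 2 + q * (B : kD (p * q)) ^ 2 = 4 * 16 ^ m := by exact_mod_cast h
  have htK : (t : kD (p * q)) = p * (A : kD (p * q)) ^ 2 - 2 * 16 ^ m := by rw [ht]; push_cast; ring
  have hd2 : dk (p * q) ^ 2 = -((p : kD (p * q)) * q) := by rw [dk_sq]; push_cast; ring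
  obtain ⟨γ, hγ⟩ : ∃ γ : kD (p * q), 2 * γ = ((p * A : ℤ) : kD (p * q)) + (B : kD (p * q)) * dk (p * q) :=
    ⟨(((p * A : ℤ) : kD (p * q)) + (B : kD (p * q)) * dk (p * q)) / 2, by ring⟩
  obtain ⟨α, hα⟩ : ∃ α : kD (p * q), 2 * α = (t : kD (p * q)) + ((A * B : ℤ) : kD (p * q)) * dk (p * q) :=
    ⟨((t : kD (p * q)) + ((A * B : ℤ) : kD (p * q)) * dk (p * q)) / 2, by ring⟩
  have iγ : IsIntegral ℤ γ := half_int h8 (hpodd.mul hA) hB hγ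
  have iα : IsIntegral ℤ α := half_int h8 hto (hA.mul hB) hα
  have iα' : IsIntegral ℤ (kc hD α) := map_isIntegral_int (kc hD) iα
  have hα' : 2 * kc hD α = (t : kD (p * q)) - ((A * B : ℤ) : kD (p * q)) * dk (p * q) := by
    have := congrArg (kc hD) hα
    rw [map_mul, map_add, map_mul, map_intCast, map_intCast, map_ofNat, kc_dk] at this
    rw [this]; ring
  have four : (4 : kD (p * q)) ≠ 0 := by norm_num
  have two : (2 : kD (p * q)) ≠ 0 := by norm_num
  have hγα : γ ^ 2 = p * α := by
    apply mul_left_cancel₀ four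
    have e1 : 4 * γ ^ 2 = (2 * γ) ^ 2 := by ring
    have e2 : 4 * (p * α) = 2 * p * (2 * α) := by ring
    rw [e1, e2, hγ, hα, htK]
    push_cast
    linear_combination (B : kD (p * q)) ^ 2 * hd2 - (p : kD (p * q)) * hK
  have hadd : α + kc hD α = t := by
    apply mul_left_cancel₀ two
    linear_combination hα + hα'
  have hmul : α * kc hD α = 2 ^ (8 * m) := by
    apply mul_left_cancel₀ four
    have e1 : 4 * (α * kc hD α) = (2 * α) * (2 * kc hD α) := by ring
    have e2 : (2 : kD (p * q)) ^ (8 * m) = (16 ^ m) ^ 2 := by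
      rw [pow_mul, ← pow_mul (16 : kD (p * q)) m 2, mul_comm m 2, pow_mul (16 : kD (p * q)) 2 m]; norm_num
    rw [e1, e2, hα, hα', htK]
    push_cast
    linear_combination (-((A : kD (p * q)) * B) ^ 2) * hd2 + (p : kD (p * q)) * A ^ 2 * hK
  obtain ⟨e, he⟩ := hensel_sqrt h8
  have he' : (e : ℚ_[2]) ^ 2 = -((p * q : ℕ) : ℚ_[2]) := by
    have := congrArg (fun x : ℤ_[2] => (x : ℚ_[2])) he
    push_cast at this ⊢
    exact this
  obtain ⟨φ, φ', h1, w, hw⟩ : ∃ φ φ' : kD (p * q) →+* ℚ_[2], φ' (kc hD α) = φ α ∧ ∃ w : ℤ_[2], φ α = 5 + 8 * (w : ℚ_[2]) := by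
    obtain ⟨φ⟩ : Nonempty (kD (p * q) →+* ℚ_[2]) := ⟨emb hD (e : ℚ_[2]) he'⟩
    obtain ⟨x, hx⟩ := phi_int φ iα
    obtain ⟨y, hy⟩ := phi_int φ iα'
    by_cases h2 : (2 : ℤ_[2]) ∣ x
    · refine ⟨φ.comp (kc hD), φ, rfl, phi_five hp8 (φ.comp (kc hD)) hγα iγ (a := y) hy ?_⟩
      intro h3
      obtain ⟨r, hr⟩ := hto
      have h4 : x + y = t := by
        have := congrArg φ hadd
        rw [map_add, hx, hy, map_intCast] at this
        have h5 : ((x + y : ℤ_[2]) : ℚ_[2]) = ((t : ℤ_[2]) : ℚ_[2]) := by push_cast; exact this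
        exact Subtype.ext h5
      apply not_two_dvd_one
      have h6 : (1 : ℤ_[2]) = x + y - 2 * r := by rw [h4, hr]; push_cast; ring
      rw [h6]
      exact dvd_sub (dvd_add h2 h3) (Dvd.intro _ rfl)
    · exact ⟨φ, φ.comp (kc hD), by rw [RingHom.comp_apply, kc_kc], phi_five hp8 φ hγα iγ hx h2⟩
  obtain ⟨g, v, v0, iv, iv', hg⟩ := gv hp hq hp8 hq8 hγα
  exact ⟨
    { φ := φ
      φ' := φ'
      α := α
      α' := kc hD α
      ia := iα
      ia' := iα'
      t := t
      ht := hto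
      m := m
      hm := hm
      hadd := hadd
      hmul := hmul
      w := w
      hw := hw
      w' := w
      hw' := by rw [h1, hw]
      hunit := kD_unit hD hs hD4
      g := g
      v := v
      hv0 := v0
      iv := iv
      iv' := iv'
      hg := hg
      hfin := kD_fin hD
      δ := dk (p * q)
      d := p * q
      hd := hD
      hδ := dk_sq }⟩

end build

section fields

lemma zt_one_mem {k : IntermediateField ℚ ℂ} (j : ℕ) : zt 1 ∈ KK k (j + 1) := by
  induction j with
  | zero => exact zt_mem 1
  | succ j ih => exact KK_le _ ih

lemma zt_one_pow (j : ℕ) : ∃ r : ℕ, zt 1 = zt (j + 1) ^ r := by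
  induction j with
  | zero => exact ⟨1, (pow_one _).symm⟩
  | succ j ih =>
    obtain ⟨r, hr⟩ := ih
    exact ⟨2 * r, by rw [pow_mul, zt_sq, hr]⟩

lemma zt_prim (n : ℕ) : IsPrimitiveRoot (zt (n + 1)) (2 ^ (n + 2)) := by
  have := Complex.isPrimitiveRoot_exp (2 ^ (n + 2)) (by positivity)
  have e : zt (n + 1) = Complex.exp (2 * Real.pi * Complex.I / ((2 ^ (n + 2) : ℕ) : ℂ)) := by
    rw [zt]
    congr 1
    push_cast
    rw [pow_succ (2 : ℂ) (n + 1)]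
    field_simp
  rw [e]; exact this

lemma Lfield_eq {p q : ℕ} (n : ℕ) : Lfield n ((p : ℤ) * q) = KK (kD (p * q)) (n + 1) := by
  have hi : (zt 1 * dl (p * q)) ^ 2 = (((p : ℤ) * q : ℤ) : ℂ) := by
    rw [mul_pow, i_sq, dl_sq]; push_cast; ring
  apply le_antisymm
  · rw [Lfield, adjoin_le_iff]
    rintro z (hz | hz)
    · have hz' : z ^ 2 ^ (n + 2) = 1 := hz
      obtain ⟨i, -, rfl⟩ := (zt_prim n).eq_pow_of_pow_eq_one hz'
      exact pow_mem (zt_mem (n + 1)) i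
    · have hz' : z ^ 2 = (((p : ℤ) * q : ℤ) : ℂ) := hz
      rw [← hi, sq_eq_sq_iff_eq_or_eq_neg] at hz'
      have hm : zt 1 * dl (p * q) ∈ KK (kD (p * q)) (n + 1) := mul_mem (zt_one_mem n) (k_le _ (dk (p * q)).2)
      rcases hz' with rfl | rfl
      · exact hm
      · exact neg_mem hm
  · have hz : zt (n + 1) ∈ Lfield n ((p : ℤ) * q) := subset_adjoin ℚ _ (Or.inl (zt_prim n).pow_eq_one)
    have h1 : zt 1 ∈ Lfield n ((p : ℤ) * q) := by
      obtain ⟨r, hr⟩ := zt_one_pow n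
      rw [hr]; exact pow_mem hz r
    have h2 : zt 1 * dl (p * q) ∈ Lfield n ((p : ℤ) * q) := subset_adjoin ℚ _ (Or.inr hi)
    have h3 : dl (p * q) ∈ Lfield n ((p : ℤ) * q) := by
      have : dl (p * q) = -(zt 1 * (zt 1 * dl (p * q))) := by linear_combination (dl (p * q)) * i_sq
      rw [this]
      exact neg_mem (mul_mem h1 h2)
    have h4 : ∀ x : kD (p * q), (x : ℂ) ∈ Lfield n ((p : ℤ) * q) := by
      intro x
      rw [c_spec x, ← eq_ratCast (algebraMap ℚ ℂ), ← eq_ratCast (algebraMap ℚ ℂ)]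
      exact add_mem (_root_.algebraMap_mem (Lfield n ((p : ℤ) * q)) (_ : ℚ)) (mul_mem (_root_.algebraMap_mem (Lfield n ((p : ℤ) * q)) (_ : ℚ)) h3)
    intro x hx
    obtain ⟨f, rfl⟩ := mem_KK.1 hx
    rw [Polynomial.aeval_eq_sum_range]
    apply sum_mem
    intro i _
    rw [Algebra.smul_def]
    exact mul_mem (h4 _) (pow_mem hz i)

end fields

end TwoG

/-- for primes `p ≡ 5 (mod 8)`, `q ≡ 3 (mod 8)` with `(p/q) = 1` and
`-q` a fourth power residue mod `p`, and positive integers `X', Y', Z` solving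
`pX'² + qY'² = Z²` with the listed coprimality and parity conditions: if
`(Z/p)₄ ≠ (2X'/Z)`, then the 2-class group of `L_{n,pq}` is `ℤ/2^{n+3}ℤ` for
all `n ≥ 1`. -/
theorem twoClassGroup_Lfield_pq_legendre_solution
    (p q : ℕ) (hp : p.Prime) (hq : q.Prime)
    (hp8 : p % 8 = 5) (hq8 : q % 8 = 3)
    (hleg : jacobiSym (p : ℤ) q = 1)
    (h4 : ∃ x : ZMod p, x ^ 4 = (-q : ZMod p))
    (X Y Z : ℕ) (hX : 0 < X) (hY : 0 < Y) (hZ : 0 < Z)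
    (heq : p * X ^ 2 + q * Y ^ 2 = Z ^ 2)
    (g1 : Nat.gcd X Y = 1) (g2 : Nat.gcd Y Z = 1) (g3 : Nat.gcd Z X = 1)
    (g4 : Nat.gcd p (Y * Z) = 1) (g5 : Nat.gcd q (X * Z) = 1)
    (hXodd : Odd X) (hYeven : Even Y) (hZ4 : Z % 4 = 1)
    (hcond : ((∃ x : ZMod p, x ^ 4 = (Z : ZMod p)) ∧ jacobiSym (2 * (X : ℤ)) Z = -1) ∨
             ((∃ x : ZMod p, x ^ 2 = (Z : ZMod p)) ∧
              (¬ ∃ x : ZMod p, x ^ 4 = (Z : ZMod p)) ∧ jacobiSym (2 * (X : ℤ)) Z = 1))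
    (n : ℕ) (hn : 1 ≤ n) :
    Nonempty ((twoClassGroup (Lfield n ((p : ℤ) * q))) ≃*
      Multiplicative (ZMod (2 ^ (n + 3)))) := by
  have hne : p ≠ q := by rintro rfl; omega
  have h8 : p * q % 8 = 7 := by rw [Nat.mul_mod, hp8, hq8]
  have hs := TwoG.pq_sqfree hp hq hne
  have hD : 0 < p * q := Nat.pos_of_ne_zero hs.ne_zero
  haveI := TwoG.kD_nf hD
  obtain ⟨Q⟩ := TwoG.qd p q hD h8 hs
  obtain ⟨m, A, B, hm, hA, hB, h⟩ := Q.output hp hq hp8 hq8 X Y Z hZ heq g1 g2 g3 g4 hXodd hYeven hZ4 hcond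
  obtain ⟨Ba⟩ := TwoG.base_exists hp hq hp8 hq8 h8 hs hm hA hB h
  rw [TwoG.Lfield_eq]
  exact Ba.final (TwoG.sq0 hp hq hne hp8 h8) n
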